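/- Let G1 and G2 be planar graphs with V(G1) ∩ V(G2) = {u, v} and with uv an edge of both. Then the 2-sum G with V(G) = V(G1) ∪ V(G2) and E(G) = E(G1) ∪ E(G2) is planar. -/

import Mathlib

open scoped Classical

/-- A graph is planar if it has a straight-line drawing in the plane: vertices map
injectively to points, and two distinct edges (as segments) meet only in images of
shared endpoints.  (By Fáry's theorem this is equivalent to planarity.) -/
def IsPlanar {V : Type*} (G : SimpleGraph V) : Prop :=
  ∃ f : V → ℝ × ℝ, Function.Injective f ∧
    ∀ a b c d : V, G.Adj a b → G.Adj c d → s(a, b) ≠ s(c, d) →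
      segment ℝ (f a) (f b) ∩ segment ℝ (f c) (f d) ⊆ f '' ({a, b} ∩ {c, d} : Set V)

theorem mem_segment_prod {p q r : ℝ × ℝ} : r ∈ segment ℝ p q ↔
    ∃ t : ℝ, 0 ≤ t ∧ t ≤ 1 ∧ r.1 = p.1 + t * (q.1 - p.1) ∧ r.2 = p.2 + t * (q.2 - p.2) := by
  rw [segment_eq_image']
  constructor
  · rintro ⟨t, ⟨h0, h1⟩, rfl⟩
    exact ⟨t, h0, h1, by simp, by simp⟩
  · rintro ⟨t, h0, h1, hx, hy⟩
    exact ⟨t, ⟨h0, h1⟩, Prod.ext (by simp [hx]) (by simp [hy])⟩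

theorem eventually_segment_meets_only_at_base {c p q : ℝ × ℝ} {x : ℝ} (hx : x ≠ c.1)
    (hpq : p.1 = q.1 → p = q)
    (hvis : ∀ r ∈ segment ℝ p q, r.1 = c.1 → r.2 ≤ c.2) :
    ∀ᶠ y in Filter.atTop, ∀ r ∈ segment ℝ c (x, y), r ∈ segment ℝ p q → r = c := by
  by_cases hq : ∃ r ∈ segment ℝ p q, r.1 = c.1
  · obtain ⟨r₀, hr₀, hr₀c⟩ := hq
    have h2 := hvis r₀ hr₀ hr₀c
    obtain ⟨s, hs0, hs1, hsx, hsy⟩ := mem_segment_prod.1 hr₀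
    filter_upwards [Filter.eventually_gt_atTop
      (c.2 + (q.2 - p.2) / (q.1 - p.1) * (x - c.1))] with y hy r hr hr'
    obtain ⟨t, ht0, ht1, htx, hty⟩ := mem_segment_prod.1 hr
    obtain ⟨s', hs0', hs1', hsx', hsy'⟩ := mem_segment_prod.1 hr'
    simp only at htx hty
    have key : r.2 - r₀.2 = (q.2 - p.2) / (q.1 - p.1) * (r.1 - r₀.1) := by
      by_cases h : p.1 = q.1
      · have := hpq h
        subst this
        simp [hsy, hsy']
      · have : q.1 - p.1 ≠ 0 := fun h' => h (by linarith)
        rw [hsx, hsx', hsy, hsy']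
        field_simp
        ring
    have ht : t = 0 := by
      by_contra ht
      have ht : 0 < t := lt_of_le_of_ne ht0 (Ne.symm ht)
      rw [htx, hr₀c, hty] at key
      nlinarith
    exact Prod.ext (by rw [htx, ht]; ring) (by rw [hty, ht]; ring)
  · have hm : ∃ m > 0, ∀ r ∈ segment ℝ p q, m ≤ |r.1 - c.1| := by
      have hne : (segment ℝ p q).Nonempty := ⟨p, left_mem_segment ℝ p q⟩
      have hc : IsCompact (segment ℝ p q) := by
        rw [segment_eq_image']
        exact isCompact_Icc.image (by fun_prop)
      obtain ⟨r, hr, hmin⟩ := hc.exists_isMinOn (f := fun r : ℝ × ℝ => |r.1 - c.1|) hne (by fun_prop)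
      exact ⟨|r.1 - c.1|, abs_pos.2 fun h => hq ⟨r, hr, by linarith⟩, fun r' hr' => hmin hr'⟩
    obtain ⟨m, hm, hmr⟩ := hm
    have hd : 0 < |x - c.1| := abs_pos.2 (sub_ne_zero.2 hx)
    filter_upwards [Filter.eventually_gt_atTop c.2,
      Filter.eventually_gt_atTop (c.2 + (max p.2 q.2 - c.2) * (|x - c.1| / m)),
      Filter.eventually_gt_atTop (max p.2 q.2)] with y hy hy' hy'' r hr hr'
    exfalso
    obtain ⟨t, ht0, ht1, htx, hty⟩ := mem_segment_prod.1 hr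
    obtain ⟨s', hs0', hs1', hsx', hsy'⟩ := mem_segment_prod.1 hr'
    simp only at htx hty
    have h1 := hmr r hr'
    rw [htx, add_sub_cancel_left, abs_mul, abs_of_nonneg ht0] at h1
    have h2 : r.2 ≤ max p.2 q.2 := by
      rw [hsy']
      nlinarith [le_max_left p.2 q.2, le_max_right p.2 q.2]
    have h3 : (max p.2 q.2 - c.2) * |x - c.1| < (y - c.2) * m := by
      have : (max p.2 q.2 - c.2) * (|x - c.1| / m) < y - c.2 := by linarith
      rw [← mul_div_assoc, div_lt_iff₀ hm] at this
      exact this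
    have h4 : (y - c.2) * m ≤ (y - c.2) * (t * |x - c.1|) :=
      mul_le_mul_of_nonneg_left h1 (by linarith)
    have h5 : t * (y - c.2) ≤ max p.2 q.2 - c.2 := by linarith
    nlinarith

/-- A drawing of the graph `H` by segments, loops `H w w` marking the vertices drawn, together
with a list of vertices ordered from left to right from which no part of the drawing lies vertically
above.  All vertices other than the two base vertices are above the horizontal axis. -/
structure ChainDrawing {V : Type*} (u₀ v₀ : V) (H : V → V → Prop) (g : V → ℝ × ℝ)
    (L : List V) : Prop where
  symm : ∀ a b, H a b → H b a
  left : ∀ a b, H a b → H a a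
  finite : {w | H w w}.Finite
  fst_inj : ∀ a b, H a a → H b b → (g a).1 = (g b).1 → a = b
  planar : ∀ a b c d, H a b → H c d → s(a, b) ≠ s(c, d) →
    segment ℝ (g a) (g b) ∩ segment ℝ (g c) (g d) ⊆ g '' ({a, b} ∩ {c, d} : Set V)
  mem_chain : ∀ c ∈ L, H c c
  sorted : L.Pairwise fun a b => (g a).1 < (g b).1
  visible : ∀ c ∈ L, ∀ a b, H a b → ∀ p ∈ segment ℝ (g a) (g b), p.1 = (g c).1 → p.2 ≤ (g c).2
  pos : ∀ w, H w w → w ≠ u₀ → w ≠ v₀ → 0 < (g w).2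

theorem segment_inter_segment_of_det_ne_zero {c c' z p : ℝ × ℝ}
    (h : (c.1 - z.1) * (c'.2 - z.2) - (c.2 - z.2) * (c'.1 - z.1) ≠ 0)
    (hp : p ∈ segment ℝ c z) (hp' : p ∈ segment ℝ c' z) : p = z := by
  rw [segment_symm, mem_segment_prod] at hp hp'
  obtain ⟨t, -, -, hx, hy⟩ := hp
  obtain ⟨s, -, -, hx', hy'⟩ := hp'
  have e1 : t * (c.1 - z.1) = s * (c'.1 - z.1) := by linarith
  have e2 : t * (c.2 - z.2) = s * (c'.2 - z.2) := by linarith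
  have : t = 0 := by
    have : t * ((c.1 - z.1) * (c'.2 - z.2) - (c.2 - z.2) * (c'.1 - z.1)) = 0 := by
      linear_combination (c'.2 - z.2) * e1 - (c'.1 - z.1) * e2
    exact (mul_eq_zero.1 this).resolve_right h
  subst this
  exact Prod.ext (by rw [hx]; ring) (by rw [hy]; ring)

/-- The edges obtained from `H` by joining the vertex `z` to itself and to the elements of `N`. -/
def addVertex {V : Type*} (H : V → V → Prop) (z : V) (N : List V) (a b : V) : Prop :=
  H a b ∨ (a = z ∧ b = z) ∨ (a = z ∧ b ∈ N) ∨ (a ∈ N ∧ b = z)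

theorem ChainDrawing.exists_addVertex {V : Type*} {u₀ v₀ : V} {H : V → V → Prop}
    {g : V → ℝ × ℝ} {l₁ mid l₂ : List V} {a b z : V}
    (h : ChainDrawing u₀ v₀ H g (l₁ ++ a :: (mid ++ b :: l₂))) (hz : ¬ H z z) :
    ∃ g' : V → ℝ × ℝ, (∀ w, w ≠ z → g' w = g w) ∧
      ChainDrawing u₀ v₀ (addVertex H z (a :: (mid ++ [b]))) g' (l₁ ++ a :: z :: b :: l₂) := by
  set N := a :: (mid ++ [b]) with hN
  have hNL : ∀ c ∈ N, c ∈ l₁ ++ a :: (mid ++ b :: l₂) := by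
    intro c hc; simp [hN] at hc ⊢; tauto
  have hNH : ∀ c ∈ N, H c c := fun c hc => h.mem_chain c (hNL c hc)
  have hab : (g a).1 < (g b).1 := by
    have := h.sorted
    rw [List.pairwise_append] at this
    exact List.rel_of_pairwise_cons this.2.1 (by simp)
  obtain ⟨x, ⟨hax, hxb⟩, hxn⟩ := (Set.Ioo_infinite hab).exists_notMem_finset
    (h.finite.toFinset.image fun w => (g w).1)
  have hxn : ∀ w, H w w → (g w).1 ≠ x := by
    intro w hw hwx
    exact hxn (Finset.mem_image.2 ⟨w, by simpa using hw, hwx⟩)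
  have hne : ∀ w, H w w → w ≠ z := fun w hw hwz => hz (hwz ▸ hw)
  have right : ∀ p q, H p q → H q q := fun p q hpq => h.left _ _ (h.symm _ _ hpq)
  have hpairs : {pq : V × V | H pq.1 pq.2}.Finite :=
    (h.finite.prod h.finite).subset fun pq hpq => ⟨h.left _ _ hpq, right _ _ hpq⟩
  have xinj : ∀ p q, H p q → (g p).1 = (g q).1 → g p = g q := by
    intro p q hpq he
    rw [h.fst_inj p q (h.left _ _ hpq) (right _ _ hpq) he]
  have E1 : ∀ᶠ y in Filter.atTop, ∀ c ∈ {c | c ∈ N}, ∀ pq ∈ {pq : V × V | H pq.1 pq.2},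
      ∀ r ∈ segment ℝ (g c) (x, y), r ∈ segment ℝ (g pq.1) (g pq.2) → r = g c := by
    rw [Filter.eventually_all_finite (List.finite_toSet N)]
    intro c hc
    rw [Filter.eventually_all_finite hpairs]
    intro pq hpq
    exact eventually_segment_meets_only_at_base (hxn c (hNH c hc)).symm (xinj _ _ hpq)
      (h.visible c (hNL c hc) _ _ hpq)
  have E2 : ∀ᶠ y in Filter.atTop, ∀ w ∈ {w | H w w}, (g w).2 < y := by
    rw [Filter.eventually_all_finite h.finite]
    exact fun w _ => Filter.eventually_gt_atTop _
  have E3 : ∀ᶠ y in Filter.atTop, ∀ c ∈ {c | c ∈ N}, ∀ c' ∈ {c | c ∈ N}, c ≠ c' →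
      ((g c).1 - x) * ((g c').2 - y) - ((g c).2 - y) * ((g c').1 - x) ≠ 0 := by
    rw [Filter.eventually_all_finite (List.finite_toSet N)]
    intro c hc
    rw [Filter.eventually_all_finite (List.finite_toSet N)]
    intro c' hc'
    by_cases hcc : c = c'
    · simp [hcc]
    have hd : (g c').1 - (g c).1 ≠ 0 := fun h' =>
      hcc (h.fst_inj _ _ (hNH c hc) (hNH c' hc') (by linarith))
    filter_upwards [Filter.eventually_ne_atTop
      (-(((g c).1 - x) * (g c').2 - (g c).2 * ((g c').1 - x)) / ((g c').1 - (g c).1))] with y hy _ h0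
    apply hy
    rw [eq_div_iff hd]
    linarith
  obtain ⟨y, hE1, hE2, hE3, hy0⟩ :=
    (E1.and (E2.and (E3.and (Filter.eventually_gt_atTop 0)))).exists
  replace hE1 : ∀ c ∈ N, ∀ p q, H p q → ∀ r ∈ segment ℝ (g c) (x, y),
      r ∈ segment ℝ (g p) (g q) → r = g c := fun c hc p q hpq => hE1 c hc (p, q) hpq
  replace hE2 : ∀ w, H w w → (g w).2 < y := hE2
  replace hE3 : ∀ c ∈ N, ∀ c' ∈ N, c ≠ c' →
      ((g c).1 - x) * ((g c').2 - y) - ((g c).2 - y) * ((g c').1 - x) ≠ 0 := hE3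
  have haN : a ∈ N := by simp [hN]
  set g' := Function.update g z (x, y) with hg'
  have gz : g' z = (x, y) := by simp [hg']
  have gne : ∀ w, w ≠ z → g' w = g w := fun w hw => by simp [hg', hw]
  have gH : ∀ w, H w w → g' w = g w := fun w hw => gne w (hne w hw)
  have gN : ∀ w ∈ N, g' w = g w := fun w hw => gH w (hNH w hw)
  have segx : ∀ c ∈ N, ∀ p ∈ segment ℝ (g c) (x, y), p.1 = (g c).1 → p = g c := by
    intro c hc p hp hpx
    obtain ⟨t, -, -, h1, h2⟩ := mem_segment_prod.1 hp
    have : t = 0 := by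
      have : t * (x - (g c).1) = 0 := by simp only at h1; linarith
      exact (mul_eq_zero.1 this).resolve_right fun h' => hxn c (hNH c hc) (by linarith)
    subst this
    exact Prod.ext (by rw [h1]; ring) (by rw [h2]; ring)
  have segz : ∀ c ∈ N, ∀ p ∈ segment ℝ (g c) (x, y), p.1 = x → p = (x, y) := by
    intro c hc p hp hpx
    obtain ⟨t, -, -, h1, h2⟩ := mem_segment_prod.1 hp
    simp only at h1 h2
    have : t = 1 := by
      have : (t - 1) * (x - (g c).1) = 0 := by linarith
      linarith [(mul_eq_zero.1 this).resolve_right fun h' => hxn c (hNH c hc) (by linarith)]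
    subst this
    exact Prod.ext (by rw [h1]; ring) (by rw [h2]; ring)
  -- every edge is old, a loop at `z`, or joins `z` to an element of `N`
  have planarNew : ∀ c ∈ z :: N, ∀ p q, addVertex H z N p q → s(c, z) ≠ s(p, q) →
      segment ℝ (g' c) (g' z) ∩ segment ℝ (g' p) (g' q) ⊆ g' '' ({c, z} ∩ {p, q} : Set V) := by
    have old : ∀ c ∈ z :: N, ∀ p q, H p q →
        segment ℝ (g' c) (g' z) ∩ segment ℝ (g' p) (g' q) ⊆ g' '' ({c, z} ∩ {p, q} : Set V) := by
      intro c hc p q hpq r hr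
      rw [gH p (h.left _ _ hpq), gH q (right _ _ hpq)] at hr
      rcases List.mem_cons.1 hc with rfl | hc
      · rw [segment_same, gz] at hr
        have hr1 := hr.1
        rw [Set.mem_singleton_iff] at hr1
        subst hr1
        have := hE1 a haN p q hpq _ (right_mem_segment ℝ _ _) hr.2
        exact absurd (congrArg Prod.fst this).symm (hxn a (hNH a haN))
      · rw [gz, gN c hc] at hr
        have hrc := hE1 c hc p q hpq r hr.1 hr.2
        subst hrc
        refine ⟨c, ⟨by simp, ?_⟩, gN c hc⟩
        by_cases hs : s(c, c) = s(p, q)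
        · rw [Sym2.eq_iff] at hs
          simp; tauto
        · obtain ⟨w, ⟨hw1, hw2⟩, -⟩ := h.planar c c p q (hNH c hc) hpq hs
            ⟨left_mem_segment ℝ _ _, hr.2⟩
          simp at hw1
          exact hw1 ▸ hw2
    have new : ∀ c ∈ z :: N, ∀ c' ∈ z :: N, s(c, z) ≠ s(c', z) →
        segment ℝ (g' c) (g' z) ∩ segment ℝ (g' c') (g' z) ⊆ {g' z} := by
      rintro c hc c' hc' hs r ⟨hr, hr'⟩
      rcases List.mem_cons.1 hc with rfl | hc
      · simpa using hr
      rcases List.mem_cons.1 hc' with rfl | hc'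
      · simpa using hr'
      rw [gN c hc, gz] at hr
      rw [gN c' hc', gz] at hr'
      rw [gz]
      exact segment_inter_segment_of_det_ne_zero
        (hE3 c hc c' hc' fun h' => hs (by rw [h'])) hr hr'
    rintro c hc p q (hpq | ⟨rfl, rfl⟩ | ⟨rfl, hq⟩ | ⟨hp, rfl⟩) hs r hr
    · exact old c hc p q hpq hr
    · exact ⟨q, by simp, (new c hc q (by simp) hs hr).symm⟩
    · rw [segment_symm ℝ (g' p)] at hr
      rw [Sym2.eq_swap (a := p)] at hs
      exact ⟨p, by simp, (new c hc q (by simp [hq]) hs hr).symm⟩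
    · exact ⟨q, by simp, (new c hc p (by simp [hp]) hs hr).symm⟩
  have hsplit : ∀ p q, addVertex H z N p q → H p q ∨ (∃ c ∈ z :: N, (p = c ∧ q = z)) ∨
      (∃ c ∈ z :: N, (p = z ∧ q = c)) := by
    rintro p q (hpq | ⟨rfl, rfl⟩ | ⟨rfl, hq⟩ | ⟨hp, rfl⟩)
    · exact Or.inl hpq
    · exact Or.inr (Or.inl ⟨q, by simp, rfl, rfl⟩)
    · exact Or.inr (Or.inr ⟨q, by simp [hq], rfl, rfl⟩)
    · exact Or.inr (Or.inl ⟨p, by simp [hp], rfl, rfl⟩)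
  have loop : ∀ w, addVertex H z N w w → H w w ∨ w = z := by
    rintro w (hw | ⟨rfl, -⟩ | ⟨rfl, -⟩ | ⟨-, rfl⟩) <;> simp [*]
  refine ⟨g', gne, ⟨?_, ?_, ?_, ?_, ?_, ?_, ?_, ?_, ?_⟩⟩
  · rintro p q (hpq | ⟨rfl, rfl⟩ | ⟨rfl, hq⟩ | ⟨hp, rfl⟩)
    · exact Or.inl (h.symm _ _ hpq)
    · exact Or.inr (Or.inl ⟨rfl, rfl⟩)
    · exact Or.inr (Or.inr (Or.inr ⟨hq, rfl⟩))
    · exact Or.inr (Or.inr (Or.inl ⟨rfl, hp⟩))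
  · rintro p q (hpq | ⟨rfl, rfl⟩ | ⟨rfl, hq⟩ | ⟨hp, rfl⟩)
    · exact Or.inl (h.left _ _ hpq)
    · exact Or.inr (Or.inl ⟨rfl, rfl⟩)
    · exact Or.inr (Or.inl ⟨rfl, rfl⟩)
    · exact Or.inl (hNH p hp)
  · exact (h.finite.insert z).subset fun w hw => by
      rcases loop w hw with h' | rfl
      · exact Or.inr h'
      · exact Or.inl rfl
  · intro p q hp hq he
    rcases loop p hp with hp1 | hp1 <;> rcases loop q hq with hq1 | hq1
    · rw [gH p hp1, gH q hq1] at he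
      exact h.fst_inj p q hp1 hq1 he
    · rw [gH p hp1, hq1, gz] at he
      exact absurd he (hxn p hp1)
    · rw [gH q hq1, hp1, gz] at he
      exact absurd he.symm (hxn q hq1)
    · rw [hp1, hq1]
  · intro p q p' q' hpq hpq' hs
    rcases hsplit p q hpq with h1 | ⟨c, hc, rfl, rfl⟩ | ⟨c, hc, rfl, rfl⟩
    · rcases hsplit p' q' hpq' with h2 | ⟨c, hc, rfl, rfl⟩ | ⟨c, hc, rfl, rfl⟩
      · rintro r hr
        rw [gH p (h.left _ _ h1), gH q (right _ _ h1), gH p' (h.left _ _ h2),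
          gH q' (right _ _ h2)] at hr
        obtain ⟨w, hw, rfl⟩ := h.planar p q p' q' h1 h2 hs hr
        refine ⟨w, hw, gH w ?_⟩
        rcases hw.1 with rfl | rfl
        · exact h.left _ _ h1
        · exact right _ _ h1
      · rw [Set.inter_comm, Set.inter_comm {p, q}]
        exact planarNew _ hc p q hpq hs.symm
      · rw [Set.inter_comm, Set.inter_comm {p, q}, segment_symm ℝ (g' p'), Set.pair_comm p']
        exact planarNew _ hc p q hpq (by rw [Sym2.eq_swap]; exact hs.symm)
    · exact planarNew _ hc p' q' hpq' hs
    · rw [segment_symm ℝ (g' p), Set.pair_comm p]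
      exact planarNew _ hc p' q' hpq' (by rw [Sym2.eq_swap]; exact hs)
  · intro c hc
    simp only [List.mem_append, List.mem_cons] at hc
    by_cases hcz : c = z
    · exact Or.inr (Or.inl ⟨hcz, hcz⟩)
    · exact Or.inl (h.mem_chain c (by simp; tauto))
  · have hs := h.sorted
    simp only [List.pairwise_append, List.pairwise_cons, List.mem_append, List.mem_cons] at hs ⊢
    have h1 : ∀ w ∈ l₁, (g' w).1 = (g w).1 := fun w hw =>
      by rw [gH w (h.mem_chain w (by simp [hw]))]
    have h2 : ∀ w ∈ l₂, (g' w).1 = (g w).1 := fun w hw =>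
      by rw [gH w (h.mem_chain w (by simp [hw]))]
    have ha' : (g' a).1 = (g a).1 := by rw [gN a haN]
    have hb' : (g' b).1 = (g b).1 := by rw [gN b (by simp [hN])]
    refine ⟨hs.1.imp_of_mem ?_, ⟨?_, ?_, ?_, hs.2.1.2.2.1.2.imp_of_mem ?_⟩, ?_⟩
    · intro p q hp hq hpq
      rwa [h1 p hp, h1 q hq]
    · rintro w (rfl | rfl | hw)
      · rw [ha', gz]; exact hax
      · rw [ha', hb']; exact hab
      · rw [ha', h2 w hw]; exact hs.2.1.1 w (by tauto)
    · rintro w (rfl | hw)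
      · rw [gz, hb']; exact hxb
      · rw [gz, h2 w hw]
        exact hxb.trans (hs.2.1.2.2.1.1 w hw)
    · intro w hw
      rw [hb', h2 w hw]; exact hs.2.1.2.2.1.1 w hw
    · intro p q hp hq hpq
      rwa [h2 p hp, h2 q hq]
    · rintro p hp w (rfl | rfl | rfl | hw)
      · rw [h1 p hp, ha']; exact hs.2.2 p hp _ (by tauto)
      · rw [h1 p hp, gz]
        exact (hs.2.2 p hp a (by tauto)).trans hax
      · rw [h1 p hp, hb']; exact hs.2.2 p hp _ (by tauto)
      · rw [h1 p hp, h2 w hw]; exact hs.2.2 p hp _ (by tauto)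
  · have hord : ∀ c ∈ l₁ ++ a :: z :: b :: l₂, c ≠ z → (g c).1 ≤ (g a).1 ∨ (g b).1 ≤ (g c).1 := by
      intro c hc hcz
      have hs := h.sorted
      simp only [List.pairwise_append, List.pairwise_cons, List.mem_append, List.mem_cons] at hs hc
      rcases hc with hc | rfl | rfl | rfl | hc
      · exact Or.inl (hs.2.2 c hc a (by tauto)).le
      · exact Or.inl le_rfl
      · exact absurd rfl hcz
      · exact Or.inr le_rfl
      · exact Or.inr (hs.2.1.2.2.1.1 c hc).le
    have hNord : ∀ c ∈ N, (g a).1 ≤ (g c).1 ∧ (g c).1 ≤ (g b).1 := by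
      intro c hc
      have hs := h.sorted
      simp only [List.pairwise_append, List.pairwise_cons, List.mem_append, List.mem_cons] at hs
      simp only [hN, List.mem_append, List.mem_cons, List.not_mem_nil, or_false] at hc
      rcases hc with rfl | hc | rfl
      · exact ⟨le_rfl, hab.le⟩
      · exact ⟨(hs.2.1.1 c (by tauto)).le, (hs.2.1.2.2.2 c hc b (by tauto)).le⟩
      · exact ⟨hab.le, le_rfl⟩
    have visNew : ∀ c ∈ l₁ ++ a :: z :: b :: l₂, ∀ d ∈ z :: N, ∀ p ∈ segment ℝ (g' d) (g' z),
        p.1 = (g' c).1 → p.2 ≤ (g' c).2 := by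
      intro c hc d hd p hp hpc
      by_cases hcz : c = z
      · subst hcz
        rcases List.mem_cons.1 hd with rfl | hd
        · rw [segment_same] at hp
          rw [hp]
        · rw [gN d hd, gz] at hp
          rw [gz] at hpc ⊢
          rw [segz d hd p hp hpc]
      · rw [gne c hcz] at hpc ⊢
        have hcH : H c c := h.mem_chain c (by simp at hc ⊢; tauto)
        rcases List.mem_cons.1 hd with rfl | hd
        · rw [segment_same, gz] at hp
          rw [Set.mem_singleton_iff.1 hp] at hpc
          exact absurd hpc.symm (hxn c hcH)
        · rw [gN d hd, gz] at hp
          by_cases hdc : d = c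
          · subst hdc
            rw [segx d hd p hp hpc]
          exfalso
          obtain ⟨t, h0, h1, hpx, -⟩ := mem_segment_prod.1 hp
          simp only at hpx
          have hne' : (g d).1 ≠ (g c).1 := fun he => hdc (h.fst_inj _ _ (hNH d hd) hcH he)
          obtain ⟨hd1, hd2⟩ := hNord d hd
          rcases hord c hc hcz with hc' | hc'
          · have : (g c).1 < (g d).1 := lt_of_le_of_ne (by linarith) hne'.symm
            rcases h0.eq_or_lt with rfl | h0
            · linarith
            · nlinarith [mul_pos h0 (by linarith : 0 < x - (g c).1),
                mul_nonneg (sub_nonneg.2 h1) (sub_pos.2 this).le]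
          · have : (g d).1 < (g c).1 := lt_of_le_of_ne (by linarith) hne'
            rcases h0.eq_or_lt with rfl | h0
            · linarith
            · nlinarith [mul_pos h0 (by linarith : 0 < (g c).1 - x),
                mul_nonneg (sub_nonneg.2 h1) (sub_pos.2 this).le]
    intro c hc p q hpq r hr hrc
    rcases hsplit p q hpq with h1 | ⟨d, hd, rfl, rfl⟩ | ⟨d, hd, rfl, rfl⟩
    · rw [gH p (h.left _ _ h1), gH q (right _ _ h1)] at hr
      by_cases hcz : c = z
      · subst hcz
        rw [gz]
        obtain ⟨t, h0, h1', -, hpy⟩ := mem_segment_prod.1 hr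
        have := hE2 p (h.left _ _ h1)
        have := hE2 q (right _ _ h1)
        simp only
        nlinarith
      · rw [gne c hcz] at hrc ⊢
        exact h.visible c (by simp at hc ⊢; tauto) p q h1 r hr hrc
    · exact visNew c hc _ hd r hr hrc
    · rw [segment_symm] at hr
      exact visNew c hc _ hd r hr hrc
  · intro w hw hu hv
    rcases loop w hw with hw | rfl
    · rw [gH w hw]; exact h.pos w hw hu hv
    · rw [gz]; exact hy0

/-- The number modulo two of members of `S` containing both `a` and `b`. -/
noncomputable def bd {V : Type*} (S : Finset (Finset V)) (a b : V) : ZMod 2 :=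
  ∑ T ∈ S, if a ∈ T ∧ b ∈ T then 1 else 0

/-- The number modulo two of times the walk `l` traverses the edge `ab`. -/
noncomputable def pathInd {V : Type*} : List V → V → V → ZMod 2
  | [], _, _ => 0
  | [_], _, _ => 0
  | x :: y :: l, a, b => (if s(x, y) = s(a, b) then 1 else 0) + pathInd (y :: l) a b

theorem zmod_two_self {x : ZMod 2} : x + x = 0 := CharTwo.add_self_eq_zero x

section bd
variable {V : Type*} {S S' : Finset (Finset V)} {a b : V}

theorem bd_comm (S : Finset (Finset V)) (a b : V) : bd S a b = bd S b a := by
  simp only [bd, and_comm]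

theorem bd_empty (a b : V) : bd ∅ a b = 0 := by simp [bd]

theorem bd_union (h : Disjoint S S') (a b : V) : bd (S ∪ S') a b = bd S a b + bd S' a b :=
  Finset.sum_union h

theorem bd_symmDiff (S S' : Finset (Finset V)) (a b : V) :
    bd (symmDiff S S') a b = bd S a b + bd S' a b := by
  have h1 : bd S a b = bd (S \ S') a b + bd (S ∩ S') a b := by
    rw [← bd_union (Finset.disjoint_sdiff_inter S S'), Finset.sdiff_union_inter]
  have h2 : bd S' a b = bd (S' \ S) a b + bd (S ∩ S') a b := by
    rw [Finset.inter_comm, ← bd_union (Finset.disjoint_sdiff_inter S' S),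
      Finset.sdiff_union_inter]
  have h3 : symmDiff S S' = S \ S' ∪ S' \ S := rfl
  rw [h3, bd_union disjoint_sdiff_sdiff, h1, h2]
  linear_combination -(zmod_two_self (x := bd (S ∩ S') a b))

theorem bd_erase {T : Finset V} (hT : T ∈ S) (a b : V) :
    bd (S.erase T) a b = bd S a b + if a ∈ T ∧ b ∈ T then 1 else 0 := by
  have : bd S a b = (if a ∈ T ∧ b ∈ T then 1 else 0) + bd (S.erase T) a b :=
    (Finset.add_sum_erase S _ hT).symm
  rw [this]
  linear_combination -(zmod_two_self (x := if a ∈ T ∧ b ∈ T then (1 : ZMod 2) else 0))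

theorem exists_of_bd_ne_zero (h : bd S a b ≠ 0) : ∃ T ∈ S, a ∈ T ∧ b ∈ T := by
  by_contra! hne
  exact h (Finset.sum_eq_zero fun T hT => if_neg fun h' => hne T hT h'.1 h'.2)

theorem bd_congr (h : ∀ T, a ∈ T → (T ∈ S ↔ T ∈ S')) (b : V) : bd S a b = bd S' a b := by
  simp only [bd, ← Finset.sum_filter]
  congr 1
  ext T
  simp only [Finset.mem_filter]
  constructor <;> rintro ⟨h1, h2, h3⟩
  · exact ⟨(h T h2).1 h1, h2, h3⟩
  · exact ⟨(h T h2).2 h1, h2, h3⟩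

end bd

section pathInd
variable {V : Type*} {a b x y : V} {l : List V}

theorem pathInd_append (l₁ : List V) (x : V) (l₂ : List V) (a b : V) :
    pathInd (l₁ ++ x :: l₂) a b = pathInd (l₁ ++ [x]) a b + pathInd (x :: l₂) a b := by
  induction l₁ with
  | nil => simp [pathInd]
  | cons y l₁ ih =>
    cases l₁ with
    | nil => simp [pathInd]
    | cons z l₁ =>
      simp only [List.cons_append, pathInd] at ih ⊢
      rw [ih, add_assoc]

theorem pathInd_eq_zero_left (h : a ∉ l) : pathInd l a b = 0 := by
  induction l with
  | nil => rfl
  | cons y l ih =>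
    cases l with
    | nil => rfl
    | cons z l =>
      simp only [List.mem_cons, not_or] at h ih
      rw [pathInd, ih h.2, if_neg, add_zero]
      rw [Sym2.eq_iff]
      tauto

theorem pathInd_comm (l : List V) (a b : V) : pathInd l a b = pathInd l b a := by
  induction l with
  | nil => rfl
  | cons y l ih =>
    cases l with
    | nil => rfl
    | cons z l => rw [pathInd, pathInd, ih, Sym2.eq_swap (a := a)]

theorem pathInd_eq_zero_right (h : b ∉ l) : pathInd l a b = 0 := by
  rw [pathInd_comm, pathInd_eq_zero_left h]

theorem pathInd_eq_one {l₁ l₂ : List V} (h₁ : y ∉ l₁) (hxy : x ≠ y) (h₂ : y ∉ l₂)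
    (hx : l₂.head? ≠ some x) : pathInd (l₁ ++ x :: y :: l₂) x y = 1 := by
  rw [pathInd_append, pathInd_eq_zero_right (by simp [h₁, hxy.symm]), pathInd, if_pos rfl]
  cases l₂ with
  | nil => simp [pathInd]
  | cons z l =>
    rw [pathInd, pathInd_eq_zero_right h₂, if_neg]
    · ring
    · simp at hx h₂
      rw [Sym2.eq_iff]
      tauto

end pathInd

/-- Two distinct vertices lying on a common face. -/
def FaceEdge {V : Type*} (𝓕 : Finset (Finset V)) (a b : V) : Prop :=
  a ≠ b ∧ ∃ T ∈ 𝓕, a ∈ T ∧ b ∈ T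

/-- A finite set of triangles that behaves like a triangulated sphere. -/
structure IsSphere {V : Type*} (𝓕 : Finset (Finset V)) : Prop where
  card_face : ∀ T ∈ 𝓕, T.card = 3
  exists_opposite : ∀ T ∈ 𝓕, ∀ a ∈ T, ∀ b ∈ T, a ≠ b → ∃ T' ∈ 𝓕, T' ≠ T ∧ a ∈ T' ∧ b ∈ T' ∧
    ∀ T'' ∈ 𝓕, a ∈ T'' → b ∈ T'' → T'' = T ∨ T'' = T'
  connected_at : ∀ S ⊆ 𝓕, ∀ w, (∀ a, a ≠ w → bd S w a = 0) → ∀ T ∈ S, w ∈ T →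
    ∀ T' ∈ 𝓕, w ∈ T' → T' ∈ S
  connected : ∀ S ⊆ 𝓕, (∀ a b, a ≠ b → bd S a b = 0) → S = ∅ ∨ S = 𝓕
  exists_filling : ∀ x l, (x :: l ++ [x]).IsChain (FaceEdge 𝓕) →
    ∃ S ⊆ 𝓕, ∀ a b, a ≠ b → bd S a b = pathInd (x :: l ++ [x]) a b

theorem List.IsChain.iff_of_mem {V : Type*} {p : V → Prop} {l : List V}
    (h : l.IsChain fun a b => (p a ↔ p b)) {a b : V} (ha : a ∈ l) (hb : b ∈ l) : p a ↔ p b := by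
  have : IsTrans V fun a b => (p a ↔ p b) := ⟨fun a b c h h' => h.trans h'⟩
  have : Std.Symm fun a b => (p a ↔ p b) := ⟨fun a b h => h.symm⟩
  exact List.Pairwise.forall_of_forall (R := fun a b => (p a ↔ p b)) (fun _ _ => Iff.rfl)
    (List.isChain_iff_pairwise.1 h) ha hb

namespace IsSphere
variable {V : Type*} {𝓕 F : Finset (Finset V)}

theorem bd_univ (h : IsSphere 𝓕) {a b : V} (hab : a ≠ b) : bd 𝓕 a b = 0 := by
  by_cases hT : ∃ T ∈ 𝓕, a ∈ T ∧ b ∈ T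
  · obtain ⟨T, hT, ha, hb⟩ := hT
    obtain ⟨T', hT', hne, ha', hb', hall⟩ := h.exists_opposite T hT a ha b hb hab
    have : (𝓕.filter fun T => a ∈ T ∧ b ∈ T) = {T, T'} := by
      ext T''
      simp only [Finset.mem_filter, Finset.mem_insert, Finset.mem_singleton]
      constructor
      · rintro ⟨h1, h2, h3⟩; exact hall T'' h1 h2 h3
      · rintro (rfl | rfl) <;> simp [*]
    rw [bd, Finset.sum_boole, this, Finset.card_pair hne.symm]
    rfl
  · by_contra h0
    exact hT (exists_of_bd_ne_zero h0)

theorem exists_face_of_bd_ne_zero (h : IsSphere 𝓕) (hF : F ⊆ 𝓕) {d c : V} (hdc : d ≠ c)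
    (h1 : bd F d c ≠ 0) : ∃ T ∈ F, ∃ t, t ≠ d ∧ t ≠ c ∧ (∀ x, x ∈ T ↔ x = d ∨ x = c ∨ x = t) ∧
      ∀ T' ∈ F, d ∈ T' → c ∈ T' → T' = T := by
  obtain ⟨T, hT, hd, hc⟩ := exists_of_bd_ne_zero h1
  obtain ⟨T₂, hT₂, hne, hd₂, hc₂, hall⟩ := h.exists_opposite T (hF hT) d hd c hc hdc
  have hcard : ((T.erase d).erase c).card = 1 := by
    rw [Finset.card_erase_of_mem (by simp [hc, hdc.symm]), Finset.card_erase_of_mem hd,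
      h.card_face T (hF hT)]
  obtain ⟨t, ht⟩ := Finset.card_eq_one.1 hcard
  have ht' : ∀ x, (x ≠ c ∧ x ≠ d ∧ x ∈ T) ↔ x = t := fun x => by
    rw [← Finset.mem_singleton, ← ht]; simp
  refine ⟨T, hT, t, ((ht' t).2 rfl).2.1, ((ht' t).2 rfl).1, fun x => ?_, fun T' hT' hd' hc' => ?_⟩
  · have := ht' x
    by_cases hx : x = d
    · simp [hx, hd]
    by_cases hx' : x = c
    · simp [hx', hc]
    tauto
  · refine (hall T' (hF hT') hd' hc').resolve_right ?_
    rintro rfl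
    refine h1 ?_
    rw [← h.bd_univ hdc, bd, bd]
    refine Finset.sum_subset hF fun T'' h2 h3 => if_neg ?_
    rintro ⟨h4, h5⟩
    rcases hall T'' h2 h4 h5 with rfl | rfl <;> contradiction

theorem exists_filling_avoiding (h : IsSphere 𝓕) {x : V} {l : List V}
    (hl : (x :: l ++ [x]).IsChain (FaceEdge 𝓕)) (T : Finset V) :
    ∃ S ⊆ 𝓕, T ∉ S ∧ ∀ a b, a ≠ b → bd S a b = pathInd (x :: l ++ [x]) a b := by
  obtain ⟨S, hS, hbd⟩ := h.exists_filling x l hl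
  by_cases hT : T ∈ S
  · refine ⟨𝓕 \ S, Finset.sdiff_subset, by simp [hT], fun a b hab => ?_⟩
    rw [← hbd a b hab]
    have := bd_union (S := 𝓕 \ S) (S' := S) Finset.sdiff_disjoint a b
    rw [Finset.sdiff_union_of_subset hS, h.bd_univ hab] at this
    linear_combination -this - zmod_two_self (x := bd S a b)
  · exact ⟨S, hS, hT, hbd⟩

theorem not_mem_of_isChain (h : IsSphere 𝓕) {S : Finset (Finset V)} (hS : S ⊆ 𝓕) {l : List V}
    (hl : l.IsChain (FaceEdge 𝓕)) (h0 : ∀ w ∈ l, ∀ a, a ≠ w → bd S w a = 0) {T : Finset V}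
    (hT : T ∈ 𝓕) (hTS : T ∉ S) {d : V} (hd : d ∈ l) (hdT : d ∈ T) {w : V} (hw : w ∈ l) :
    ∀ T' ∈ S, w ∉ T' := by
  have key : (∃ T' ∈ S, w ∈ T') ↔ ∃ T' ∈ S, d ∈ T' := by
    have hc : l.IsChain fun a b => ((∃ T' ∈ S, a ∈ T') ↔ ∃ T' ∈ S, b ∈ T') := by
      refine List.IsChain.imp_of_mem_imp ?_ hl
      rintro a b ha hb ⟨-, T₁, hT₁, ha₁, hb₁⟩
      constructor
      · rintro ⟨T', hT', haT'⟩
        exact ⟨T₁, h.connected_at S hS a (h0 a ha) T' hT' haT' T₁ hT₁ ha₁, hb₁⟩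
      · rintro ⟨T', hT', haT'⟩
        exact ⟨T₁, h.connected_at S hS b (h0 b hb) T' hT' haT' T₁ hT₁ hb₁, ha₁⟩
    exact hc.iff_of_mem hw hd
  intro T' hT' hwT'
  obtain ⟨T₂, hT₂, hd₂⟩ := key.1 ⟨T', hT', hwT'⟩
  exact hTS (h.connected_at S hS d (h0 d hd) T₂ hT₂ hd₂ T hT hdT)

end IsSphere

theorem triangle_pairs {V : Type*} {d c t a b : V} (hdc : d ≠ c) (hdt : d ≠ t) (hct : c ≠ t)
    (hab : a ≠ b) : (if (a = d ∨ a = c ∨ a = t) ∧ (b = d ∨ b = c ∨ b = t) then (1 : ZMod 2) else 0) =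
      (if s(d, c) = s(a, b) then 1 else 0) + (if s(d, t) = s(a, b) then 1 else 0) +
        (if s(t, c) = s(a, b) then 1 else 0) := by
  by_cases h : (a = d ∨ a = c ∨ a = t) ∧ (b = d ∨ b = c ∨ b = t)
  · obtain ⟨rfl | rfl | rfl, rfl | rfl | rfl⟩ := h <;>
      simp [hdc, hdt, hct, hdc.symm, hdt.symm, hct.symm] at hab ⊢
  · rw [if_neg h]
    simp only [not_and_or, not_or] at h
    rcases h with ⟨h1, h2, h3⟩ | ⟨h1, h2, h3⟩ <;>
      simp [Ne.symm h1, Ne.symm h2, Ne.symm h3]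

namespace IsSphere
variable {V : Type*} {𝓕 F : Finset (Finset V)}

theorem exists_split (h : IsSphere 𝓕) (hF : F ⊆ 𝓕) {P P' R₁ R₂ : List V} {u d c t : V}
    {T : Finset V} (hu : P ++ [d] = u :: P')
    (hnd : (P ++ d :: c :: (R₁ ++ t :: R₂)).Nodup)
    (hch : (P ++ d :: c :: (R₁ ++ t :: (R₂ ++ [u]))).IsChain (FaceEdge 𝓕))
    (hT : T ∈ F) (hTm : ∀ x, x ∈ T ↔ x = d ∨ x = c ∨ x = t)
    (hbd : ∀ a b, a ≠ b → bd F a b = pathInd (P ++ d :: c :: (R₁ ++ t :: (R₂ ++ [u]))) a b) :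
    ∃ S S', S ∪ S' = F.erase T ∧
      (∀ a b, a ≠ b → bd S a b = pathInd (P ++ d :: t :: (R₂ ++ [u])) a b) ∧
      (∀ a b, a ≠ b → bd S' a b = pathInd (c :: (R₁ ++ t :: [c])) a b) ∧
      (P ++ d :: t :: (R₂ ++ [u])).IsChain (FaceEdge 𝓕) ∧
      (c :: (R₁ ++ t :: [c])).IsChain (FaceEdge 𝓕) ∧
      (∀ w ∈ P ++ d :: R₂, ∀ T' ∈ S', w ∉ T') ∧ (∀ w ∈ c :: R₁, ∀ T' ∈ S, w ∉ T') ∧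
      ∀ w, ∀ T₁ ∈ S, w ∈ T₁ → ∀ T₂ ∈ S', w ∈ T₂ → w = t := by
  have hTF := hF hT
  have hd : d ∈ T := by simp [hTm]
  have hc : c ∈ T := by simp [hTm]
  have ht : t ∈ T := by simp [hTm]
  have hnd' := hnd
  simp only [List.nodup_append, List.nodup_cons, List.mem_cons, List.mem_append] at hnd'
  have hdt : d ≠ t := fun e => by simp [e] at hnd'
  have hdc : d ≠ c := fun e => by simp [e] at hnd'
  have hct : c ≠ t := fun e => by simp [e] at hnd'
  have huP : u ∈ P ++ [d] := by simp [hu]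
  have hudef : u ∈ P ∨ u = d := by simpa using huP
  obtain ⟨hch1, hch2, hch3⟩ := List.isChain_append_cons_cons.1 hch
  obtain ⟨hch4, hch5⟩ := (List.isChain_split (l₁ := c :: R₁)).1 hch3
  have edt : FaceEdge 𝓕 d t := ⟨hdt, T, hTF, hd, ht⟩
  have etc : FaceEdge 𝓕 t c := ⟨hct.symm, T, hTF, ht, hc⟩
  have ch1 : (P ++ d :: t :: (R₂ ++ [u])).IsChain (FaceEdge 𝓕) :=
    List.isChain_append_cons_cons.2 ⟨hch1, edt, hch5⟩
  have ch2 : (c :: (R₁ ++ t :: [c])).IsChain (FaceEdge 𝓕) :=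
    (List.isChain_append_cons_cons (l₁ := c :: R₁)).2 ⟨hch4, etc, List.isChain_singleton _⟩
  have e1 : P ++ d :: t :: (R₂ ++ [u]) = u :: (P' ++ t :: R₂) ++ [u] := by
    simp only [← List.cons_append, ← hu, List.append_assoc]
    simp
  have e2 : c :: (R₁ ++ t :: [c]) = c :: (R₁ ++ [t]) ++ [c] := by simp
  obtain ⟨S, hS, hTS, hbS⟩ := h.exists_filling_avoiding (e1 ▸ ch1) T
  obtain ⟨S', hS', hTS', hbS'⟩ := h.exists_filling_avoiding (e2 ▸ ch2) T
  rw [← e1] at hbS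
  rw [← e2] at hbS'
  have z1 : ∀ w ∈ c :: R₁, ∀ a, a ≠ w → bd S w a = 0 := by
    intro w hw a ha
    rw [hbS w a ha.symm, pathInd_eq_zero_left]
    intro hw'
    simp only [List.mem_append, List.mem_cons, List.not_mem_nil, or_false] at hw hw'
    grind
  have z2 : ∀ w ∈ P ++ d :: R₂, ∀ a, a ≠ w → bd S' w a = 0 := by
    intro w hw a ha
    rw [hbS' w a ha.symm, pathInd_eq_zero_left]
    intro hw'
    simp only [List.mem_append, List.mem_cons, List.not_mem_nil, or_false] at hw hw'
    grind
  have n1 : ∀ w ∈ c :: R₁, ∀ T' ∈ S, w ∉ T' := fun w hw =>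
    h.not_mem_of_isChain hS ((List.isChain_append (l₁ := c :: R₁)).1 hch3).1 z1 hTF hTS
      (by simp) hc hw
  have n2 : ∀ w ∈ P ++ d :: R₂, ∀ T' ∈ S', w ∉ T' := by
    intro w hw
    have ch : (R₂ ++ (P ++ [d])).IsChain (FaceEdge 𝓕) := by
      rw [hu, List.isChain_split, ← hu]
      refine ⟨?_, hch1⟩
      exact hch5.tail
    refine h.not_mem_of_isChain hS' ch (fun w hw => z2 w ?_) hTF hTS' (d := d) (by simp) hd ?_
    · simp at hw ⊢; tauto
    · simp at hw ⊢; tauto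
  have z3 : ∀ w, w ∉ c :: R₁ → w ∉ P ++ d :: R₂ → w ≠ t →
      (∀ a, a ≠ w → bd S w a = 0) ∧ (∀ a, a ≠ w → bd S' w a = 0) := by
    intro w hw1 hw2 hwt
    constructor
    · intro a ha
      rw [hbS w a ha.symm, pathInd_eq_zero_left]
      simp at hw1 hw2 ⊢
      grind
    · intro a ha
      rw [hbS' w a ha.symm, pathInd_eq_zero_left]
      simp at hw1 hw2 ⊢
      grind
  have hz : ∀ w a, w ≠ t → a ≠ w → bd (S ∩ S') w a = 0 := by
    intro w a hwt haw
    by_cases hw1 : w ∈ c :: R₁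
    · by_contra h0
      obtain ⟨T', hT', hw', -⟩ := exists_of_bd_ne_zero h0
      exact n1 w hw1 T' (Finset.mem_inter.1 hT').1 hw'
    by_cases hw2 : w ∈ P ++ d :: R₂
    · by_contra h0
      obtain ⟨T', hT', hw', -⟩ := exists_of_bd_ne_zero h0
      exact n2 w hw2 T' (Finset.mem_inter.1 hT').2 hw'
    obtain ⟨h1, h2⟩ := z3 w hw1 hw2 hwt
    by_cases hw3 : ∃ T' ∈ S', w ∈ T'
    · obtain ⟨T', hT', hwT'⟩ := hw3
      rw [← h1 a haw]
      refine bd_congr (fun T₁ hT₁ => ⟨fun h' => (Finset.mem_inter.1 h').1, fun h' =>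
        Finset.mem_inter.2 ⟨h', h.connected_at S' hS' w h2 T' hT' hwT' T₁ (hS h') hT₁⟩⟩) a
    · by_contra h0
      obtain ⟨T', hT', hw', -⟩ := exists_of_bd_ne_zero h0
      exact hw3 ⟨T', (Finset.mem_inter.1 hT').2, hw'⟩
  have hdisj : S ∩ S' = ∅ := by
    refine (h.connected _ (Finset.inter_subset_left.trans hS) fun a b hab => ?_).resolve_right ?_
    · by_cases ha : a = t
      · rw [bd_comm]
        exact hz b a (ha ▸ hab.symm) hab
      · exact hz a b ha hab.symm
    · intro he
      exact hTS (Finset.mem_inter.1 (he ▸ hTF)).1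
  have hshared : ∀ w, ∀ T₁ ∈ S, w ∈ T₁ → ∀ T₂ ∈ S', w ∈ T₂ → w = t := by
    intro w T₁ hT₁ hw₁ T₂ hT₂ hw₂
    by_contra hwt
    obtain ⟨h1, h2⟩ := z3 w (fun hw => n1 w hw T₁ hT₁ hw₁) (fun hw => n2 w hw T₂ hT₂ hw₂) hwt
    have : T₁ ∈ S ∩ S' :=
      Finset.mem_inter.2 ⟨hT₁, h.connected_at S' hS' w h2 T₂ hT₂ hw₂ T₁ (hS hT₁) hw₁⟩
    simp [hdisj] at this
  refine ⟨S, S', ?_, hbS, hbS', ch1, ch2, n2, n1, hshared⟩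
  have hsd : symmDiff (symmDiff S S') (F.erase T) = ∅ := by
    refine (h.connected _ ?_ fun a b hab => ?_).resolve_right ?_
    · intro T' hT'
      simp only [Finset.mem_symmDiff, Finset.mem_erase] at hT'
      rcases hT' with ⟨⟨h1, -⟩ | ⟨h1, -⟩, -⟩ | ⟨⟨-, h1⟩, -⟩
      exacts [hS h1, hS' h1, hF h1]
    · rw [bd_symmDiff, bd_symmDiff, bd_erase hT, hbS a b hab, hbS' a b hab, hbd a b hab,
        pathInd_append P d (t :: _), pathInd_append P d (c :: _)]
      have hind : (if a ∈ T ∧ b ∈ T then (1 : ZMod 2) else 0) =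
          (if s(d, c) = s(a, b) then 1 else 0) + (if s(d, t) = s(a, b) then 1 else 0) +
            (if s(t, c) = s(a, b) then 1 else 0) := by
        simp only [hTm]
        exact triangle_pairs hdc hdt hct hab
      have e3 := pathInd_append (c :: R₁) t [c] a b
      have e4 := pathInd_append (c :: R₁) t (R₂ ++ [u]) a b
      simp only [List.cons_append] at e3 e4
      simp only [pathInd, hind, e3, e4]
      ring_nf
      simp [show (2 : ZMod 2) = 0 from rfl]
    · intro he
      have := he ▸ hTF
      simp [Finset.mem_symmDiff, hTS, hTS'] at this
  rw [← symmDiff_eq_bot.1 hsd]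
  exact ((Finset.disjoint_iff_inter_eq_empty.2 hdisj).symmDiff_eq_sup).symm

end IsSphere

/-- `H', g'` extends the drawing `H, g` and draws all triangles of `F`, without drawing any vertex
outside of `F`. -/
structure ExtendsOver {V : Type*} (F : Finset (Finset V)) (H : V → V → Prop) (g : V → ℝ × ℝ)
    (H' : V → V → Prop) (g' : V → ℝ × ℝ) : Prop where
  le : ∀ a b, H a b → H' a b
  agree : ∀ w, H w w → g' w = g w
  loop : ∀ w, H' w w → H w w ∨ ∃ T ∈ F, w ∈ T
  faces : ∀ T ∈ F, ∀ a ∈ T, ∀ b ∈ T, H' a b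

/-- A disc `F` bounded by the cycle `u :: M`, with `v` the last vertex, can be drawn above an edge
`uv` of the upper envelope of any drawing. -/
def Drawable {V : Type*} (u₀ v₀ : V) (𝓕 F : Finset (Finset V)) : Prop :=
  ∀ (u v : V) (M : List V) (H : V → V → Prop) (g : V → ℝ × ℝ) (l₁ l₂ : List V),
    (u :: M).Nodup → M.getLast? = some v → (u :: (M ++ [u])).IsChain (FaceEdge 𝓕) →
    (∀ a b, a ≠ b → bd F a b = pathInd (u :: (M ++ [u])) a b) →
    ChainDrawing u₀ v₀ H g (l₁ ++ u :: v :: l₂) → H u v →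
    (∀ T ∈ F, ∀ w ∈ T, H w w → w = u ∨ w = v) →
    ∃ H' g', ExtendsOver F H g H' g' ∧ ChainDrawing u₀ v₀ H' g' (l₁ ++ u :: (M ++ l₂))

theorem pathInd_boundary_eq_one {V : Type*} {P R : List V} {u d c : V} (hu : u ∈ P ++ [d])
    (hnd : (P ++ d :: c :: R).Nodup) (hR : R ≠ []) :
    pathInd (P ++ d :: c :: (R ++ [u])) d c = 1 := by
  simp only [List.nodup_append, List.nodup_cons, List.mem_cons] at hnd
  simp only [List.mem_append, List.mem_singleton] at hu
  obtain ⟨r, R, rfl⟩ := List.exists_cons_of_ne_nil hR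
  obtain ⟨h1, ⟨h2, h3, h4⟩, h5⟩ := hnd
  refine pathInd_eq_one (fun h => h5 c h c (by simp) rfl) (fun h => h2 (by simp [h])) ?_ ?_
  · simp only [List.mem_append, List.mem_singleton, not_or]
    refine ⟨h3, ?_⟩
    rintro rfl
    rcases hu with hu | rfl
    · exact h5 c hu c (by simp) rfl
    · simp at h2
  · rintro h
    simp at h
    simp [h] at h2

namespace IsSphere
variable {V : Type*} {𝓕 : Finset (Finset V)} {u₀ v₀ : V}

theorem exists_extension_of_fan (h : IsSphere 𝓕) (n : ℕ) : ∀ F ⊆ 𝓕, F.card = n → F ≠ 𝓕 →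
    (∀ F' ⊂ F, Drawable u₀ v₀ 𝓕 F') →
    ∀ (P P' R : List V) (u v d c : V) (H : V → V → Prop) (g : V → ℝ × ℝ) (l₁ l₂ : List V),
    P ++ [d] = u :: P' → (P ++ d :: c :: R).Nodup → R.getLast? = some v →
    (P ++ d :: c :: (R ++ [u])).IsChain (FaceEdge 𝓕) →
    (∀ a b, a ≠ b → bd F a b = pathInd (P ++ d :: c :: (R ++ [u])) a b) →
    (∀ T ∈ F, c ∈ T → ∀ x ∈ P, x ∉ T) →
    ChainDrawing u₀ v₀ H g (l₁ ++ u :: v :: l₂) → H u v →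
    (∀ T ∈ F, ∀ w ∈ T, H w w → w = u ∨ w = v) →
    ∃ H' g', ExtendsOver F H g H' g' ∧ ChainDrawing u₀ v₀ H' g' (l₁ ++ u :: c :: (R ++ l₂)) ∧
      ∀ x ∈ P ++ [d], H' c x := by
  induction n with
  | zero =>
    intro F hF hn hne _ P P' R u v d c H g l₁ l₂ hu hnd hv hch hbd
    exfalso
    have hnd' := hnd
    simp only [List.nodup_append, List.nodup_cons, List.mem_cons] at hnd'
    have huP : u ∈ P ++ [d] := by simp [hu]
    have := hbd d c (fun e => by simp [e] at hnd')
    rw [Finset.card_eq_zero.1 hn, bd_empty, pathInd_boundary_eq_one huP hnd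
      (by rintro rfl; simp at hv)] at this
    simp at this
  | succ n ih =>
    intro F hF hn hne hdraw P P' R u v d c H g l₁ l₂ hu hnd hv hch hbd hinv hD huv hfresh
    have hnd' := hnd
    simp only [List.nodup_append, List.nodup_cons, List.mem_cons] at hnd'
    have huP : u ∈ P ++ [d] := by simp [hu]
    have hdc : d ≠ c := fun e => by simp [e] at hnd'
    have hvR : v ∈ R := List.mem_of_getLast? hv
    have hbdc : bd F d c = 1 := by
      rw [hbd d c hdc, pathInd_boundary_eq_one huP hnd (by rintro rfl; simp at hv)]
    obtain ⟨T, hT, t, htd, htc, hTm, huniq⟩ := h.exists_face_of_bd_ne_zero hF hdc (by simp [hbdc])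
    have htP : t ∉ P := fun ht => hinv T hT (by simp [hTm]) t ht (by simp [hTm])
    have edt : FaceEdge 𝓕 d t := ⟨htd.symm, T, hF hT, by simp [hTm], by simp [hTm]⟩
    have etc : FaceEdge 𝓕 t c := ⟨htc, T, hF hT, by simp [hTm], by simp [hTm]⟩
    have hcfresh : ¬ H c c := fun hc => by
      rcases hfresh T hT c (by simp [hTm]) hc with rfl | rfl
      · simp only [List.mem_append, List.mem_singleton] at huP
        rcases huP with huP | rfl
        · exact hnd'.2.2 c huP c (by simp) rfl
        · exact hdc rfl
      · exact hnd'.2.1.2.1 hvR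
    -- it remains to see that the edges of `T` get drawn
    have facesT : ∀ H' : V → V → Prop, (∀ a b, H' a b → H' b a) → (∀ a b, H' a b → H' a a) →
        H' c d → H' c t → H' d t → ∀ a ∈ T, ∀ b ∈ T, H' a b := by
      intro H' hs hl h1 h2 h3 a ha b hb
      rcases (hTm a).1 ha with rfl | rfl | rfl <;> rcases (hTm b).1 hb with rfl | rfl | rfl
      exacts [hl _ _ h3, hs _ _ h1, h3, h1, hl _ _ h1, h2, hs _ _ h3, hs _ _ h2, hl _ _ (hs _ _ h2)]
    by_cases htR : t ∈ R
    · obtain ⟨R₁, R₂, rfl⟩ := List.append_of_mem htR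
      have hch' : (P ++ d :: c :: (R₁ ++ t :: (R₂ ++ [u]))).IsChain (FaceEdge 𝓕) := by
        simpa using hch
      obtain ⟨S, S', hSS', hbS, hbS', ch1, ch2, n2, n1, hshared⟩ :=
        h.exists_split hF hu hnd hch' hT hTm (by simpa using hbd)
      have hSF : ∀ T' ∈ S, T' ∈ F ∧ T' ≠ T := fun T' hT' =>
        (Finset.mem_erase.1 (hSS' ▸ Finset.mem_union_left S' hT')).symm
      have hS'F : ∀ T' ∈ S', T' ∈ F ∧ T' ≠ T := fun T' hT' =>
        (Finset.mem_erase.1 (hSS' ▸ Finset.mem_union_right S hT')).symm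
      have hSs : S ⊂ F := Finset.ssubset_iff_subset_ne.2
        ⟨fun T' hT' => (hSF T' hT').1, by rintro rfl; exact (hSF T hT).2 rfl⟩
      have hS's : S' ⊂ F := Finset.ssubset_iff_subset_ne.2
        ⟨fun T' hT' => (hS'F T' hT').1, by rintro rfl; exact (hS'F T hT).2 rfl⟩
      have e1 : P ++ d :: t :: (R₂ ++ [u]) = u :: ((P' ++ t :: R₂) ++ [u]) := by
        have : P ++ d :: t :: (R₂ ++ [u]) = (P ++ [d]) ++ t :: (R₂ ++ [u]) := by simp
        rw [this, hu]; simp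
      have e2 : c :: (R₁ ++ t :: [c]) = c :: ((R₁ ++ [t]) ++ [c]) := by simp
      have hnd1 : (u :: (P' ++ t :: R₂)).Nodup := by
        have : u :: (P' ++ t :: R₂) = (P ++ [d]) ++ t :: R₂ := by rw [hu]; simp
        rw [this]
        refine List.Nodup.sublist ?_ hnd
        simp
      have hnd2 : (c :: (R₁ ++ [t])).Nodup := by
        refine List.Nodup.sublist ?_ hnd
        refine List.Sublist.trans ?_ (List.sublist_append_right _ _)
        refine List.Sublist.cons _ (List.Sublist.cons_cons _ ?_)
        simp
      rw [e1] at hbS ch1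
      rw [e2] at hbS' ch2
      obtain ⟨H₁, g₁, hE₁, hD₁⟩ := hdraw S hSs u v (P' ++ t :: R₂) H g l₁ l₂ hnd1
        (by simpa using hv) ch1 hbS hD huv fun T' hT' w hw hH => hfresh T' (hSF T' hT').1 w hw hH
      have hc1 : ¬ H₁ c c := fun hc => by
        rcases hE₁.loop c hc with hc | ⟨T', hT', hcT'⟩
        · exact hcfresh hc
        · exact n1 c (by simp) T' hT' hcT'
      have hdt1 : H₁ d t := by
        by_cases he : P = [] ∧ R₂ = []
        · obtain ⟨rfl, rfl⟩ := he
          simp at hv hu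
          rw [hu.1, hv]
          exact hE₁.le _ _ huv
        · have : bd S d t = 1 := by
            rw [hbS d t htd.symm, ← e1, pathInd_eq_one htP htd.symm]
            · intro ht
              simp only [List.mem_append, List.mem_singleton] at ht huP
              simp only [List.nodup_append, List.nodup_cons] at hnd'
              rcases ht with ht | rfl
              · exact hnd'.2.1.2.2.2.1.1 ht
              · tauto
            · cases R₂ with
              | nil =>
                simp only [and_true] at he
                obtain ⟨p, P, rfl⟩ := List.exists_cons_of_ne_nil he
                simp only [List.cons_append, List.cons.injEq] at hu
                simp only [List.nil_append, List.head?_cons, ne_eq, Option.some.injEq]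
                rintro rfl
                exact hnd'.2.2 p (by simp) u (by simp) hu.1
              | cons r R₂ =>
                simp only [List.cons_append, List.head?_cons, ne_eq, Option.some.injEq]
                rintro rfl
                exact hnd'.2.1.1 (by simp)
          obtain ⟨T', hT', h1, h2⟩ := exists_of_bd_ne_zero (S := S) (a := d) (b := t) (by simp [this])
          exact hE₁.faces T' hT' _ h1 _ h2
      rw [show l₁ ++ u :: (P' ++ t :: R₂ ++ l₂) = l₁ ++ u :: (P' ++ t :: (R₂ ++ l₂)) by simp] at hD₁
      obtain ⟨g₂, hg₂, hD₂⟩ := hD₁.exists_addVertex hc1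
      set N := u :: (P' ++ [t]) with hN
      have hNm : ∀ x, x ∈ N ↔ x ∈ P ++ [d] ∨ x = t := by
        intro x; rw [hu]; simp [hN, or_assoc]
      have hne₂ : ∀ w, H₁ w w → g₂ w = g₁ w := fun w hw => hg₂ w (by rintro rfl; exact hc1 hw)
      have loop₂ : ∀ w, addVertex H₁ c N w w → H₁ w w ∨ w = c := by
        rintro w (hw | ⟨rfl, -⟩ | ⟨rfl, -⟩ | ⟨-, rfl⟩) <;> simp [*]
      have hct : addVertex H₁ c N c t := Or.inr (Or.inr (Or.inl ⟨rfl, by simp [hN]⟩))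
      rw [show l₁ ++ u :: c :: t :: (R₂ ++ l₂) = (l₁ ++ [u]) ++ c :: t :: (R₂ ++ l₂) by simp] at hD₂
      obtain ⟨H₃, g₃, hE₃, hD₃⟩ := hdraw S' hS's c t (R₁ ++ [t]) _ g₂ (l₁ ++ [u]) (R₂ ++ l₂) hnd2
        (by simp) ch2 hbS' hD₂ hct (by
          intro T' hT' w hw hH
          rcases loop₂ w hH with hH | hH
          · rcases hE₁.loop w hH with hH | ⟨T₁, hT₁, hw₁⟩
            · rcases hfresh T' (hS'F T' hT').1 w hw hH with rfl | rfl
              · exact absurd hw (n2 w (by simp at huP ⊢; tauto) T' hT')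
              · by_cases hwt : w = t
                · exact Or.inr hwt
                · refine absurd hw (n2 w ?_ T' hT')
                  have : w ∈ t :: R₂ := List.mem_of_getLast? (by simpa using hv)
                  simp at this ⊢; tauto
            · exact Or.inr (hshared w T₁ hT₁ hw₁ T' hT' hw)
          · exact Or.inl hH)
      have hadd : ∀ a b, H₁ a b → H₃ a b := fun a b hab => hE₃.le _ _ (Or.inl hab)
      have hcN : ∀ x ∈ N, H₃ c x := fun x hx =>
        hE₃.le _ _ (Or.inr (Or.inr (Or.inl ⟨rfl, hx⟩)))
      refine ⟨H₃, g₃, ⟨fun a b hab => hadd _ _ (hE₁.le _ _ hab), fun w hw => ?_, fun w hw => ?_, ?_⟩,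
        by simpa using hD₃, fun x hx => hcN x ((hNm x).2 (Or.inl hx))⟩
      · rw [hE₃.agree w (Or.inl (hE₁.le _ _ hw)), hne₂ w (hE₁.le _ _ hw), hE₁.agree w hw]
      · rcases hE₃.loop w hw with hw | ⟨T', hT', hw⟩
        · rcases loop₂ w hw with hw | rfl
          · rcases hE₁.loop w hw with hw | ⟨T', hT', hw⟩
            · exact Or.inl hw
            · exact Or.inr ⟨T', (hSF T' hT').1, hw⟩
          · exact Or.inr ⟨T, hT, by simp [hTm]⟩
        · exact Or.inr ⟨T', (hS'F T' hT').1, hw⟩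
      · intro T' hT'
        by_cases hTT : T' = T
        · subst hTT
          exact facesT H₃ hD₃.symm hD₃.left (hcN d ((hNm d).2 (by simp)))
            (hcN t ((hNm t).2 (by simp))) (hadd _ _ hdt1)
        · have : T' ∈ S ∪ S' := hSS' ▸ Finset.mem_erase.2 ⟨hTT, hT'⟩
          rcases Finset.mem_union.1 this with h' | h'
          · exact fun a ha b hb => hadd _ _ (hE₁.faces T' h' a ha b hb)
          · exact hE₃.faces T' h'
    · have hsub : F.erase T ⊆ F := Finset.erase_subset _ _
      have hdtc : (P ++ d :: t :: c :: R).Nodup := by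
        have : (t :: (P ++ d :: c :: R)).Nodup := by
          refine List.nodup_cons.2 ⟨?_, hnd⟩
          simp [htP, htd, htc, htR]
        refine (List.Perm.nodup_iff ?_).1 this
        refine List.perm_middle.symm.trans ?_ |>.trans (List.Perm.refl _)
        exact List.Perm.append_left P (List.Perm.swap _ _ _)
      have hbd' : ∀ a b, a ≠ b →
          bd (F.erase T) a b = pathInd (P ++ [d] ++ t :: c :: (R ++ [u])) a b := by
        intro a b hab
        have e : P ++ [d] ++ t :: c :: (R ++ [u]) = P ++ d :: t :: c :: (R ++ [u]) := by simp
        rw [e, bd_erase hT, hbd a b hab, pathInd_append P d (c :: _), pathInd_append P d (t :: _)]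
        simp only [hTm, triangle_pairs hdc htd.symm htc.symm hab, pathInd]
        ring_nf
        simp [show (2 : ZMod 2) = 0 from rfl]
      have hlt : F.erase T ≠ 𝓕 := fun he => by
        have := he ▸ hF hT
        simp at this
      obtain ⟨hch1, hch2, hch3⟩ := List.isChain_append_cons_cons.1 hch
      obtain ⟨H', g', hE, hD', hc'⟩ := ih (F.erase T) (hsub.trans hF)
        (by rw [Finset.card_erase_of_mem hT, hn]; rfl) hlt
        (fun F' hF' => hdraw F' (hF'.trans_subset hsub)) (P ++ [d]) (P' ++ [t]) R u v t c H g l₁ l₂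
        (by rw [hu]; simp) (by simpa using hdtc) hv
        (by
          rw [List.append_assoc]
          refine List.isChain_append_cons_cons.2 ⟨hch1, edt, List.isChain_cons_cons.2 ⟨etc, hch3⟩⟩)
        hbd'
        (by
          intro T' hT' hc x hx hxT'
          obtain ⟨hne', hT'⟩ := Finset.mem_erase.1 hT'
          rcases List.mem_append.1 hx with hx | hx
          · exact hinv T' hT' hc x hx hxT'
          · obtain rfl := List.mem_singleton.1 hx
            exact hne' (huniq T' hT' hxT' hc))
        hD huv (fun T' hT' => hfresh T' (hsub hT'))
      have hdt : H' d t := by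
        have : bd (F.erase T) d t = 1 := by
          rw [hbd' d t htd.symm, List.append_assoc, List.singleton_append, pathInd_eq_one]
          · exact htP
          · exact htd.symm
          · simp only [List.mem_append, List.mem_singleton] at huP
            simp only [List.mem_append, List.mem_cons, List.not_mem_nil, or_false, not_or]
            refine ⟨htc, htR, ?_⟩
            rintro rfl
            tauto
          · simp [hdc.symm]
        obtain ⟨T', hT', h1, h2⟩ :=
          exists_of_bd_ne_zero (S := F.erase T) (a := d) (b := t) (by simp [this])
        exact hE.faces T' hT' _ h1 _ h2
      refine ⟨H', g', ⟨hE.le, hE.agree, fun w hw => ?_, ?_⟩, hD', fun x hx => hc' x (by simp at hx ⊢; tauto)⟩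
      · rcases hE.loop w hw with hw | ⟨T', hT', hw⟩
        · exact Or.inl hw
        · exact Or.inr ⟨T', hsub hT', hw⟩
      · intro T' hT'
        by_cases hTT : T' = T
        · subst hTT
          exact facesT H' hD'.symm hD'.left (hc' d (by simp)) (hc' t (by simp)) hdt
        · exact hE.faces T' (Finset.mem_erase.2 ⟨hTT, hT'⟩)

theorem drawable (h : IsSphere 𝓕) (F : Finset (Finset V)) (hF : F ⊆ 𝓕) (hne : F ≠ 𝓕) :
    Drawable u₀ v₀ 𝓕 F := by
  induction F using Finset.strongInduction with
  | H F ih =>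
    have ih' : ∀ F' ⊂ F, Drawable u₀ v₀ 𝓕 F' := fun F' hF' => ih F' hF' (hF'.subset.trans hF)
      fun he => hF'.not_subset (he ▸ hF)
    intro u v M H g l₁ l₂ hnd hv hch hbd hD huv hfresh
    cases M with
    | nil => simp at hv
    | cons c R =>
      by_cases hR : R = []
      · subst hR
        obtain rfl : c = v := by simpa using hv
        have : F = ∅ := by
          refine (h.connected F hF fun a b hab => ?_).resolve_right hne
          rw [hbd a b hab]
          simp only [pathInd, List.cons_append, List.nil_append, Sym2.eq_swap (a := c)]
          rw [add_zero, zmod_two_self]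
        subst this
        exact ⟨H, g, ⟨fun _ _ => id, fun _ _ => rfl, fun _ => Or.inl, by simp⟩, by simpa using hD⟩
      · obtain ⟨H', g', hE, hD', -⟩ := h.exists_extension_of_fan F.card F hF rfl hne ih' [] [] R u v u c
          H g l₁ l₂ rfl hnd (by
            rw [List.getLast?_cons] at hv
            rw [← hv]
            cases hl : R.getLast? with
            | none => simp at hl; contradiction
            | some x => simp) hch hbd (by simp) hD huv hfresh
        exact ⟨H', g', hE, hD'⟩

end IsSphere

theorem exists_mem_segment_eq_zero {h : ℝ × ℝ → ℝ} (hc : Continuous h) {r d : ℝ × ℝ} (hr : 0 ≤ h r)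
    (hd : h d ≤ 0) : ∃ z ∈ segment ℝ r d, h z = 0 := by
  have := (convex_segment (𝕜 := ℝ) r d).isPreconnected.intermediate_value
    (right_mem_segment ℝ r d) (left_mem_segment ℝ r d) hc.continuousOn
  exact this ⟨hd, hr⟩

theorem segment_subset_of_mem {c d r r' z : ℝ × ℝ} (hr : r ∈ segment ℝ c d)
    (hr' : r' ∈ segment ℝ c d) (hz : z ∈ segment ℝ r r') : z ∈ segment ℝ c d :=
  (convex_segment (𝕜 := ℝ) c d).segment_subset hr hr' hz

/-- In the triangle with vertices `(0,0)`, `(1,0)`, `(0,1)`, choose the vertex `s` making the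
smallest angle with the first axis, and closest to the origin among those.  If the edges entering
the triangle avoid its first and second side, the triangle below `s` is essentially empty. -/
theorem exists_vertex_min_angle {E : ℝ × ℝ → ℝ × ℝ → Prop} {P : Finset (ℝ × ℝ)}
    (hE : ∀ a b, E a b → a ∈ P) (symm : ∀ a b, E a b → E b a) (hy : ((0, 1) : ℝ × ℝ) ∈ P)
    (hfree : ∀ c d, E c d → ∀ r ∈ segment ℝ c d, 0 ≤ r.1 → 0 < r.2 → r.1 + r.2 < 1 →
      ∀ r' ∈ segment ℝ c d, 0 ≤ r'.1 → 0 ≤ r'.2 → r'.1 + r'.2 ≤ 1 →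
        (r'.2 = 0 ∨ r'.1 + r'.2 = 1) → r' = (0, 0) ∨ r' = (0, 1)) :
    ∃ s ∈ P, 0 ≤ s.1 ∧ 0 < s.2 ∧ s.1 + s.2 ≤ 1 ∧ ∀ c d, E c d → ∀ r ∈ segment ℝ c d,
      0 ≤ r.1 → 0 < r.2 → r.1 + r.2 < 1 → s.1 * r.2 ≤ r.1 * s.2 →
        r.1 * s.2 = s.1 * r.2 ∧ (s.2 ≤ r.2 ∨ (0, 0) ∈ segment ℝ c d) := by
  set Q := P.filter fun p => 0 ≤ p.1 ∧ 0 < p.2 ∧ p.1 + p.2 ≤ 1 with hQ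
  have hyQ : ((0, 1) : ℝ × ℝ) ∈ Q := by simp [hQ, hy]
  obtain ⟨s₀, hs₀, hmax₀⟩ := Q.exists_max_image (fun p => p.1 / p.2) ⟨_, hyQ⟩
  obtain ⟨s, hs, hmin⟩ := (Q.filter fun p => p.1 / p.2 = s₀.1 / s₀.2).exists_min_image (fun p => p.2)
    ⟨s₀, by simp [hs₀]⟩
  obtain ⟨hsQ, hse⟩ := Finset.mem_filter.1 hs
  obtain ⟨hsP, hs1, hs2, hs3⟩ := Finset.mem_filter.1 hsQ
  have hmax : ∀ p ∈ P, 0 ≤ p.1 → 0 < p.2 → p.1 + p.2 ≤ 1 →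
      p.1 * s.2 ≤ s.1 * p.2 ∧ (p.1 * s.2 = s.1 * p.2 → s.2 ≤ p.2) := by
    intro p hp h1 h2 h3
    have hpQ : p ∈ Q := Finset.mem_filter.2 ⟨hp, h1, h2, h3⟩
    have := hmax₀ p hpQ
    rw [← hse] at this
    refine ⟨(div_le_div_iff₀ h2 hs2).1 this, fun he => hmin p (Finset.mem_filter.2 ⟨hpQ, ?_⟩)⟩
    rw [← hse, div_eq_div_iff h2.ne' hs2.ne', he]
  clear_value Q
  refine ⟨s, hsP, hs1, hs2, hs3, ?_⟩
  have back : ∀ c d, c ∈ P → ∀ r ∈ segment ℝ c d, 0 ≤ r.1 → 0 < r.2 → r.1 + r.2 < 1 →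
      r.1 * s.2 = s.1 * r.2 → r.1 * d.2 = d.1 * r.2 → r.2 < d.2 →
        s.2 ≤ r.2 ∨ (0, 0) ∈ segment ℝ c d := by
    intro c d hc r hr h1 h2 h3 hrs hrd hlt
    obtain ⟨t, ht0, ht1, hx, hy⟩ := mem_segment_prod.1 hr
    have ht1' : t < 1 := lt_of_le_of_ne ht1 fun h => by rw [h] at hy; linarith
    have hrc : r.1 * c.2 = c.1 * r.2 := by
      have : (1 - t) * (r.1 * c.2 - c.1 * r.2) = 0 := by
        have e : (1 - t) * (r.1 * c.2 - c.1 * r.2) + t * (r.1 * d.2 - d.1 * r.2) = 0 := by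
          linear_combination r.2 * hx - r.1 * hy
        rw [hrd] at e
        linarith
      rcases mul_eq_zero.1 this with h | h <;> linarith
    have hcr : c.2 ≤ r.2 := by nlinarith
    by_cases hc0 : 0 < c.2
    · left
      have hc1 : 0 ≤ c.1 := by
        by_contra hneg
        push Not at hneg
        nlinarith [mul_nonneg h1 hc0.le, mul_neg_of_neg_of_pos hneg h2]
      have hc2 : c.1 ≤ r.1 := by nlinarith
      have hcs : c.1 * s.2 = s.1 * c.2 := by
        have : r.2 * (c.1 * s.2 - s.1 * c.2) = 0 := by
          linear_combination (-s.2) * hrc + c.2 * hrs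
        rcases mul_eq_zero.1 this with h | h <;> linarith
      exact ((hmax c hc hc1 hc0 (by linarith)).2 hcs).trans hcr
    · right
      push Not at hc0
      have hdpos : 0 < d.2 - c.2 := by linarith
      have hcd' : c.1 * d.2 = d.1 * c.2 := by
        have : r.2 * (c.1 * d.2 - d.1 * c.2) = 0 := by
          linear_combination (-d.2) * hrc + c.2 * hrd
        rcases mul_eq_zero.1 this with h | h <;> linarith
      refine mem_segment_prod.2 ⟨-c.2 / (d.2 - c.2), div_nonneg (by linarith) hdpos.le, ?_, ?_, ?_⟩
      · rw [div_le_one hdpos]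
        linarith
      · field_simp
        linarith
      · field_simp
        ring
  have main : ∀ c d, c ∈ P → d ∈ P → (E c d) → ∀ r ∈ segment ℝ c d,
      0 ≤ r.1 → 0 < r.2 → r.1 + r.2 < 1 → s.1 * r.2 ≤ r.1 * s.2 → r.1 * d.2 ≤ d.1 * r.2 →
        r.1 * s.2 = s.1 * r.2 ∧ (s.2 ≤ r.2 ∨ (0, 0) ∈ segment ℝ c d) := by
    intro c d hcP hdP hcd r hr h1 h2 h3 hle hf
    by_cases hd : 0 < d.2 ∧ d.1 + d.2 ≤ 1
    · obtain ⟨hd2, hd3⟩ := hd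
      have hd1 : 0 ≤ d.1 := by
        by_contra hneg
        push Not at hneg
        nlinarith [mul_nonneg h1 hd2.le, mul_neg_of_neg_of_pos hneg h2]
      obtain ⟨hm1, hm2⟩ := hmax d hdP hd1 hd2 hd3
      have e1 : r.1 * s.2 = s.1 * r.2 := by nlinarith
      have e2 : r.1 * d.2 = d.1 * r.2 := by nlinarith
      have e3 : d.1 * s.2 = s.1 * d.2 := by nlinarith
      refine ⟨e1, ?_⟩
      rcases le_or_gt d.2 r.2 with hle' | hlt
      · exact Or.inl ((hm2 e3).trans hle')
      · exact back c d hcP r hr h1 h2 h3 e1 e2 hlt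
    · obtain ⟨z, hz, hz0⟩ := exists_mem_segment_eq_zero (h := fun z => min z.2 (1 - z.1 - z.2))
        (by fun_prop) (r := r) (d := d) (le_min h2.le (by linarith)) (by
          rw [min_le_iff]
          by_contra! hcon
          exact hd ⟨hcon.1, by linarith⟩)
      have hz2 : 0 ≤ z.2 := hz0.symm.le.trans (min_le_left _ _)
      have hz3 : 0 ≤ 1 - z.1 - z.2 := hz0.symm.le.trans (min_le_right _ _)
      have hfz : r.1 * z.2 ≤ z.1 * r.2 := by
        obtain ⟨t, ht0, ht1, hx, hy⟩ := mem_segment_prod.1 hz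
        rw [hx, hy]
        nlinarith
      have hz1 : 0 ≤ z.1 := by
        by_contra hneg
        push Not at hneg
        nlinarith [mul_nonneg h1 hz2, mul_neg_of_neg_of_pos hneg h2]
      have hzs : z ∈ segment ℝ c d := segment_subset_of_mem hr (right_mem_segment ℝ c d) hz
      have hrz : r ∈ segment ℝ c z := by
        rw [mem_segment_iff_wbtw] at *
        exact hr.trans_right_left hz
      rcases hfree c d hcd r hr h1 h2 h3 z hzs hz1 hz2 (by linarith) (by
        rcases min_choice z.2 (1 - z.1 - z.2) with h | h
        · exact Or.inl (h.symm.trans hz0)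
        · right
          have := h.symm.trans hz0
          linarith) with rfl | rfl
      · have hcs : r.1 * s.2 = s.1 * r.2 := by
          obtain ⟨t, ht0, ht1, hx, hy⟩ := mem_segment_prod.1 hrz
          simp only at hx hy
          have ht1' : t < 1 := lt_of_le_of_ne ht1 fun h => by rw [h] at hy; linarith
          have hc2 : 0 < c.2 := by
            by_contra hneg
            push Not at hneg
            nlinarith
          have hc1 : 0 ≤ c.1 := by
            by_contra hneg
            push Not at hneg
            nlinarith
          by_cases hc : c.1 + c.2 ≤ 1
          · have := (hmax c hcP hc1 hc2 hc).1
            refine le_antisymm ?_ hle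
            have : (1 - t) * (c.1 * s.2) ≤ (1 - t) * (s.1 * c.2) :=
              mul_le_mul_of_nonneg_left this (by linarith)
            rw [hx, hy]
            linarith
          · push Not at hc
            have hsum : 0 < c.1 + c.2 := by linarith
            have hwc : ((c.1 / (c.1 + c.2), c.2 / (c.1 + c.2)) : ℝ × ℝ) ∈ segment ℝ c (0, 0) := by
              refine mem_segment_prod.2 ⟨1 - 1 / (c.1 + c.2), ?_, ?_, ?_, ?_⟩
              · rw [sub_nonneg, div_le_one hsum]
                exact hc.le
              · have : 0 < 1 / (c.1 + c.2) := by positivity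
                linarith
              · field_simp
                ring
              · field_simp
                ring
            have := hfree c d hcd r hr h1 h2 h3 _
              (segment_subset_of_mem (left_mem_segment ℝ c d) hzs hwc) (by positivity)
              (by positivity) (by field_simp; rfl) (Or.inr (by field_simp))
            have hc0 : c.1 = 0 := by
              rcases this with h | h
              · have := congrArg Prod.fst h
                simpa [hsum.ne'] using this
              · have := congrArg Prod.fst h
                simpa [hsum.ne'] using this
            have hr0 : r.1 = 0 := by rw [hx, hc0]; ring
            have : s.1 * r.2 = 0 := by
              refine le_antisymm ?_ (by positivity)
              rwa [hr0, zero_mul] at hle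
            rw [this, hr0, zero_mul]
        exact ⟨hcs, Or.inr hzs⟩
      · simp only [mul_one, zero_mul] at hfz
        have hr0 : r.1 = 0 := le_antisymm hfz h1
        have hs0 : s.1 * r.2 = 0 := by
          refine le_antisymm ?_ (by positivity)
          rwa [hr0, zero_mul] at hle
        have e1 : r.1 * s.2 = s.1 * r.2 := by rw [hs0, hr0, zero_mul]
        refine ⟨e1, ?_⟩
        rcases back c (0, 1) hcP r hrz h1 h2 h3 e1 (by simp [hr0]) (by
          simp only
          linarith) with h | h
        · exact Or.inl h
        · exact Or.inr (segment_subset_of_mem (left_mem_segment ℝ c d) hzs h)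
  intro c d hcd r hr h1 h2 h3 hle
  obtain ⟨t, ht0, ht1, hx, hy⟩ := mem_segment_prod.1 hr
  rcases le_or_gt (r.1 * d.2) (d.1 * r.2) with hf | hf
  · exact main c d (hE _ _ hcd) (hE _ _ (symm _ _ hcd)) hcd r hr h1 h2 h3 hle hf
  · have : r.1 * c.2 ≤ c.1 * r.2 := by
      have e : (1 - t) * (r.1 * c.2 - c.1 * r.2) + t * (r.1 * d.2 - d.1 * r.2) = 0 := by
        linear_combination r.2 * hx - r.1 * hy
      rcases ht1.eq_or_lt with rfl | h
      · linarith
      · nlinarith [mul_nonneg ht0 (sub_nonneg.2 hf.le)]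
    rw [segment_symm] at hr ⊢
    exact main d c (hE _ _ (symm _ _ hcd)) (hE _ _ hcd) (symm _ _ hcd) r hr h1 h2 h3 hle this

/-- Twice the signed area of the triangle `abc`. -/
def orient (a b c : ℝ × ℝ) : ℝ := (b.1 - a.1) * (c.2 - a.2) - (b.2 - a.2) * (c.1 - a.1)

theorem orient_rotate (a b c : ℝ × ℝ) : orient b c a = orient a b c := by
  unfold orient; ring

theorem orient_swap (a b c : ℝ × ℝ) : orient b a c = -orient a b c := by
  unfold orient; ring

theorem orient_self_left (a b : ℝ × ℝ) : orient a b a = 0 := by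
  unfold orient; ring

theorem orient_self_right (a b : ℝ × ℝ) : orient a b b = 0 := by
  unfold orient; ring

theorem orient_self (a b : ℝ × ℝ) : orient a a b = 0 := by
  unfold orient; ring

theorem orient_add (a b c p : ℝ × ℝ) :
    orient b c p + orient c a p + orient a b p = orient a b c := by
  unfold orient; ring

theorem orient_bary_fst (a b c p : ℝ × ℝ) : orient a b c * p.1 =
    orient b c p * a.1 + orient c a p * b.1 + orient a b p * c.1 := by
  unfold orient; ring

theorem orient_bary_snd (a b c p : ℝ × ℝ) : orient a b c * p.2 =
    orient b c p * a.2 + orient c a p * b.2 + orient a b p * c.2 := by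
  unfold orient; ring

theorem orient_bary (a b c p x y : ℝ × ℝ) : orient a b c * orient x y p =
    orient b c p * orient x y a + orient c a p * orient x y b + orient a b p * orient x y c := by
  unfold orient; ring

theorem orient_segment (x y p q : ℝ × ℝ) {r : ℝ × ℝ} {t : ℝ} (h1 : r.1 = p.1 + t * (q.1 - p.1))
    (h2 : r.2 = p.2 + t * (q.2 - p.2)) :
    orient x y r = (1 - t) * orient x y p + t * orient x y q := by
  unfold orient; rw [h1, h2]; ring

theorem continuous_orient (a b : ℝ × ℝ) : Continuous (orient a b) := by
  unfold orient; fun_prop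

theorem mem_segment_of_orient {a b c p : ℝ × ℝ} (h : orient a b c ≠ 0) (h1 : orient a b p = 0)
    (h2 : 0 ≤ orient a b c * orient b c p) (h3 : 0 ≤ orient a b c * orient c a p) :
    p ∈ segment ℝ a b := by
  have hs := orient_add a b c p
  have e1 := orient_bary_fst a b c p
  have e2 := orient_bary_snd a b c p
  rw [h1] at hs e1 e2
  have hsq : 0 < orient a b c * orient a b c := mul_self_pos.2 h
  have hdiv : ∀ x, 0 ≤ orient a b c * x → 0 ≤ x / orient a b c := by
    intro x hx
    have : x / orient a b c = orient a b c * x / (orient a b c * orient a b c) := by field_simp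
    rw [this]
    positivity
  refine mem_segment_prod.2 ⟨orient c a p / orient a b c, hdiv _ h3, ?_, ?_, ?_⟩
  · have h5 := hdiv _ h2
    have : orient b c p / orient a b c + orient c a p / orient a b c = 1 := by
      field_simp
      linarith
    linarith
  · field_simp
    linear_combination e1 + a.1 * hs
  · field_simp
    linear_combination e2 + a.2 * hs

theorem orient_eq_zero_of_mem {a b p : ℝ × ℝ} (h : p ∈ segment ℝ a b) : orient a b p = 0 := by
  obtain ⟨t, -, -, h1, h2⟩ := mem_segment_prod.1 h
  rw [orient_segment a b a b h1 h2, orient_self_left, orient_self_right]; ring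

/-- An affine-invariant form of the choice of a vertex of minimal angle. -/
theorem exists_vertex_min_orient {E : ℝ × ℝ → ℝ × ℝ → Prop} {P : Finset (ℝ × ℝ)} {o x y : ℝ × ℝ}
    {D : ℝ} (hDdef : D = orient o x y) (hD : D ≠ 0)
    (hE : ∀ a b, E a b → a ∈ P) (symm : ∀ a b, E a b → E b a) (hy : y ∈ P)
    (hfree : ∀ c d, E c d → ∀ r ∈ segment ℝ c d, 0 ≤ D * orient y o r → 0 < D * orient o x r →
      0 < D * orient x y r → ∀ r' ∈ segment ℝ c d, 0 ≤ D * orient y o r' → 0 ≤ D * orient o x r' →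
        0 ≤ D * orient x y r' → (orient o x r' = 0 ∨ orient x y r' = 0) → r' = o ∨ r' = y) :
    ∃ s ∈ P, 0 ≤ D * orient y o s ∧ 0 < D * orient o x s ∧ 0 ≤ D * orient x y s ∧ ∀ c d, E c d →
      ∀ r ∈ segment ℝ c d, 0 ≤ D * orient y o r → 0 < D * orient o x r → 0 < D * orient x y r →
        D * orient o s r ≤ 0 →
          orient o s r = 0 ∧ (D * orient o x s ≤ D * orient o x r ∨ o ∈ segment ℝ c d) := by
  let φ : ℝ × ℝ → ℝ × ℝ := fun r =>
    (o.1 + r.1 * (x.1 - o.1) + r.2 * (y.1 - o.1), o.2 + r.1 * (x.2 - o.2) + r.2 * (y.2 - o.2))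
  let ψ : ℝ × ℝ → ℝ × ℝ := fun r => (orient y o r / D, orient o x r / D)
  have hφψ : ∀ r, φ (ψ r) = r := by
    intro r
    have h1 := orient_bary_fst o x y r
    have h2 := orient_bary_snd o x y r
    have h3 := orient_add o x y r
    rw [← hDdef] at h1 h2 h3
    refine Prod.ext ?_ ?_ <;> simp only [φ, ψ] <;> field_simp
    · linear_combination -h1 - o.1 * h3
    · linear_combination -h2 - o.2 * h3
  have hDD : 0 < D * D := mul_self_pos.2 hD
  have g1 : ∀ r, D * orient y o (φ r) = D * D * r.1 := by
    intro r; simp only [φ, hDdef, orient]; ring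
  have g2 : ∀ r, D * orient o x (φ r) = D * D * r.2 := by
    intro r; simp only [φ, hDdef, orient]; ring
  have g3 : ∀ r, D * orient x y (φ r) = D * D * (1 - r.1 - r.2) := by
    intro r; simp only [φ, hDdef, orient]; ring
  have g4 : ∀ s r, D * orient o (φ s) (φ r) = D * D * (s.1 * r.2 - r.1 * s.2) := by
    intro s r; simp only [φ, hDdef, orient]; ring
  have hψφ : ∀ r, ψ (φ r) = r := by
    intro r
    have h1 := g1 r
    have h2 := g2 r
    refine Prod.ext ?_ ?_ <;> simp only [ψ] <;> rw [div_eq_iff hD] <;> apply mul_left_cancel₀ hD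
    · linear_combination h1
    · linear_combination h2
  have hseg : ∀ c d r, r ∈ segment ℝ c d → φ r ∈ segment ℝ (φ c) (φ d) := by
    intro c d r hr
    obtain ⟨t, h0, h1, h2, h3⟩ := mem_segment_prod.1 hr
    refine mem_segment_prod.2 ⟨t, h0, h1, ?_, ?_⟩ <;> simp only [φ, h2, h3] <;> ring
  have hseg' : ∀ c d r, r ∈ segment ℝ c d → ψ r ∈ segment ℝ (ψ c) (ψ d) := by
    intro c d r hr
    obtain ⟨t, h0, h1, h2, h3⟩ := mem_segment_prod.1 hr
    refine mem_segment_prod.2 ⟨t, h0, h1, ?_, ?_⟩ <;> simp only [ψ]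
    · rw [orient_segment _ _ c d h2 h3]; ring
    · rw [orient_segment _ _ c d h2 h3]; ring
  have hφo : φ (0, 0) = o := by simp [φ]
  have hφy : φ (0, 1) = y := by simp [φ]
  have hmem : ∀ p, p ∈ P.image ψ ↔ φ p ∈ P := by
    intro p
    simp only [Finset.mem_image]
    exact ⟨by rintro ⟨q, hq, rfl⟩; rwa [hφψ], fun h => ⟨_, h, hψφ p⟩⟩
  obtain ⟨s, hs, hs1, hs2, hs3, hmin⟩ := exists_vertex_min_angle (E := fun p q => E (φ p) (φ q))
    (P := P.image ψ) (fun a b h => (hmem a).2 (hE _ _ h)) (fun a b h => symm _ _ h)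
    ((hmem _).2 (by rwa [hφy])) (by
      intro c d hcd r hr h1 h2 h3 r' hr' h1' h2' h3' hor
      have := hfree _ _ hcd (φ r) (hseg _ _ _ hr) (by rw [g1]; positivity) (by rw [g2]; positivity)
        (by rw [g3]; exact mul_pos hDD (by linarith)) (φ r') (hseg _ _ _ hr')
        (by rw [g1]; positivity)
        (by rw [g2]; positivity) (by rw [g3]; exact mul_nonneg hDD.le (by linarith)) (by
          rcases hor with h | h
          · left; apply mul_left_cancel₀ hD; rw [g2, h]; ring
          · right; apply mul_left_cancel₀ hD; rw [g3, sub_sub, h]; ring)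
      rcases this with h | h
      · left; rw [← hψφ r', h, ← hφo, hψφ]
      · right; rw [← hψφ r', h, ← hφy, hψφ])
  refine ⟨φ s, (hmem s).1 hs, by rw [g1]; positivity, by rw [g2]; positivity,
    by rw [g3]; exact mul_nonneg hDD.le (by linarith), ?_⟩
  intro c d hcd r hr h1 h2 h3 h4
  obtain ⟨r, rfl⟩ : ∃ r', r = φ r' := ⟨ψ r, (hφψ r).symm⟩
  rw [g1] at h1
  rw [g2] at h2
  rw [g3] at h3
  rw [g4] at h4
  have hr' := hseg' _ _ _ hr
  rw [hψφ] at hr'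
  obtain ⟨k1, k2⟩ := hmin (ψ c) (ψ d) (by simpa only [hφψ] using hcd) r hr'
    (nonneg_of_mul_nonneg_right h1 hDD) ((mul_pos_iff_of_pos_left hDD).1 h2)
    (by have := (mul_pos_iff_of_pos_left hDD).1 h3; linarith)
    (by
      by_contra! hlt
      have := mul_pos hDD (sub_pos.2 hlt)
      linarith)
  refine ⟨by apply mul_left_cancel₀ hD; rw [g4, k1]; ring, ?_⟩
  rcases k2 with k | k
  · left; rw [g2, g2]; exact mul_le_mul_of_nonneg_left k hDD.le
  · right
    have := hseg _ _ _ k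
    rwa [hφψ, hφψ, hφo] at this

/-- A straight-line drawing of a graph with vertex set `P` (with a loop at every vertex) to which
no edge can be added. -/
structure MaximalDrawing (P : Finset (ℝ × ℝ)) (E : ℝ × ℝ → ℝ × ℝ → Prop) : Prop where
  mem : ∀ a b, E a b → a ∈ P
  symm : ∀ a b, E a b → E b a
  loop : ∀ a ∈ P, E a a
  cross : ∀ a b c d, E a b → E c d → s(a, b) ≠ s(c, d) → ∀ r ∈ segment ℝ a b,
    r ∈ segment ℝ c d → (r = a ∨ r = b) ∧ (r = c ∨ r = d)
  maximal : ∀ a ∈ P, ∀ b ∈ P, (∀ c d, E c d → s(a, b) ≠ s(c, d) → ∀ r ∈ segment ℝ a b,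
    r ∈ segment ℝ c d → (r = a ∨ r = b) ∧ (r = c ∨ r = d)) → E a b

/-- The open segment from `m` to `t` meets no edge. -/
def Sees (E : ℝ × ℝ → ℝ × ℝ → Prop) (m t : ℝ × ℝ) : Prop :=
  ∀ c d, E c d → ∀ r ∈ segment ℝ c d, r ∈ segment ℝ m t → r = m ∨ r = t

theorem segment_eq_of_sym2 {a b c d : ℝ × ℝ} (h : s(a, b) = s(c, d)) :
    segment ℝ a b = segment ℝ c d := by
  rcases Sym2.eq_iff.1 h with ⟨rfl, rfl⟩ | ⟨rfl, rfl⟩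
  · rfl
  · exact segment_symm _ _ _

theorem isCompact_segment_prod (a b : ℝ × ℝ) : IsCompact (segment ℝ a b) := by
  rw [segment_eq_image']
  exact isCompact_Icc.image (by fun_prop)

namespace MaximalDrawing
variable {P : Finset (ℝ × ℝ)} {E : ℝ × ℝ → ℝ × ℝ → Prop}
  {a b c d m t : ℝ × ℝ}

theorem mem_right (h : MaximalDrawing P E) (hab : E a b) : b ∈ P := h.mem _ _ (h.symm _ _ hab)

theorem eq_of_mem_segment (h : MaximalDrawing P E)
    (hcd : E c d) {p : ℝ × ℝ} (hp : p ∈ P) (hps : p ∈ segment ℝ c d) :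
    p = c ∨ p = d := by
  by_cases he : s(p, p) = s(c, d)
  · rcases Sym2.eq_iff.1 he with ⟨h1, -⟩ | ⟨h1, -⟩
    · exact Or.inl h1
    · exact Or.inr h1
  · exact (h.cross _ _ _ _ (h.loop p hp) hcd he p (left_mem_segment ℝ p p) hps).2

theorem sym2_eq_of_mem (h : MaximalDrawing P E)
    (hab : E a b) (hm : m ∈ segment ℝ a b) (hma : m ≠ a) (hmb : m ≠ b)
    (hcd : E c d) (hm' : m ∈ segment ℝ c d) : s(a, b) = s(c, d) := by
  by_contra hne
  rcases (h.cross _ _ _ _ hab hcd hne m hm hm').1 with h | h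
  · exact hma h
  · exact hmb h

theorem isCompact_edges (h : MaximalDrawing P E) (s : Sym2 (ℝ × ℝ)) :
    IsCompact {q | ∃ c d, E c d ∧ s ≠ s(c, d) ∧ q ∈ segment ℝ c d} := by
  have : {q | ∃ c d, E c d ∧ s ≠ s(c, d) ∧ q ∈ segment ℝ c d} =
      ⋃ e ∈ (P ×ˢ P).filter fun e => E e.1 e.2 ∧ s ≠ s(e.1, e.2), segment ℝ e.1 e.2 := by
    ext q
    simp only [Set.mem_ofPred_eq, Finset.mem_filter, Finset.mem_product, Set.mem_iUnion,
      exists_prop]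
    constructor
    · rintro ⟨c, d, h1, h2, h3⟩
      exact ⟨(c, d), ⟨⟨h.mem _ _ h1, h.mem_right h1⟩, h1, h2⟩, h3⟩
    · rintro ⟨⟨c, d⟩, ⟨-, h1, h2⟩, h3⟩
      exact ⟨c, d, h1, h2, h3⟩
  rw [this]
  exact Finset.isCompact_biUnion _ fun e _ => isCompact_segment_prod _ _

/-- If an edge `cd` is the first thing seen from a point `m` of the edge `ab` in the direction of
`q`, and `c` lies left of `ab`, then `m` sees a vertex. -/
theorem exists_sees_of_first_hit (h : MaximalDrawing P E)
    {q : ℝ × ℝ} (hab : E a b) (hm : m ∈ segment ℝ a b) (hma : m ≠ a)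
    (hmb : m ≠ b) (hq : 0 < orient a b q) (hqP : q ∉ P) (hcd : E c d) (hqcd : q ∈ segment ℝ c d)
    (hc : 0 < orient a b c) (hD : orient m q c ≠ 0)
    (hfirst : ∀ e f, E e f → ∀ r ∈ segment ℝ e f, r ∈ segment ℝ m q → r = m ∨ r = q) :
    ∃ t ∈ P, 0 < orient a b t ∧ Sees E m t := by
  have hmab : orient a b m = 0 := orient_eq_zero_of_mem hm
  have hline : orient q c d = 0 := by
    have := orient_eq_zero_of_mem hqcd
    rwa [← orient_rotate]
  set D := orient m q c with hDdef
  have hDD : 0 < D * D := mul_self_pos.2 hD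
  obtain ⟨s, hs, hs1, hs2, hs3, hmin⟩ := exists_vertex_min_orient hDdef hD h.mem h.symm
    (h.mem _ _ hcd) (by
      intro e f hef r hr h1 h2 h3 r' hr' h1' h2' h3' hor
      rcases hor with h0 | h0
      · have hseg : r' ∈ segment ℝ m q := mem_segment_of_orient hD h0 h3' h1'
        rcases hfirst e f hef r' hr' hseg with hh | hh
        · exact Or.inl hh
        · exfalso
          subst hh
          have := h.sym2_eq_of_mem hcd hqcd (fun hh => hqP (hh ▸ h.mem _ _ hcd))
            (fun hh => hqP (hh ▸ h.mem_right hcd)) hef hr'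
          rw [← segment_eq_of_sym2 this] at hr
          obtain ⟨t, -, -, k1, k2⟩ := mem_segment_prod.1 hr
          rw [orient_segment _ _ _ _ k1 k2, orient_self_right, hline] at h3
          simp at h3
      · have hseg : r' ∈ segment ℝ q c := by
          have e : orient q c m = D := orient_rotate m q c
          exact mem_segment_of_orient (by rwa [e]) h0 (by rwa [e]) (by rwa [e])
        have hne : s(c, d) ≠ s(e, f) := by
          intro he
          rw [← segment_eq_of_sym2 he] at hr
          obtain ⟨t, -, -, k1, k2⟩ := mem_segment_prod.1 hr
          rw [orient_segment _ _ _ _ k1 k2, orient_self_right, hline] at h3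
          simp at h3
        have hrcd : r' ∈ segment ℝ c d :=
          segment_subset_of_mem hqcd (left_mem_segment ℝ c d) hseg
        rcases (h.cross _ _ _ _ hcd hef hne r' hrcd hr').1 with rfl | rfl
        · exact Or.inr rfl
        · exfalso
          obtain ⟨t, k0, k1, k2, k3⟩ := mem_segment_prod.1 hqcd
          have e := orient_segment m q _ _ k2 k3
          rw [orient_self_right, ← hDdef] at e
          have ht : t = 1 := by
            by_contra hne
            have : 0 < 1 - t := by
              have := lt_of_le_of_ne k1 hne
              linarith
            have e2 : (1 - t) * (D * D) + t * (D * orient m q r') = 0 := by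
              linear_combination -D * e
            have := mul_pos this hDD
            have := mul_nonneg k0 h2'
            linarith
          have : q = r' := Prod.ext (by rw [k2, ht]; ring) (by rw [k3, ht]; ring)
          exact hqP (this ▸ h.mem_right hcd))
  have hpos : 0 < orient a b s := by
    have e := orient_bary m q c s a b
    rw [hmab, ← hDdef] at e
    have e2 : D * D * orient a b s = D * orient c m s * orient a b q
      + D * orient m q s * orient a b c := by linear_combination D * e
    have h1 := mul_nonneg hs1 hq.le
    have h2 := mul_pos hs2 hc
    exact (mul_pos_iff_of_pos_left hDD).1 (by linarith)
  refine ⟨s, hs, hpos, ?_⟩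
  intro e f hef r hr hrs
  obtain ⟨t, k0, k1, k2, k3⟩ := mem_segment_prod.1 hrs
  rcases k0.eq_or_lt with rfl | k0
  · exact Or.inl (Prod.ext (by rw [k2]; ring) (by rw [k3]; ring))
  rcases k1.eq_or_lt with rfl | k1
  · exact Or.inr (Prod.ext (by rw [k2]; ring) (by rw [k3]; ring))
  exfalso
  have o1 := orient_segment c m _ _ k2 k3
  have o2 := orient_segment m q _ _ k2 k3
  have o3 := orient_segment q c _ _ k2 k3
  have o4 := orient_segment m s _ _ k2 k3
  have o5 := orient_segment a b _ _ k2 k3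
  rw [orient_self_right, mul_zero, zero_add] at o1
  rw [orient_self_left, mul_zero, zero_add] at o2
  rw [orient_rotate m q c, ← hDdef] at o3
  rw [orient_self_left, orient_self_right, mul_zero, mul_zero, zero_add] at o4
  rw [hmab, mul_zero, zero_add] at o5
  have p2 := mul_pos k0 hs2
  obtain ⟨-, h2⟩ := hmin e f hef r hr (by
      rw [o1]; have := mul_nonneg k0.le hs1; linarith) (by rw [o2]; linarith)
    (by
      rw [o3]
      have := mul_nonneg k0.le hs3
      have := mul_pos (sub_pos.2 k1) hDD
      linarith) (by rw [o4, mul_zero])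
  rcases h2 with h2 | h2
  · rw [o2] at h2
    have := mul_pos (sub_pos.2 k1) hs2
    linarith
  · have he := h.sym2_eq_of_mem hab hm hma hmb hef h2
    rw [← segment_eq_of_sym2 he] at hr
    have := mul_pos k0 hpos
    rw [orient_eq_zero_of_mem hr] at o5
    linarith

theorem exists_sees (h : MaximalDrawing P E)
    {p : ℝ × ℝ} (hab : E a b) (hm : m ∈ segment ℝ a b) (hma : m ≠ a)
    (hmb : m ≠ b) (hpP : p ∈ P) (hp : 0 < orient a b p) :
    ∃ t ∈ P, 0 < orient a b t ∧ Sees E m t := by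
  have hmab : orient a b m = 0 := orient_eq_zero_of_mem hm
  have hne : ((segment ℝ m p) ∩
      {q | ∃ c d, E c d ∧ s(a, b) ≠ s(c, d) ∧ q ∈ segment ℝ c d}).Nonempty := by
    refine ⟨p, right_mem_segment ℝ m p, p, p, h.loop p hpP, fun he => ?_, left_mem_segment ℝ p p⟩
    rcases Sym2.eq_iff.1 he with ⟨h1, -⟩ | ⟨h1, -⟩
    · rw [← h1, orient_self_left] at hp
      exact hp.false
    · rw [← h1, orient_self_left] at hp
      exact hp.false
  obtain ⟨q, ⟨hqs, c, d, hcd, hncd, hqcd⟩, hmin⟩ :=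
    ((isCompact_segment_prod m p).inter (h.isCompact_edges s(a, b))).exists_isMinOn hne
      (continuous_orient a b).continuousOn
  obtain ⟨t, t0, t1, q1, q2⟩ := mem_segment_prod.1 hqs
  have hq := orient_segment a b _ _ q1 q2
  rw [hmab, mul_zero, zero_add] at hq
  have hqm : q ≠ m := by
    rintro rfl
    exact hncd (h.sym2_eq_of_mem hab hm hma hmb hcd hqcd)
  have ht0 : 0 < t := by
    refine lt_of_le_of_ne t0 fun h0 => hqm ?_
    subst h0
    exact Prod.ext (by rw [q1]; ring) (by rw [q2]; ring)
  have hqpos : 0 < orient a b q := by rw [hq]; positivity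
  have hfirst : ∀ e f, E e f → ∀ r ∈ segment ℝ e f, r ∈ segment ℝ m q → r = m ∨ r = q := by
    intro e f hef r hr hrs
    obtain ⟨w, w0, w1, r1, r2⟩ := mem_segment_prod.1 hrs
    have hro := orient_segment a b _ _ r1 r2
    rw [hmab, mul_zero, zero_add] at hro
    by_cases he : s(a, b) = s(e, f)
    · left
      rw [← segment_eq_of_sym2 he] at hr
      rw [orient_eq_zero_of_mem hr] at hro
      have : w = 0 := by
        rcases mul_eq_zero.1 hro.symm with h | h
        · exact h
        · exact absurd h hqpos.ne'
      exact Prod.ext (by rw [r1, this]; ring) (by rw [r2, this]; ring)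
    · right
      have := hmin (a := r) ⟨segment_subset_of_mem (left_mem_segment ℝ m p) hqs hrs, e, f, hef, he, hr⟩
      simp only [Set.mem_ofPred_eq] at this
      have : w = 1 := by nlinarith
      exact Prod.ext (by rw [r1, this]; ring) (by rw [r2, this]; ring)
  by_cases hqP : q ∈ P
  · exact ⟨q, hqP, hqpos, hfirst⟩
  have hqc : q ≠ c := fun hh => hqP (hh ▸ h.mem _ _ hcd)
  have hqd : q ≠ d := fun hh => hqP (hh ▸ h.mem_right hcd)
  -- neither half of the edge `cd` points along the line `mq`
  have hmP : m ∉ P := fun hmP => by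
    rcases h.eq_of_mem_segment hab hmP hm with h | h
    · exact hma h
    · exact hmb h
  have key : ∀ c d, E c d → s(a, b) ≠ s(c, d) → q ∈ segment ℝ c d → q ≠ c → q ≠ d →
      orient a b d ≤ orient a b q → orient m q c ≠ 0 := by
    intro c d hcd hncd hqcd hqc hqd hle h0
    obtain ⟨w, w0, w1, r1, r2⟩ := mem_segment_prod.1 hqcd
    have hd0 : orient m q d = 0 := by
      have e := orient_segment m q _ _ r1 r2
      rw [orient_self_right, h0, mul_zero, zero_add] at e
      rcases mul_eq_zero.1 e.symm with hw | hw
      · exact absurd (Prod.ext (by rw [r1, hw]; ring) (by rw [r2, hw]; ring)) hqc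
      · exact hw
    have e1 : orient a b q * (d.1 - m.1) = orient a b d * (q.1 - m.1) := by
      have : orient a b q * (d.1 - m.1) - orient a b d * (q.1 - m.1) =
          orient a b m * (d.1 - q.1) - (b.1 - a.1) * orient m q d := by unfold orient; ring
      rw [hmab, hd0] at this
      linarith
    have e2 : orient a b q * (d.2 - m.2) = orient a b d * (q.2 - m.2) := by
      have : orient a b q * (d.2 - m.2) - orient a b d * (q.2 - m.2) =
          orient a b m * (d.2 - q.2) - (b.2 - a.2) * orient m q d := by unfold orient; ring
      rw [hmab, hd0] at this
      linarith
    have hqne := hqpos.ne'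
    have hdP : d ∈ P := h.mem_right hcd
    rcases le_or_gt 0 (orient a b d) with hd | hd
    · have hds : d ∈ segment ℝ m q := by
        refine mem_segment_prod.2 ⟨orient a b d / orient a b q, by positivity, ?_, ?_, ?_⟩
        · rwa [div_le_one hqpos]
        · field_simp
          linarith
        · field_simp
          linarith
      rcases hfirst d d (h.loop d hdP) d (left_mem_segment ℝ d d) hds with hh | hh
      · exact hmP (hh ▸ hdP)
      · exact hqd hh.symm
    · have hms : m ∈ segment ℝ q d := by
        have hpos : 0 < orient a b q - orient a b d := by linarith
        refine mem_segment_prod.2 ⟨orient a b q / (orient a b q - orient a b d), by positivity, ?_,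
          ?_, ?_⟩
        · rw [div_le_one hpos]
          linarith
        · field_simp
          linarith
        · field_simp
          linarith
      exact hncd (h.sym2_eq_of_mem hab hm hma hmb hcd
        (segment_subset_of_mem hqcd (right_mem_segment ℝ c d) hms))
  obtain ⟨w, w0, w1, r1, r2⟩ := mem_segment_prod.1 hqcd
  have e := orient_segment a b _ _ r1 r2
  rcases le_total (orient a b d) (orient a b q) with hle | hle
  · have hlt : 0 < orient a b c := by
      have : w ≠ 1 := fun hw => hqd (Prod.ext (by rw [r1, hw]; ring) (by rw [r2, hw]; ring))
      have : w < 1 := lt_of_le_of_ne w1 this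
      by_contra! hcon
      nlinarith
    exact h.exists_sees_of_first_hit hab hm hma hmb hqpos hqP hcd hqcd hlt
      (key c d hcd hncd hqcd hqc hqd hle) hfirst
  · have hle' : orient a b c ≤ orient a b q := by
      have : w ≠ 1 := fun hw => hqd (Prod.ext (by rw [r1, hw]; ring) (by rw [r2, hw]; ring))
      have : w < 1 := lt_of_le_of_ne w1 this
      by_contra! hcon
      nlinarith
    have hqdc : q ∈ segment ℝ d c := by rwa [segment_symm]
    exact h.exists_sees_of_first_hit hab hm hma hmb hqpos hqP (h.symm _ _ hcd) hqdc
      (hqpos.trans_le hle)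
      (key d c (h.symm _ _ hcd) (by rwa [Sym2.eq_swap (a := d)]) hqdc hqd hqc hle') hfirst

end MaximalDrawing

namespace MaximalDrawing
variable {P : Finset (ℝ × ℝ)} {E : ℝ × ℝ → ℝ × ℝ → Prop}
  {a b c d m t : ℝ × ℝ}

/-- Let `t` be the vertex closest to the line `ab` among those seen from a point `m` of `ab`.
No edge passes through the interior of the triangle `amt`. -/
theorem eq_zero_of_closest (h : MaximalDrawing P E) {D : ℝ} (hDdef : D = orient a m t) (hab : E a b)
    (hm : m ∈ segment ℝ a b) (hma : m ≠ a) (hmb : m ≠ b) (ht : t ∈ P) (hmt : Sees E m t)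
    (hD : D ≠ 0)
    (hclosest : ∀ s ∈ P, Sees E m s → 0 < D * orient a m s → D * D ≤ D * orient a m s) :
    ∀ c d, E c d → ∀ r ∈ segment ℝ c d, 0 ≤ D * orient t a r → 0 < D * orient a m r →
      0 < D * orient m t r → orient t a r = 0 ∧ a ∈ segment ℝ c d := by
  have hDD : 0 < D * D := mul_self_pos.2 hD
  have hside : ∀ r ∈ segment ℝ a b, orient a m r = 0 := by
    intro r hr
    obtain ⟨w, -, -, m1, m2⟩ := mem_segment_prod.1 hm
    have : orient a m r = w * orient a b r := by unfold orient; rw [m1, m2]; ring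
    rw [this, orient_eq_zero_of_mem hr, mul_zero]
  have honly : ∀ c d, E c d → ∀ r ∈ segment ℝ c d, 0 < D * orient a m r → m ∉ segment ℝ c d := by
    intro c d hcd r hr hpos hmcd
    have := h.sym2_eq_of_mem hab hm hma hmb hcd hmcd
    rw [← segment_eq_of_sym2 this] at hr
    rw [hside r hr, mul_zero] at hpos
    exact hpos.false
  obtain ⟨s, hs, hs1, hs2, hs3, hmin⟩ := exists_vertex_min_orient hDdef hD h.mem h.symm ht (by
    intro e f hef r hr h1 h2 h3 r' hr' h1' h2' h3' hor
    rcases hor with h0 | h0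
    · have hseg : r' ∈ segment ℝ a m :=
        mem_segment_of_orient (hDdef ▸ hD) h0 (hDdef ▸ h3') (hDdef ▸ h1')
      have hsab := segment_subset_of_mem (left_mem_segment ℝ a b) hm hseg
      have hne : s(a, b) ≠ s(e, f) := by
        intro he
        rw [← segment_eq_of_sym2 he] at hr
        rw [hside r hr, mul_zero] at h2
        exact h2.false
      rcases (h.cross _ _ _ _ hab hef hne r' hsab hr').1 with hh | hh
      · exact Or.inl hh
      · exfalso
        subst hh
        obtain ⟨w, w0, w1, m1, m2⟩ := mem_segment_prod.1 hm
        obtain ⟨x, x0, x1, y1, y2⟩ := mem_segment_prod.1 hseg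
        have hxw : (1 - x * w) * (r'.1 - a.1) = 0 := by rw [m1] at y1; linarith
        have hxw' : (1 - x * w) * (r'.2 - a.2) = 0 := by rw [m2] at y2; linarith
        have hw : w < 1 := lt_of_le_of_ne w1 fun hw => hmb (by
          subst hw
          exact Prod.ext (by rw [m1]; ring) (by rw [m2]; ring))
        have hne' : 1 - x * w ≠ 0 := by nlinarith
        have k1 := (mul_eq_zero.1 hxw).resolve_left hne'
        have k2 := (mul_eq_zero.1 hxw').resolve_left hne'
        exact hma (Prod.ext (by rw [m1, k1]; ring) (by rw [m2, k2]; ring))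
    · have e1 : orient m t a = D := by rw [hDdef, orient_rotate]
      have hseg : r' ∈ segment ℝ m t :=
        mem_segment_of_orient (by rwa [e1]) h0 (by rwa [e1]) (by rwa [e1])
      rcases hmt e f hef r' hr' hseg with rfl | rfl
      · exact absurd hr' (honly e f hef r hr h2)
      · exact Or.inr rfl)
  have hst : s = t := by
    by_contra hst
    have hs3' : 0 < D * orient m t s := by
      refine lt_of_le_of_ne hs3 fun h0 => hst ?_
      have h0 : orient m t s = 0 := by
        rcases mul_eq_zero.1 h0.symm with hh | hh
        · exact absurd hh hD
        · exact hh
      have e1 : orient m t a = D := by rw [hDdef, orient_rotate]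
      have hseg : s ∈ segment ℝ m t :=
        mem_segment_of_orient (by rwa [e1]) h0 (by rwa [e1]) (by rw [e1]; exact hs2.le)
      rcases hmt s s (h.loop s hs) s (left_mem_segment ℝ s s) hseg with rfl | rfl
      · rw [orient_self_right, mul_zero] at hs2
        exact absurd hs2 (lt_irrefl _)
      · rfl
    have hsees : Sees E m s := by
      intro e f hef r hr hrs
      by_contra! hne
      obtain ⟨x, x0, x1, y1, y2⟩ := mem_segment_prod.1 hrs
      have x0 : 0 < x := lt_of_le_of_ne x0 fun hx => hne.1 (by
          subst hx
          exact Prod.ext (by rw [y1]; ring) (by rw [y2]; ring))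
      have x1 : x < 1 := lt_of_le_of_ne x1 fun hx => hne.2 (by
          subst hx
          exact Prod.ext (by rw [y1]; ring) (by rw [y2]; ring))
      have o1 := orient_segment t a _ _ y1 y2
      have o2 := orient_segment a m _ _ y1 y2
      have o3 := orient_segment m t _ _ y1 y2
      have o4 := orient_segment a s _ _ y1 y2
      rw [← orient_rotate t a m, ← hDdef] at o1
      rw [orient_self_right, mul_zero, zero_add] at o2
      rw [orient_self_left, mul_zero, zero_add] at o3
      rw [orient_self_right, mul_zero, add_zero] at o4
      have e4 : orient a s m = -orient a m s := by unfold orient; ring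
      rw [e4] at o4
      have p1 := mul_nonneg x0.le hs1
      have p2 := mul_pos x0 hs2
      have p3 := mul_pos x0 hs3'
      have p4 := mul_pos (sub_pos.2 x1) hs2
      have p5 := mul_pos (sub_pos.2 x1) hDD
      obtain ⟨h0, -⟩ := hmin e f hef r hr (by rw [o1]; linarith) (by rw [o2]; linarith)
        (by rw [o3]; linarith) (by rw [o4]; linarith)
      rw [h0] at o4
      have : (1 - x) * (D * orient a m s) = 0 := by linear_combination D * o4
      linarith
    have hle := hclosest s hs hsees hs2
    have e := orient_add a m t s
    rw [← hDdef] at e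
    have : D * orient m t s + D * orient t a s + D * orient a m s = D * D := by rw [← e]; ring
    linarith
  subst hst
  intro c d hcd r hr h1 h2 h3
  have e4 : orient a s r = -orient s a r := by unfold orient; ring
  obtain ⟨k1, k2⟩ := hmin c d hcd r hr h1 h2 h3 (by rw [e4]; linarith)
  refine ⟨by rw [e4] at k1; linarith, k2.resolve_left fun hle => ?_⟩
  have e := orient_add a m s r
  rw [← hDdef] at e
  have : D * orient m s r + D * orient s a r + D * orient a m r = D * D := by rw [← e]; ring
  rw [← hDdef] at hle
  linarith

theorem adj_of_closest (h : MaximalDrawing P E)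
    {D : ℝ} (hDdef : D = orient a m t) (hab : E a b) (ht : t ∈ P)
    (hD : D ≠ 0)
    (hempty : ∀ c d, E c d → ∀ r ∈ segment ℝ c d, 0 ≤ D * orient t a r → 0 < D * orient a m r →
      0 < D * orient m t r → orient t a r = 0 ∧ a ∈ segment ℝ c d) : E a t := by
  have haP := h.mem _ _ hab
  have hDD : 0 < D * D := mul_self_pos.2 hD
  have hat : a ≠ t := by
    rintro rfl
    rw [orient_self_left] at hDdef
    exact hD hDdef
  have hopen : ∀ c d, E c d → ∀ r ∈ segment ℝ c d, r ∈ segment ℝ a t → r ≠ a → r ≠ t →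
      a ∈ segment ℝ c d := by
    intro c d hcd r hr hrat hra hrt
    obtain ⟨x, x0, x1, y1, y2⟩ := mem_segment_prod.1 hrat
    have x0 : 0 < x := lt_of_le_of_ne x0 fun hx => hra (by
        subst hx
        exact Prod.ext (by rw [y1]; ring) (by rw [y2]; ring))
    have x1 : x < 1 := lt_of_le_of_ne x1 fun hx => hrt (by
        subst hx
        exact Prod.ext (by rw [y1]; ring) (by rw [y2]; ring))
    have o1 := orient_segment t a _ _ y1 y2
    have o2 := orient_segment a m _ _ y1 y2
    have o3 := orient_segment m t _ _ y1 y2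
    rw [orient_self_left, orient_self_right] at o1
    rw [orient_self_left, ← hDdef] at o2
    rw [orient_self_right, orient_rotate a m t, ← hDdef] at o3
    refine (hempty c d hcd r hr (by rw [o1]; simp) ?_ ?_).2
    · rw [o2]
      have := mul_pos x0 hDD
      linarith
    · rw [o3]
      have := mul_pos (sub_pos.2 x1) hDD
      linarith
  refine h.maximal _ haP _ ht fun c d hcd hne r hr hrcd => ?_
  by_cases hra : r = a
  · subst hra
    exact ⟨Or.inl rfl, h.eq_of_mem_segment hcd haP hrcd⟩
  by_cases hrt : r = t
  · subst hrt
    exact ⟨Or.inr rfl, h.eq_of_mem_segment hcd ht hrcd⟩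
  exfalso
  have key : ∀ d, E a d → t ≠ d → r ∈ segment ℝ a d → False := by
    intro d had htd hrd
    obtain ⟨x, x0, x1, y1, y2⟩ := mem_segment_prod.1 hr
    obtain ⟨z, z0, z1, w1, w2⟩ := mem_segment_prod.1 hrd
    have x0 : 0 < x := lt_of_le_of_ne x0 fun hx => hra (by
        subst hx
        exact Prod.ext (by rw [y1]; ring) (by rw [y2]; ring))
    have z0 : 0 < z := lt_of_le_of_ne z0 fun hx => hra (by
        subst hx
        exact Prod.ext (by rw [w1]; ring) (by rw [w2]; ring))
    have hd := h.mem_right had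
    rcases le_total x z with hxz | hxz
    · have : d ∈ segment ℝ a t := by
        refine mem_segment_prod.2 ⟨x / z, by positivity, (div_le_one z0).2 hxz, ?_, ?_⟩ <;>
          field_simp <;> linarith
      by_cases hda : d = a
      · subst hda
        rw [segment_same] at hrd
        exact hra hrd
      have := hopen d d (h.loop d hd) d (left_mem_segment ℝ d d) this hda htd.symm
      rw [segment_same] at this
      exact hda this.symm
    · have : t ∈ segment ℝ a d := by
        refine mem_segment_prod.2 ⟨z / x, by positivity, (div_le_one x0).2 hxz, ?_, ?_⟩ <;>
          field_simp <;> linarith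
      rcases h.eq_of_mem_segment had ht this with hh | hh
      · exact hat hh.symm
      · exact htd hh
  rcases h.eq_of_mem_segment hcd haP (hopen c d hcd r hrcd hr hra hrt) with rfl | rfl
  · exact key d hcd (fun hh => hne (by rw [hh])) hrcd
  · rw [segment_symm] at hrcd
    exact key c (h.symm _ _ hcd) (fun hh => hne (by rw [hh, Sym2.eq_swap])) hrcd

end MaximalDrawing

/-- `abc` is a counterclockwise triangle of edges containing no further vertex. -/
structure Face (P : Finset (ℝ × ℝ)) (E : ℝ × ℝ → ℝ × ℝ → Prop) (a b c : ℝ × ℝ) : Prop where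
  pos : 0 < orient a b c
  adj₁ : E a b
  adj₂ : E b c
  adj₃ : E c a
  eq_of_mem : ∀ p ∈ P, 0 ≤ orient a b p → 0 ≤ orient b c p → 0 ≤ orient c a p →
    p = a ∨ p = b ∨ p = c

namespace MaximalDrawing
variable {P : Finset (ℝ × ℝ)} {E : ℝ × ℝ → ℝ × ℝ → Prop}
  {a b c d m t : ℝ × ℝ}

/-- An edge with a vertex on its left lies on a face to its left. -/
theorem exists_face (h : MaximalDrawing P E) (hab : E a b) (hne : a ≠ b) {p : ℝ × ℝ} (hp : p ∈ P)
    (hpos : 0 < orient a b p) : ∃ c, Face P E a b c := by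
  set m : ℝ × ℝ := ((a.1 + b.1) / 2, (a.2 + b.2) / 2) with hmdef
  have hm : m ∈ segment ℝ a b :=
    mem_segment_prod.2 ⟨1 / 2, by norm_num, by norm_num, by simp only [hmdef]; ring,
      by simp only [hmdef]; ring⟩
  have hma : m ≠ a := fun hh => hne (by
    have h1 := congrArg Prod.fst hh
    have h2 := congrArg Prod.snd hh
    simp only [hmdef] at h1 h2
    exact Prod.ext (by linarith) (by linarith))
  have hmb : m ≠ b := fun hh => hne (by
    have h1 := congrArg Prod.fst hh
    have h2 := congrArg Prod.snd hh
    simp only [hmdef] at h1 h2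
    exact Prod.ext (by linarith) (by linarith))
  have hmP : m ∉ P := fun hmP => by
    rcases h.eq_of_mem_segment hab hmP hm with h | h
    · exact hma h
    · exact hmb h
  obtain ⟨t₀, ht₀, ht₀', hs₀⟩ := h.exists_sees hab hm hma hmb hp hpos
  obtain ⟨t, htm, hmin⟩ := (P.filter fun t => 0 < orient a b t ∧ Sees E m t).exists_min_image
    (fun t => orient a b t) ⟨t₀, by simp [ht₀, ht₀', hs₀]⟩
  obtain ⟨ht, htpos, hsees⟩ := Finset.mem_filter.1 htm
  have oa : ∀ s, orient a m s = orient a b s / 2 := by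
    intro s; simp only [hmdef, orient]; ring
  have ob : ∀ s, orient b m s = -(orient a b s / 2) := by
    intro s; simp only [hmdef, orient]; ring
  have hDa : orient a m t ≠ 0 := by rw [oa]; positivity
  have hDb : orient b m t ≠ 0 := by rw [ob, neg_ne_zero]; positivity
  have hca := h.eq_zero_of_closest rfl hab hm hma hmb ht hsees hDa (by
    intro s hs hss hp
    rw [oa, oa] at *
    have := hmin s (Finset.mem_filter.2 ⟨hs, by
      have := (mul_pos_iff_of_pos_left (by linarith)).1 hp
      linarith, hss⟩)
    nlinarith)
  have hba := h.symm _ _ hab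
  have hcb := h.eq_zero_of_closest rfl hba (by rwa [segment_symm]) hmb hma ht hsees hDb (by
    intro s hs hss hp
    rw [ob, ob] at *
    have := hmin s (Finset.mem_filter.2 ⟨hs, by
      rw [neg_mul_neg] at hp
      have := (mul_pos_iff_of_pos_left (by linarith)).1 hp
      linarith, hss⟩)
    nlinarith)
  refine ⟨t, htpos, hab, h.adj_of_closest rfl hba ht hDb hcb,
    h.symm _ _ (h.adj_of_closest rfl hab ht hDa hca), fun p hp h1 h2 h3 => ?_⟩
  rcases h1.eq_or_lt with h0 | h1
  · have := h.eq_of_mem_segment hab hp (mem_segment_of_orient htpos.ne' h0.symm (by positivity)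
      (by positivity))
    tauto
  rcases lt_trichotomy (orient m t p) 0 with h4 | h4 | h4
  · have hD : orient b m t < 0 := by rw [ob]; linarith
    have := (hcb p p (h.loop p hp) p (left_mem_segment ℝ p p)
      (mul_nonneg_of_nonpos_of_nonpos hD.le (by
        have : orient t b p = -orient b t p := by unfold orient; ring
        linarith)) (mul_pos_of_neg_of_neg hD (by rw [ob]; linarith))
      (mul_pos_of_neg_of_neg hD h4)).2
    rw [segment_same] at this
    exact Or.inr (Or.inl this.symm)
  · have e1 : orient m t a = orient a m t := orient_rotate _ _ _
    have hD : 0 < orient a m t := by rw [oa]; linarith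
    have : p ∈ segment ℝ m t := mem_segment_of_orient (by rwa [e1]) h4
      (by rw [e1]; positivity) (by rw [e1, oa p]; positivity)
    rcases hsees p p (h.loop p hp) p (left_mem_segment ℝ p p) this with rfl | rfl
    · exact absurd hp hmP
    · exact Or.inr (Or.inr rfl)
  · have hD : 0 < orient a m t := by rw [oa]; linarith
    have := (hca p p (h.loop p hp) p (left_mem_segment ℝ p p) (by positivity)
      (by rw [oa p]; positivity) (by positivity)).2
    rw [segment_same] at this
    exact Or.inl this.symm

end MaximalDrawing

theorem exists_mem_sides {a b c z q : ℝ × ℝ} (habc : 0 < orient a b c)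
    (h1 : 0 ≤ orient a b z) (h2 : 0 ≤ orient b c z) (h3 : 0 ≤ orient c a z)
    (hq : ¬(0 < orient a b q ∧ 0 < orient b c q ∧ 0 < orient c a q)) :
    ∃ w ∈ segment ℝ z q, w ∈ segment ℝ a b ∨ w ∈ segment ℝ b c ∨ w ∈ segment ℝ c a := by
  obtain ⟨w, hw, h0⟩ := exists_mem_segment_eq_zero
    (h := fun z => min (orient a b z) (min (orient b c z) (orient c a z)))
    ((continuous_orient a b).min ((continuous_orient b c).min (continuous_orient c a)))
    (r := z) (d := q) (le_min h1 (le_min h2 h3)) (by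
      by_contra! hlt
      rw [lt_min_iff, lt_min_iff] at hlt
      exact hq hlt)
  have hb : orient b c a = orient a b c := orient_rotate a b c
  have hc : orient c a b = orient a b c := (orient_rotate c a b).symm
  have w1 : 0 ≤ orient a b w := h0.symm.le.trans (min_le_left _ _)
  have w2 : 0 ≤ orient b c w := h0.symm.le.trans ((min_le_right _ _).trans (min_le_left _ _))
  have w3 : 0 ≤ orient c a w := h0.symm.le.trans ((min_le_right _ _).trans (min_le_right _ _))
  refine ⟨w, hw, ?_⟩
  have : orient a b w = 0 ∨ orient b c w = 0 ∨ orient c a w = 0 := by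
    rcases min_choice (orient a b w) (min (orient b c w) (orient c a w)) with h | h
    · exact Or.inl (h.symm.trans h0)
    · rcases min_choice (orient b c w) (orient c a w) with h' | h'
      · exact Or.inr (Or.inl ((h.trans h').symm.trans h0))
      · exact Or.inr (Or.inr ((h.trans h').symm.trans h0))
  rcases this with h | h | h
  · exact Or.inl (mem_segment_of_orient habc.ne' h (by positivity) (by positivity))
  · exact Or.inr (Or.inl (mem_segment_of_orient (by rw [hb]; exact habc.ne') h
      (by rw [hb]; positivity) (by rw [hb]; positivity)))
  · exact Or.inr (Or.inr (mem_segment_of_orient (by rw [hc]; exact habc.ne') h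
      (by rw [hc]; positivity) (by rw [hc]; positivity)))

theorem frequently_orient_pos {a b w : ℝ × ℝ} (hab : a ≠ b) (hw : w ∈ segment ℝ a b) :
    ∃ᶠ z in nhds w, 0 < orient a b z := by
  have ht : Filter.Tendsto (fun e : ℝ => (w.1 - e * (b.2 - a.2), w.2 + e * (b.1 - a.1)))
      (nhdsWithin 0 (Set.Ioi 0)) (nhds w) := by
    have hc : Continuous (fun e : ℝ => (w.1 - e * (b.2 - a.2), w.2 + e * (b.1 - a.1))) := by
      fun_prop
    have := hc.tendsto 0
    simp only [zero_mul, sub_zero, add_zero] at this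
    exact this.mono_left nhdsWithin_le_nhds
  refine ht.frequently (Filter.Eventually.frequently ?_)
  filter_upwards [self_mem_nhdsWithin] with e he
  have e1 : orient a b (w.1 - e * (b.2 - a.2), w.2 + e * (b.1 - a.1)) =
      orient a b w + e * ((b.1 - a.1) ^ 2 + (b.2 - a.2) ^ 2) := by unfold orient; ring
  rw [e1, orient_eq_zero_of_mem hw, zero_add]
  refine mul_pos he ?_
  by_contra! hle
  refine hab (Prod.ext ?_ ?_) <;>
    nlinarith [sq_nonneg (b.1 - a.1), sq_nonneg (b.2 - a.2)]

theorem exists_mem_segment_ne {a b : ℝ × ℝ} (hab : a ≠ b) :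
    ∃ m ∈ segment ℝ a b, m ≠ a ∧ m ≠ b := by
  refine ⟨((a.1 + b.1) / 2, (a.2 + b.2) / 2),
    mem_segment_prod.2 ⟨1 / 2, by norm_num, by norm_num, by ring, by ring⟩, ?_, ?_⟩ <;>
  · rintro hh
    have h1 := congrArg Prod.fst hh
    have h2 := congrArg Prod.snd hh
    simp only at h1 h2
    exact hab (Prod.ext (by linarith) (by linarith))

namespace Face
variable {P : Finset (ℝ × ℝ)} {E : ℝ × ℝ → ℝ × ℝ → Prop} {a b c a' b' c' z w : ℝ × ℝ}

theorem rotate (hf : Face P E a b c) : Face P E b c a where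
  pos := (orient_rotate a b c).symm ▸ hf.pos
  adj₁ := hf.adj₂
  adj₂ := hf.adj₃
  adj₃ := hf.adj₁
  eq_of_mem p hp h1 h2 h3 := by
    rcases hf.eq_of_mem p hp h3 h1 h2 with h | h | h <;> simp [h]

theorem ne (hf : Face P E a b c) : a ≠ b := by
  rintro rfl
  have := hf.pos
  rw [orient_self] at this
  exact this.false

theorem eventually (hf : Face P E a b c) (hw : w ∈ segment ℝ a b) (hwa : w ≠ a) (hwb : w ≠ b) :
    ∀ᶠ z in nhds w, 0 < orient b c z ∧ 0 < orient c a z := by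
  obtain ⟨t, t0, t1, w1, w2⟩ := mem_segment_prod.1 hw
  have t0 : 0 < t := lt_of_le_of_ne t0 fun hx => hwa (by
    subst hx
    exact Prod.ext (by rw [w1]; ring) (by rw [w2]; ring))
  have t1 : t < 1 := lt_of_le_of_ne t1 fun hx => hwb (by
    subst hx
    exact Prod.ext (by rw [w1]; ring) (by rw [w2]; ring))
  have o1 := orient_segment b c _ _ w1 w2
  have o2 := orient_segment c a _ _ w1 w2
  rw [orient_self_left, orient_rotate a b c] at o1
  rw [orient_self_right, ← orient_rotate c a b] at o2
  have := hf.pos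
  have p1 : 0 < orient b c w := by
    rw [o1]
    have := mul_pos (sub_pos.2 t1) this
    linarith
  have p2 : 0 < orient c a w := by
    rw [o2]
    have := mul_pos t0 this
    linarith
  exact ((continuous_orient b c).continuousAt.eventually_const_lt p1).and
    ((continuous_orient c a).continuousAt.eventually_const_lt p2)

theorem not_mem_interior (hf : Face P E a b c) (hz : z ∈ P) :
    ¬(0 < orient a b z ∧ 0 < orient b c z ∧ 0 < orient c a z) := by
  rintro ⟨h1, h2, h3⟩
  rcases hf.eq_of_mem z hz h1.le h2.le h3.le with rfl | rfl | rfl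
  · rw [orient_self_left] at h1; exact h1.false
  · rw [orient_self_right] at h1; exact h1.false
  · rw [orient_self_right] at h2; exact h2.false

end Face

namespace MaximalDrawing
variable {P : Finset (ℝ × ℝ)} {E : ℝ × ℝ → ℝ × ℝ → Prop}
  {a b c a' b' c' p q z w : ℝ × ℝ}

/-- Edges do not meet the interior of a face. -/
theorem edge_not_mem_interior (h : MaximalDrawing P E)
    (hf : Face P E a b c) (hpq : E p q) (hz : z ∈ segment ℝ p q) :
    ¬(0 < orient a b z ∧ 0 < orient b c z ∧ 0 < orient c a z) := by
  rintro ⟨h1, h2, h3⟩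
  have hzP : z ∉ P := fun hzP => hf.not_mem_interior hzP ⟨h1, h2, h3⟩
  have key : ∀ p q, E p q → z ∈ segment ℝ p q → q = a ∨ q = b ∨ q = c := by
    intro p q hpq hz
    obtain ⟨w, hw, hside⟩ := exists_mem_sides hf.pos h1.le h2.le h3.le
      (hf.not_mem_interior (h.mem_right hpq))
    have hwpq := segment_subset_of_mem hz (right_mem_segment ℝ p q) hw
    have hstep : ∀ x y, E x y → 0 < orient x y z → w ∈ segment ℝ x y → q = x ∨ q = y := by
      intro x y hxy hpos hwxy
      have hne : s(p, q) ≠ s(x, y) := by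
        intro he
        rw [segment_eq_of_sym2 he] at hz
        exact hpos.ne' (orient_eq_zero_of_mem hz)
      obtain ⟨k1, k2⟩ := h.cross _ _ _ _ hpq hxy hne w hwpq hwxy
      rcases k1 with rfl | rfl
      · exfalso
        obtain ⟨t, t0, t1, z1, z2⟩ := mem_segment_prod.1 hz
        obtain ⟨s, s0, s1, w1, w2⟩ := mem_segment_prod.1 hw
        have ht : 0 < t := lt_of_le_of_ne t0 fun ht => hzP (by
          have : z = w := by
            rw [← ht] at z1 z2
            exact Prod.ext (by linarith) (by linarith)
          rw [this]
          exact h.mem _ _ hpq)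
        have hne : 0 < t + s * (1 - t) := by nlinarith
        have e1 : (t + s * (1 - t)) * (q.1 - w.1) = 0 := by
          rw [z1] at w1; linarith
        have e2 : (t + s * (1 - t)) * (q.2 - w.2) = 0 := by
          rw [z2] at w2; linarith
        have e1 := (mul_eq_zero.1 e1).resolve_left hne.ne'
        have e2 := (mul_eq_zero.1 e2).resolve_left hne.ne'
        exact hzP (by
          have : z = w := Prod.ext (by rw [z1, e1]; ring) (by rw [z2, e2]; ring)
          rw [this]
          exact h.mem _ _ hpq)
      · exact k2
    rcases hside with hs | hs | hs
    · have := hstep _ _ hf.adj₁ h1 hs; tauto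
    · have := hstep _ _ hf.adj₂ h2 hs; tauto
    · have := hstep _ _ hf.adj₃ h3 hs; tauto
  have hq := key p q hpq hz
  have hp := key q p (h.symm _ _ hpq) (by rwa [segment_symm])
  obtain ⟨t, t0, t1, z1, z2⟩ := mem_segment_prod.1 hz
  rw [orient_segment _ _ _ _ z1 z2] at h1 h2 h3
  rcases hp with rfl | rfl | rfl <;> rcases hq with rfl | rfl | rfl <;>
    simp [orient_self_left, orient_self_right] at h1 h2 h3

/-- Two faces with a common interior point coincide. -/
theorem face_eq (h : MaximalDrawing P E) (hf : Face P E a b c) (hf' : Face P E a' b' c')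
    (hz : 0 < orient a b z ∧ 0 < orient b c z ∧ 0 < orient c a z)
    (hz' : 0 < orient a' b' z ∧ 0 < orient b' c' z ∧ 0 < orient c' a' z) :
    ({a, b, c} : Finset (ℝ × ℝ)) = {a', b', c'} := by
  have key : ∀ a' b' c', Face P E a' b' c' →
      (0 < orient a' b' z ∧ 0 < orient b' c' z ∧ 0 < orient c' a' z) → a' = a ∨ a' = b ∨ a' = c := by
    intro a' b' c' hf' hz'
    have ha' := h.mem _ _ hf'.adj₁
    obtain ⟨w, hw, hside⟩ := exists_mem_sides hf.pos hz.1.le hz.2.1.le hz.2.2.le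
      (hf.not_mem_interior ha')
    obtain ⟨t, t0, t1, w1, w2⟩ := mem_segment_prod.1 hw
    rcases t1.eq_or_lt with rfl | t1
    · have hwa : w = a' := Prod.ext (by rw [w1]; ring) (by rw [w2]; ring)
      subst hwa
      rcases hside with hs | hs | hs
      · have := h.eq_of_mem_segment hf.adj₁ ha' hs; tauto
      · have := h.eq_of_mem_segment hf.adj₂ ha' hs; tauto
      · have := h.eq_of_mem_segment hf.adj₃ ha' hs; tauto
    · exfalso
      have o1 := orient_segment a' b' _ _ w1 w2
      have o2 := orient_segment b' c' _ _ w1 w2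
      have o3 := orient_segment c' a' _ _ w1 w2
      rw [orient_self_left] at o1
      rw [orient_rotate a' b' c'] at o2
      rw [orient_self_right] at o3
      have p1 := mul_pos (sub_pos.2 t1) hz'.1
      have p2 := mul_pos (sub_pos.2 t1) hz'.2.1
      have p3 := mul_pos (sub_pos.2 t1) hz'.2.2
      have p4 := mul_nonneg t0 hf'.pos.le
      have hin : 0 < orient a' b' w ∧ 0 < orient b' c' w ∧ 0 < orient c' a' w :=
        ⟨by linarith, by linarith, by linarith⟩
      rcases hside with hs | hs | hs
      · exact h.edge_not_mem_interior hf' hf.adj₁ hs hin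
      · exact h.edge_not_mem_interior hf' hf.adj₂ hs hin
      · exact h.edge_not_mem_interior hf' hf.adj₃ hs hin
  have k1 := key _ _ _ hf' hz'
  have k2 := key _ _ _ hf'.rotate ⟨hz'.2.1, hz'.2.2, hz'.1⟩
  have k3 := key _ _ _ hf'.rotate.rotate ⟨hz'.2.2, hz'.1, hz'.2.1⟩
  have n1 := hf'.ne
  have n2 := hf'.rotate.ne
  have n3 := hf'.rotate.rotate.ne
  ext x
  simp only [Finset.mem_insert, Finset.mem_singleton]
  constructor
  · rintro (rfl | rfl | rfl) <;> grind
  · rintro (rfl | rfl | rfl) <;> assumption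

theorem face_unique (h : MaximalDrawing P E)
    (hf : Face P E a b c) (hf' : Face P E a b c') : c = c' := by
  obtain ⟨m, hm, hma, hmb⟩ := exists_mem_segment_ne hf.ne
  obtain ⟨z, hz, hz1, hz2⟩ := ((frequently_orient_pos hf.ne hm).and_eventually
    ((hf.eventually hm hma hmb).and (hf'.eventually hm hma hmb))).exists
  have he := h.face_eq hf hf' ⟨hz, hz1⟩ ⟨hz, hz2⟩
  have hc : c ∈ ({a, b, c'} : Finset (ℝ × ℝ)) := he ▸ by simp
  simp only [Finset.mem_insert, Finset.mem_singleton] at hc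
  rcases hc with hc | hc | hc
  · exact absurd hc hf.rotate.rotate.ne
  · exact absurd hc.symm hf.rotate.ne
  · exact hc

end MaximalDrawing

/-- `ABC` is a triangle of points of `P` containing all other points of `P` in its interior, and
there are such points. -/
structure Hull (P : Finset (ℝ × ℝ)) (A B C : ℝ × ℝ) : Prop where
  pos : 0 < orient A B C
  mem : A ∈ P ∧ B ∈ P ∧ C ∈ P
  inside : ∀ p ∈ P, p = A ∨ p = B ∨ p = C ∨ (0 < orient A B p ∧ 0 < orient B C p ∧ 0 < orient C A p)
  exists_inside : ∃ p ∈ P, 0 < orient A B p ∧ 0 < orient B C p ∧ 0 < orient C A p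

/-- `ab` is a side of `ABC`, traversed clockwise. -/
def RevSide (A B C a b : ℝ × ℝ) : Prop := (a = B ∧ b = A) ∨ (a = C ∧ b = B) ∨ (a = A ∧ b = C)

/-- `T` is the face to the left of the edge `ab`, possibly the unbounded face `ABC`. -/
def LeftFace (P : Finset (ℝ × ℝ)) (E : ℝ × ℝ → ℝ × ℝ → Prop) (A B C a b : ℝ × ℝ)
    (T : Finset (ℝ × ℝ)) : Prop :=
  (∃ c, Face P E a b c ∧ T = {a, b, c}) ∨ (RevSide A B C a b ∧ T = {A, B, C})

/-- The faces, including the unbounded one. -/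
noncomputable def faces (P : Finset (ℝ × ℝ)) (E : ℝ × ℝ → ℝ × ℝ → Prop) (A B C : ℝ × ℝ) :
    Finset (Finset (ℝ × ℝ)) :=
  P.powerset.filter fun T => T = {A, B, C} ∨ ∃ a b c, Face P E a b c ∧ T = {a, b, c}

namespace Hull
variable {P : Finset (ℝ × ℝ)} {E : ℝ × ℝ → ℝ × ℝ → Prop} {A B C : ℝ × ℝ}
  {a b c p : ℝ × ℝ}

theorem rotate (H : Hull P A B C) : Hull P B C A where
  pos := (orient_rotate A B C).symm ▸ H.pos
  mem := ⟨H.mem.2.1, H.mem.2.2, H.mem.1⟩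
  inside p hp := by rcases H.inside p hp with h | h | h | h <;> tauto
  exists_inside := by
    obtain ⟨p, hp, h1, h2, h3⟩ := H.exists_inside
    exact ⟨p, hp, h2, h3, h1⟩

theorem ne (H : Hull P A B C) : A ≠ B := by
  rintro rfl
  have := H.pos
  rw [orient_self] at this
  exact this.false

theorem nonneg (H : Hull P A B C)
    (hp : p ∈ P) : 0 ≤ orient A B p ∧ 0 ≤ orient B C p ∧ 0 ≤ orient C A p := by
  have h1 := H.pos.le
  have h2 := H.rotate.pos.le
  have h3 := H.rotate.rotate.pos.le
  rcases H.inside p hp with rfl | rfl | rfl | ⟨h1, h2, h3⟩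
  · exact ⟨(orient_self_left _ _).ge, h2, (orient_self_right _ _).ge⟩
  · exact ⟨(orient_self_right _ _).ge, (orient_self_left _ _).ge, h3⟩
  · exact ⟨h1, (orient_self_right _ _).ge, (orient_self_left _ _).ge⟩
  · exact ⟨h1.le, h2.le, h3.le⟩

theorem eq_of_eq_zero (H : Hull P A B C) (hp : p ∈ P) (h0 : orient A B p = 0) : p = A ∨ p = B := by
  rcases H.inside p hp with rfl | rfl | rfl | ⟨h1, h2, h3⟩
  · exact Or.inl rfl
  · exact Or.inr rfl
  · exact absurd h0 H.pos.ne'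
  · exact absurd h0 h1.ne'

theorem adj (H : Hull P A B C) (h : MaximalDrawing P E) : E A B := by
  refine h.maximal _ H.mem.1 _ H.mem.2.1 fun c d hcd hne r hr hrcd => ?_
  have hc := h.mem _ _ hcd
  have hd := h.mem_right hcd
  obtain ⟨t, t0, t1, r1, r2⟩ := mem_segment_prod.1 hrcd
  have o := orient_segment A B _ _ r1 r2
  rw [orient_eq_zero_of_mem hr] at o
  have h1 := mul_nonneg (sub_nonneg.2 t1) (H.nonneg hc).1
  have h2 := mul_nonneg t0 (H.nonneg hd).1
  rcases mul_eq_zero.1 (show (1 - t) * orient A B c = 0 by linarith) with h3 | h3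
  · have : t = 1 := by linarith
    subst this
    have hrd : r = d := Prod.ext (by rw [r1]; ring) (by rw [r2]; ring)
    subst hrd
    exact ⟨H.eq_of_eq_zero hd (orient_eq_zero_of_mem hr), Or.inr rfl⟩
  · rcases mul_eq_zero.1 (show t * orient A B d = 0 by linarith) with h4 | h4
    · subst h4
      have hrc : r = c := Prod.ext (by rw [r1]; ring) (by rw [r2]; ring)
      subst hrc
      exact ⟨H.eq_of_eq_zero hc (orient_eq_zero_of_mem hr), Or.inl rfl⟩
    · have hcd' : c = d := by
        rcases H.eq_of_eq_zero hc h3 with rfl | rfl <;> rcases H.eq_of_eq_zero hd h4 with rfl | rfl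
        · rfl
        · exact absurd rfl hne
        · exact absurd Sym2.eq_swap hne
        · rfl
      subst hcd'
      rw [segment_same] at hrcd
      rw [hrcd]
      exact ⟨H.eq_of_eq_zero hc h3, Or.inl rfl⟩

theorem nonpos_of_revSide (H : Hull P A B C)
    (hs : RevSide A B C a b) (hp : p ∈ P) : orient a b p ≤ 0 := by
  have := H.nonneg hp
  rcases hs with ⟨rfl, rfl⟩ | ⟨rfl, rfl⟩ | ⟨rfl, rfl⟩ <;> rw [orient_swap] <;> linarith

theorem revSide (H : Hull P A B C)
    (hab : a ≠ b) (ha : a ∈ P) (hb : b ∈ P) (hle : ∀ p ∈ P, orient a b p ≤ 0) :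
    RevSide A B C a b := by
  have key : ∀ q ∈ P, orient a b q = 0 → q = A ∨ q = B ∨ q = C := by
    intro q hq h0
    by_contra! hne
    obtain ⟨k1, k2, k3⟩ : 0 < orient A B q ∧ 0 < orient B C q ∧ 0 < orient C A q := by
      rcases H.inside q hq with k | k | k | k <;> tauto
    have e := orient_bary A B C q a b
    rw [h0, mul_zero] at e
    have l1 := mul_nonneg k2.le (neg_nonneg.2 (hle A H.mem.1))
    have l2 := mul_nonneg k3.le (neg_nonneg.2 (hle B H.mem.2.1))
    have l3 := mul_nonneg k1.le (neg_nonneg.2 (hle C H.mem.2.2))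
    have z1 : orient a b A = 0 :=
      (mul_eq_zero.1 (show orient B C q * orient a b A = 0 by linarith)).resolve_left k2.ne'
    have z2 : orient a b B = 0 :=
      (mul_eq_zero.1 (show orient C A q * orient a b B = 0 by linarith)).resolve_left k3.ne'
    have z3 : orient a b C = 0 :=
      (mul_eq_zero.1 (show orient A B q * orient a b C = 0 by linarith)).resolve_left k1.ne'
    obtain ⟨z, hz⟩ := (frequently_orient_pos hab (left_mem_segment ℝ a b)).exists
    have e := orient_bary A B C z a b
    rw [z1, z2, z3] at e
    have := mul_pos H.pos hz
    linarith
  have ka := key a ha (orient_self_left a b)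
  have kb := key b hb (orient_self_right a b)
  have n1 := H.pos
  have n2 := H.rotate.pos
  have n3 := H.rotate.rotate.pos
  have lA := hle A H.mem.1
  have lB := hle B H.mem.2.1
  have lC := hle C H.mem.2.2
  unfold RevSide
  rcases ka with rfl | rfl | rfl <;> rcases kb with rfl | rfl | rfl <;> first | tauto | linarith

theorem mem_faces (H : Hull P A B C)
    {T : Finset (ℝ × ℝ)} (h : MaximalDrawing P E) : T ∈ faces P E A B C ↔
    T = {A, B, C} ∨ ∃ a b c, Face P E a b c ∧ T = {a, b, c} := by
  rw [faces, Finset.mem_filter, Finset.mem_powerset, and_iff_right_iff_imp]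
  rintro (rfl | ⟨a, b, c, hf, rfl⟩)
  · simp [Finset.insert_subset_iff, H.mem]
  · simp [Finset.insert_subset_iff, h.mem _ _ hf.adj₁, h.mem _ _ hf.adj₂, h.mem _ _ hf.adj₃]

theorem exists_leftFace (H : Hull P A B C) (h : MaximalDrawing P E) (hab : E a b) (hne : a ≠ b) :
    ∃ T, LeftFace P E A B C a b T := by
  by_cases hp : ∃ p ∈ P, 0 < orient a b p
  · obtain ⟨p, hp, hpos⟩ := hp
    obtain ⟨c, hc⟩ := h.exists_face hab hne hp hpos
    exact ⟨_, Or.inl ⟨c, hc, rfl⟩⟩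
  · push Not at hp
    exact ⟨_, Or.inr ⟨H.revSide hne (h.mem _ _ hab) (h.mem_right hab) hp, rfl⟩⟩

theorem face_not_revSide (H : Hull P A B C)
    (h : MaximalDrawing P E) (hf : Face P E a b c) : ¬RevSide A B C a b :=
  fun hs => (H.nonpos_of_revSide hs (h.mem _ _ hf.adj₃)).not_gt hf.pos

theorem leftFace_unique (H : Hull P A B C) (h : MaximalDrawing P E) {T T' : Finset (ℝ × ℝ)}
    (hT : LeftFace P E A B C a b T) (hT' : LeftFace P E A B C a b T') : T = T' := by
  rcases hT with ⟨c, hf, rfl⟩ | ⟨hs, rfl⟩ <;> rcases hT' with ⟨c', hf', rfl⟩ | ⟨hs', rfl⟩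
  · rw [h.face_unique hf hf']
  · exact absurd hs' (H.face_not_revSide h hf)
  · exact absurd hs (H.face_not_revSide h hf')
  · rfl

theorem leftFace_of_mem (H : Hull P A B C)
    {T : Finset (ℝ × ℝ)} (h : MaximalDrawing P E) (hT : T ∈ faces P E A B C)
    (ha : a ∈ T) (hb : b ∈ T) (hab : a ≠ b) :
    LeftFace P E A B C a b T ∨ LeftFace P E A B C b a T := by
  rcases (H.mem_faces h).1 hT with rfl | ⟨x, y, z, hf, rfl⟩
  · simp only [Finset.mem_insert, Finset.mem_singleton] at ha hb
    unfold LeftFace RevSide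
    rcases ha with rfl | rfl | rfl <;> rcases hb with rfl | rfl | rfl <;> tauto
  · have key : ∀ x y z, Face P E x y z → LeftFace P E A B C x y {x, y, z} :=
      fun x y z hf => Or.inl ⟨z, hf, rfl⟩
    have k1 := key _ _ _ hf
    have k2 := key _ _ _ hf.rotate
    have k3 := key _ _ _ hf.rotate.rotate
    have e2 : ({y, z, x} : Finset (ℝ × ℝ)) = {x, y, z} := by ext; simp; tauto
    have e3 : ({z, x, y} : Finset (ℝ × ℝ)) = {x, y, z} := by ext; simp; tauto
    rw [e2] at k2
    rw [e3] at k3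
    simp only [Finset.mem_insert, Finset.mem_singleton] at ha hb
    rcases ha with rfl | rfl | rfl <;> rcases hb with rfl | rfl | rfl <;> tauto

theorem not_face (H : Hull P A B C) : ¬Face P E A B C := by
  intro hf
  obtain ⟨p, hp, hin⟩ := H.exists_inside
  exact hf.not_mem_interior hp hin

theorem leftFace_ne (H : Hull P A B C) {T T' : Finset (ℝ × ℝ)} (hT : LeftFace P E A B C a b T)
    (hT' : LeftFace P E A B C b a T') : T ≠ T' := by
  have key : ∀ a b c, Face P E a b c → RevSide A B C b a → ({a, b, c} : Finset _) ≠ {A, B, C} := by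
    intro a b c hf hs he
    have hc : c ∈ ({A, B, C} : Finset (ℝ × ℝ)) := he ▸ by simp
    have n1 := hf.rotate.ne
    have n2 := hf.rotate.rotate.ne
    simp only [Finset.mem_insert, Finset.mem_singleton] at hc
    have f1 := hf.rotate
    have f2 := hf.rotate.rotate
    have := H.not_face (E := E)
    rcases hs with ⟨rfl, rfl⟩ | ⟨rfl, rfl⟩ | ⟨rfl, rfl⟩ <;> rcases hc with rfl | rfl | rfl <;>
      tauto
  rcases hT with ⟨c, hf, rfl⟩ | ⟨hs, rfl⟩ <;> rcases hT' with ⟨c', hf', rfl⟩ | ⟨hs', rfl⟩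
  · intro he
    have hc : c ∈ ({b, a, c'} : Finset (ℝ × ℝ)) := he ▸ by simp
    simp only [Finset.mem_insert, Finset.mem_singleton] at hc
    have h1 := hf.pos
    have h2 := hf'.pos
    rcases hc with rfl | rfl | rfl
    · exact hf.rotate.ne rfl
    · exact hf.rotate.rotate.ne rfl
    · rw [orient_swap] at h2
      linarith
  · exact key _ _ _ hf hs'
  · exact (key _ _ _ hf' hs).symm
  · have n1 := H.ne
    have n2 := H.rotate.ne
    have n3 := H.rotate.rotate.ne
    exfalso
    unfold RevSide at hs hs'
    grind

theorem adj_of_leftFace (H : Hull P A B C) (h : MaximalDrawing P E) {T : Finset (ℝ × ℝ)}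
    (hT : LeftFace P E A B C a b T) : E a b := by
  rcases hT with ⟨c, hf, rfl⟩ | ⟨hs, rfl⟩
  · exact hf.adj₁
  · rcases hs with ⟨rfl, rfl⟩ | ⟨rfl, rfl⟩ | ⟨rfl, rfl⟩
    · exact h.symm _ _ (H.adj h)
    · exact h.symm _ _ (H.rotate.adj h)
    · exact h.symm _ _ (H.rotate.rotate.adj h)

theorem leftFace_mem (H : Hull P A B C) (h : MaximalDrawing P E) {T : Finset (ℝ × ℝ)}
    (hT : LeftFace P E A B C a b T) : T ∈ faces P E A B C ∧ a ∈ T ∧ b ∈ T ∧ a ≠ b := by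
  rw [H.mem_faces h]
  rcases hT with ⟨c, hf, rfl⟩ | ⟨hs, rfl⟩
  · exact ⟨Or.inr ⟨_, _, _, hf, rfl⟩, by simp, by simp, hf.ne⟩
  · refine ⟨Or.inl rfl, ?_⟩
    have n1 := H.ne
    have n2 := H.rotate.ne
    have n3 := H.rotate.rotate.ne
    rcases hs with ⟨rfl, rfl⟩ | ⟨rfl, rfl⟩ | ⟨rfl, rfl⟩ <;> simp [*, Ne.symm]

theorem adj_of_mem_faces (H : Hull P A B C) (h : MaximalDrawing P E) {T : Finset (ℝ × ℝ)}
    (hT : T ∈ faces P E A B C) (ha : a ∈ T) (hb : b ∈ T) (hab : a ≠ b) : E a b := by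
  rcases H.leftFace_of_mem h hT ha hb hab with hl | hl
  · exact H.adj_of_leftFace h hl
  · exact h.symm _ _ (H.adj_of_leftFace h hl)

theorem card_face (H : Hull P A B C)
    (h : MaximalDrawing P E) {T : Finset (ℝ × ℝ)} (hT : T ∈ faces P E A B C) :
    T.card = 3 := by
  rw [Finset.card_eq_three]
  rcases (H.mem_faces h).1 hT with rfl | ⟨x, y, z, hf, rfl⟩
  · exact ⟨A, B, C, H.ne, H.rotate.rotate.ne.symm, H.rotate.ne, rfl⟩
  · exact ⟨x, y, z, hf.ne, hf.rotate.rotate.ne.symm, hf.rotate.ne, rfl⟩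

theorem exists_opposite (H : Hull P A B C)
    (h : MaximalDrawing P E) {T : Finset (ℝ × ℝ)} (hT : T ∈ faces P E A B C)
    (ha : a ∈ T) (hb : b ∈ T) (hab : a ≠ b) :
    ∃ T' ∈ faces P E A B C, T' ≠ T ∧ a ∈ T' ∧ b ∈ T' ∧
      ∀ T'' ∈ faces P E A B C, a ∈ T'' → b ∈ T'' → T'' = T ∨ T'' = T' := by
  have key : ∀ a b, a ∈ T → b ∈ T → a ≠ b → LeftFace P E A B C a b T →
      ∃ T' ∈ faces P E A B C, T' ≠ T ∧ a ∈ T' ∧ b ∈ T' ∧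
        ∀ T'' ∈ faces P E A B C, a ∈ T'' → b ∈ T'' → T'' = T ∨ T'' = T' := by
    intro a b ha hb hab hl
    have hadj := H.adj_of_mem_faces h hT ha hb hab
    obtain ⟨T', hT'⟩ := H.exists_leftFace h (h.symm _ _ hadj) hab.symm
    obtain ⟨m1, m2, m3, -⟩ := H.leftFace_mem h hT'
    refine ⟨T', m1, (H.leftFace_ne hl hT').symm, m3, m2, fun T'' hT'' ha'' hb'' => ?_⟩
    rcases H.leftFace_of_mem h hT'' ha'' hb'' hab with hl' | hl'
    · exact Or.inl (H.leftFace_unique h hl' hl)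
    · exact Or.inr (H.leftFace_unique h hl' hT')
  rcases H.leftFace_of_mem h hT ha hb hab with hl | hl
  · exact key a b ha hb hab hl
  · obtain ⟨T', m1, m2, m3, m4, m5⟩ := key b a hb ha hab.symm hl
    exact ⟨T', m1, m2, m4, m3, fun T'' k1 k2 k3 => m5 T'' k1 k3 k2⟩

end Hull

theorem exists_mem_orient_ne_zero {V : Set (ℝ × ℝ)} (hV : IsOpen V) {w q v : ℝ × ℝ} (hw : w ∈ V)
    (hqv : q ≠ v) : ∃ z ∈ V, orient q v z ≠ 0 := by
  by_cases h0 : orient q v w = 0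
  swap
  · exact ⟨w, hw, h0⟩
  have hc : Continuous (fun e : ℝ => (w.1 - e * (v.2 - q.2), w.2 + e * (v.1 - q.1))) := by
    fun_prop
  have ht := (hc.tendsto 0).eventually (hV.mem_nhds (by simpa using hw))
  obtain ⟨e, he, he0⟩ := ((ht.filter_mono nhdsWithin_le_nhds).and
    (self_mem_nhdsWithin (s := Set.Ioi (0 : ℝ)))).exists
  have he0 : 0 < e := he0
  refine ⟨_, he, ?_⟩
  have : orient q v (w.1 - e * (v.2 - q.2), w.2 + e * (v.1 - q.1)) =
      orient q v w + e * ((v.1 - q.1) ^ 2 + (v.2 - q.2) ^ 2) := by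
    unfold orient; ring
  rw [this, h0, zero_add]
  refine mul_ne_zero he0.ne' fun hz => hqv ?_
  have h1 : v.1 - q.1 = 0 := by nlinarith [sq_nonneg (v.1 - q.1), sq_nonneg (v.2 - q.2)]
  have h2 : v.2 - q.2 = 0 := by nlinarith [sq_nonneg (v.1 - q.1), sq_nonneg (v.2 - q.2)]
  exact Prod.ext (by linarith) (by linarith)

theorem exists_mem_segment_disjoint (P : Finset (ℝ × ℝ)) {q : ℝ × ℝ} (hq : q ∉ P)
    {V : Set (ℝ × ℝ)} (hV : IsOpen V) (hne : V.Nonempty) :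
    ∃ z ∈ V, ∀ v ∈ P, v ∉ segment ℝ q z := by
  suffices ∃ z ∈ V, ∀ v ∈ P, orient q v z ≠ 0 by
    obtain ⟨z, hz, h⟩ := this
    refine ⟨z, hz, fun v hv hmem => h v hv ?_⟩
    have : orient q v z = -orient q z v := by unfold orient; ring
    rw [this, orient_eq_zero_of_mem hmem, neg_zero]
  induction P using Finset.induction_on with
  | empty => exact ⟨_, hne.some_mem, by simp⟩
  | insert v P _ ih =>
    rw [Finset.mem_insert, not_or] at hq
    obtain ⟨z, hz, h⟩ := ih hq.2
    have hO : IsOpen (V ∩ ⋂ v ∈ P, {z | orient q v z ≠ 0}) :=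
      hV.inter (isOpen_biInter_finset fun v _ =>
        isOpen_ne_fun (continuous_orient q v) continuous_const)
    obtain ⟨z', hz', h'⟩ := exists_mem_orient_ne_zero hO
      ⟨hz, Set.mem_iInter₂.2 fun v hv => h v hv⟩ hq.1
    refine ⟨z', hz'.1, fun x hx => ?_⟩
    rcases Finset.mem_insert.1 hx with rfl | hx
    · exact h'
    · exact Set.mem_iInter₂.1 hz'.2 x hx

theorem isClosed_triangle (a b c : ℝ × ℝ) :
    IsClosed {z | 0 ≤ orient a b z ∧ 0 ≤ orient b c z ∧ 0 ≤ orient c a z} :=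
  (isClosed_le continuous_const (continuous_orient a b)).inter
    ((isClosed_le continuous_const (continuous_orient b c)).inter
      (isClosed_le continuous_const (continuous_orient c a)))

theorem isOpen_triangle (a b c : ℝ × ℝ) :
    IsOpen {z | 0 < orient a b z ∧ 0 < orient b c z ∧ 0 < orient c a z} :=
  (isOpen_lt continuous_const (continuous_orient a b)).inter
    ((isOpen_lt continuous_const (continuous_orient b c)).inter
      (isOpen_lt continuous_const (continuous_orient c a)))

theorem convex_triangle (a b c : ℝ × ℝ) :
    Convex ℝ {z | 0 < orient a b z ∧ 0 < orient b c z ∧ 0 < orient c a z} := by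
  rw [convex_iff_segment_subset]
  rintro x ⟨x1, x2, x3⟩ y ⟨y1, y2, y3⟩ z hz
  obtain ⟨t, t0, t1, h1, h2⟩ := mem_segment_prod.1 hz
  have key : ∀ p q, 0 < orient p q x → 0 < orient p q y → 0 < orient p q z := by
    intro p q hx hy
    rw [orient_segment p q x y h1 h2]
    rcases eq_or_lt_of_le t0 with rfl | t0
    · linarith
    · have := mul_pos t0 hy
      have := mul_nonneg (sub_nonneg.2 t1) hx.le
      linarith
  exact ⟨key _ _ x1 y1, key _ _ x2 y2, key _ _ x3 y3⟩

/-- The union of the closed faces in `S`. -/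
def region (P : Finset (ℝ × ℝ)) (E : ℝ × ℝ → ℝ × ℝ → Prop) (S : Finset (Finset (ℝ × ℝ))) :
    Set (ℝ × ℝ) :=
  {z | ∃ a b c, Face P E a b c ∧ {a, b, c} ∈ S ∧
    0 ≤ orient a b z ∧ 0 ≤ orient b c z ∧ 0 ≤ orient c a z}

namespace MaximalDrawing
variable {P : Finset (ℝ × ℝ)} {E : ℝ × ℝ → ℝ × ℝ → Prop}
  {S : Finset (Finset (ℝ × ℝ))} {a b c a' b' c' x p q : ℝ × ℝ} {U : Set (ℝ × ℝ)}

theorem isClosed_region (h : MaximalDrawing P E) : IsClosed (region P E S) := by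
  have : region P E S = ⋃ t ∈ (P ×ˢ P ×ˢ P).filter fun t =>
      Face P E t.1 t.2.1 t.2.2 ∧ {t.1, t.2.1, t.2.2} ∈ S,
      {z | 0 ≤ orient t.1 t.2.1 z ∧ 0 ≤ orient t.2.1 t.2.2 z ∧ 0 ≤ orient t.2.2 t.1 z} := by
    ext z
    simp only [region, Set.mem_ofPred_eq, Set.mem_iUnion, Finset.mem_filter, Finset.mem_product]
    constructor
    · rintro ⟨a, b, c, hf, hS, hz⟩
      exact ⟨(a, b, c), ⟨⟨h.mem _ _ hf.adj₁, h.mem _ _ hf.adj₂, h.mem _ _ hf.adj₃⟩, hf, hS⟩, hz⟩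
    · rintro ⟨⟨a, b, c⟩, ⟨-, hf, hS⟩, hz⟩
      exact ⟨a, b, c, hf, hS, hz⟩
  rw [this]
  exact isClosed_biUnion_finset fun t _ => isClosed_triangle _ _ _

theorem region_mem_nhds (h : MaximalDrawing P E)
    (hS : ∀ a b c, Face P E a b c → {a, b, c} ∈ S → ∀ x ∈ U, x ∈ segment ℝ a b → x ≠ a → x ≠ b →
      ∃ d, Face P E b a d ∧ {b, a, d} ∈ S)
    (hx : x ∈ region P E S) (hxU : x ∈ U) (hxP : x ∉ P) : region P E S ∈ nhds x := by
  have key : ∀ a b c, Face P E a b c → {a, b, c} ∈ S → 0 ≤ orient b c x → 0 ≤ orient c a x →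
      orient a b x = 0 → region P E S ∈ nhds x := by
    intro a b c hf hS' h2 h3 h1
    have hx : x ∈ segment ℝ a b := mem_segment_of_orient hf.pos.ne' h1
      (mul_nonneg hf.pos.le h2) (mul_nonneg hf.pos.le h3)
    have hxa : x ≠ a := by rintro rfl; exact hxP (h.mem _ _ hf.adj₁)
    have hxb : x ≠ b := by rintro rfl; exact hxP (h.mem _ _ hf.adj₂)
    obtain ⟨d, hf', hS''⟩ := hS a b c hf hS' x hxU hx hxa hxb
    filter_upwards [hf.eventually hx hxa hxb,
      hf'.eventually (segment_symm ℝ a b ▸ hx) hxb hxa] with z hz hz'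
    rcases le_total 0 (orient a b z) with h0 | h0
    · exact ⟨a, b, c, hf, hS', h0, hz.1.le, hz.2.le⟩
    · exact ⟨b, a, d, hf', hS'', by rw [orient_swap]; linarith, hz'.1.le, hz'.2.le⟩
  obtain ⟨a, b, c, hf, hS', h1, h2, h3⟩ := hx
  have e2 : ({b, c, a} : Finset (ℝ × ℝ)) = {a, b, c} := by ext; simp; tauto
  have e3 : ({c, a, b} : Finset (ℝ × ℝ)) = {a, b, c} := by ext; simp; tauto
  rcases eq_or_lt_of_le h1 with g1 | g1
  · exact key _ _ _ hf hS' h2 h3 g1.symm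
  rcases eq_or_lt_of_le h2 with g2 | g2
  · exact key _ _ _ hf.rotate (e2 ▸ hS') h3 h1 g2.symm
  rcases eq_or_lt_of_le h3 with g3 | g3
  · exact key _ _ _ hf.rotate.rotate (e3 ▸ hS') h1 h2 g3.symm
  filter_upwards [(isOpen_triangle a b c).mem_nhds ⟨g1, g2, g3⟩] with z hz
  exact ⟨a, b, c, hf, hS', hz.1.le, hz.2.1.le, hz.2.2.le⟩

/-- A set of faces which is closed under crossing edges inside a convex open set `U` contains all
faces meeting `U` or none. -/
theorem mem_of_adjacent_closed (h : MaximalDrawing P E) (hU : IsOpen U) (hconv : Convex ℝ U)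
    (hS : ∀ a b c, Face P E a b c → {a, b, c} ∈ S → ∀ x ∈ U, x ∈ segment ℝ a b → x ≠ a → x ≠ b →
      ∃ d, Face P E b a d ∧ {b, a, d} ∈ S)
    (hf : Face P E a b c) (hfS : {a, b, c} ∈ S) (hp : p ∈ U)
    (hpf : 0 < orient a b p ∧ 0 < orient b c p ∧ 0 < orient c a p)
    (hf' : Face P E a' b' c') (hq : q ∈ U)
    (hqf : 0 < orient a' b' q ∧ 0 < orient b' c' q ∧ 0 < orient c' a' q) :
    {a', b', c'} ∈ S := by
  have hqP : q ∉ P := fun hqP => hf'.not_mem_interior hqP hqf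
  obtain ⟨r, ⟨hrU, hrf⟩, hr⟩ := exists_mem_segment_disjoint P hqP
    (hU.inter (isOpen_triangle a b c)) ⟨p, hp, hpf⟩
  have hsub : segment ℝ q r ⊆ interior (region P E S) := by
    refine (convex_segment (𝕜 := ℝ) q r).isPreconnected.subset_of_closure_inter_subset
      isOpen_interior ⟨r, right_mem_segment ℝ q r, ?_⟩ ?_
    · rw [mem_interior_iff_mem_nhds]
      exact h.region_mem_nhds hS ⟨a, b, c, hf, hfS, hrf.1.le, hrf.2.1.le, hrf.2.2.le⟩ hrU
        fun hrP => hf.not_mem_interior hrP hrf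
    · rintro x ⟨hx, hxs⟩
      rw [mem_interior_iff_mem_nhds]
      exact h.region_mem_nhds hS (closure_minimal interior_subset h.isClosed_region hx)
        (hconv.segment_subset hq hrU hxs) fun hxP => hr x hxP hxs
  obtain ⟨x, y, z, hg, hgS, h1, h2, h3⟩ := interior_subset (hsub (left_mem_segment ℝ q r))
  have key : ∀ x y z, Face P E x y z → 0 ≤ orient x y q → 0 ≤ orient y z q → 0 ≤ orient z x q →
      0 < orient x y q := by
    intro x y z hg h1 h2 h3
    refine lt_of_le_of_ne h1 fun h0 => h.edge_not_mem_interior hf' hg.adj₁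
      (mem_segment_of_orient hg.pos.ne' h0.symm (mul_nonneg hg.pos.le h2)
      (mul_nonneg hg.pos.le h3)) hqf
  rw [h.face_eq hf' hg hqf ⟨key _ _ _ hg h1 h2 h3, key _ _ _ hg.rotate h2 h3 h1,
    key _ _ _ hg.rotate.rotate h3 h1 h2⟩]
  exact hgS

end MaximalDrawing

namespace Face
variable {P : Finset (ℝ × ℝ)} {E : ℝ × ℝ → ℝ × ℝ → Prop} {a b c w : ℝ × ℝ}

theorem exists_interior (hf : Face P E a b c) :
    ∃ z, 0 < orient a b z ∧ 0 < orient b c z ∧ 0 < orient c a z := by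
  have h1 := hf.pos
  refine ⟨((a.1 + b.1 + c.1) / 3, (a.2 + b.2 + c.2) / 3), ?_⟩
  unfold orient at *
  refine ⟨?_, ?_, ?_⟩ <;> linarith

theorem frequently_interior (hf : Face P E a b c) (hw : w ∈ ({a, b, c} : Finset (ℝ × ℝ))) :
    ∃ᶠ z in nhds w, 0 < orient a b z ∧ 0 < orient b c z ∧ 0 < orient c a z := by
  obtain ⟨g, g1, g2, g3⟩ := hf.exists_interior
  have hc : Continuous (fun e : ℝ => (w.1 + e * (g.1 - w.1), w.2 + e * (g.2 - w.2))) := by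
    fun_prop
  have ht := hc.tendsto 0
  simp only [zero_mul, add_zero] at ht
  refine (ht.mono_left (nhdsWithin_le_nhds (s := Set.Ioi 0))).frequently
    (Filter.Eventually.frequently ?_)
  filter_upwards [Ioo_mem_nhdsGT (show (0 : ℝ) < 1 by norm_num)] with e he
  have hw' : 0 ≤ orient a b w ∧ 0 ≤ orient b c w ∧ 0 ≤ orient c a w := by
    have k1 := hf.pos.le
    have k2 := hf.rotate.pos.le
    have k3 := hf.rotate.rotate.pos.le
    simp only [Finset.mem_insert, Finset.mem_singleton] at hw
    rcases hw with rfl | rfl | rfl <;>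
      simp only [orient_self_left, orient_self_right, le_refl, true_and, and_true] <;> assumption
  have key : ∀ p q, 0 ≤ orient p q w → 0 < orient p q g →
      0 < orient p q (w.1 + e * (g.1 - w.1), w.2 + e * (g.2 - w.2)) := by
    intro p q h1 h2
    rw [orient_segment p q w g rfl rfl]
    exact add_pos_of_nonneg_of_pos (mul_nonneg (by linarith [he.2]) h1) (mul_pos he.1 h2)
  exact ⟨key _ _ hw'.1 g1, key _ _ hw'.2.1 g2, key _ _ hw'.2.2 g3⟩

end Face

namespace Hull
variable {P : Finset (ℝ × ℝ)} {E : ℝ × ℝ → ℝ × ℝ → Prop} {A B C : ℝ × ℝ}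
  {a b c p w x : ℝ × ℝ} {S : Finset (Finset (ℝ × ℝ))} {T T' : Finset (ℝ × ℝ)}

theorem opposite_mem (H : Hull P A B C) (h : MaximalDrawing P E) (hS : S ⊆ faces P E A B C)
    (hbd : bd S a b = 0) (hl : LeftFace P E A B C a b T) (hT : T ∈ S)
    (hl' : LeftFace P E A B C b a T') : T' ∈ S := by
  by_contra hT'
  obtain ⟨-, ma, mb, hab⟩ := H.leftFace_mem h hl
  have : bd S a b = 1 := by
    rw [bd, Finset.sum_eq_single T, if_pos ⟨ma, mb⟩]
    · refine fun R hR hne => if_neg fun hm => ?_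
      rcases H.leftFace_of_mem h (hS hR) hm.1 hm.2 hab with hr | hr
      · exact hne (H.leftFace_unique h hr hl)
      · exact hT' (H.leftFace_unique h hr hl' ▸ hR)
    · exact fun hn => absurd hT hn
  rw [hbd] at this
  exact zero_ne_one this

theorem exists_adjacent (H : Hull P A B C) (h : MaximalDrawing P E) (hS : S ⊆ faces P E A B C)
    (hx : 0 < orient A B x ∧ 0 < orient B C x ∧ 0 < orient C A x) (hxs : x ∈ segment ℝ a b)
    (hf : Face P E a b c) (hfS : {a, b, c} ∈ S) (hbd : bd S a b = 0) :
    ∃ d, Face P E b a d ∧ {b, a, d} ∈ S := by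
  obtain ⟨T', hT'⟩ := H.exists_leftFace h (h.symm _ _ hf.adj₁) hf.ne.symm
  have hm := H.opposite_mem h hS hbd (Or.inl ⟨c, hf, rfl⟩) hfS hT'
  rcases hT' with ⟨d, hd, rfl⟩ | ⟨hs, -⟩
  · exact ⟨d, hd, hm⟩
  · have h0 := orient_eq_zero_of_mem hxs
    rcases hs with ⟨rfl, rfl⟩ | ⟨rfl, rfl⟩ | ⟨rfl, rfl⟩ <;> linarith

theorem face_interior (H : Hull P A B C) (h : MaximalDrawing P E) (hf : Face P E a b c)
    (hx : 0 < orient a b x ∧ 0 < orient b c x ∧ 0 < orient c a x) :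
    0 < orient A B x ∧ 0 < orient B C x ∧ 0 < orient C A x := by
  have ha := h.mem _ _ hf.adj₁
  have hb := h.mem _ _ hf.adj₂
  have hc := h.mem _ _ hf.adj₃
  have key : ∀ A B C, Hull P A B C → 0 < orient A B x := by
    intro A B C H
    have e := orient_bary a b c x A B
    have na := (H.nonneg ha).1
    have nb := (H.nonneg hb).1
    have nc := (H.nonneg hc).1
    by_contra! hle
    have hle' := mul_nonneg hf.pos.le (neg_nonneg.2 hle)
    have l1 := mul_nonneg hx.2.1.le na
    have l2 := mul_nonneg hx.2.2.le nb
    have l3 := mul_nonneg hx.1.le nc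
    have z1 := (mul_eq_zero.1 (show orient b c x * orient A B a = 0 by linarith)).resolve_left
      hx.2.1.ne'
    have z2 := (mul_eq_zero.1 (show orient c a x * orient A B b = 0 by linarith)).resolve_left
      hx.2.2.ne'
    have z3 := (mul_eq_zero.1 (show orient a b x * orient A B c = 0 by linarith)).resolve_left
      hx.1.ne'
    have n1 := hf.ne
    have n2 := hf.rotate.ne
    have n3 := hf.rotate.rotate.ne
    have k1 := H.eq_of_eq_zero ha z1
    have k2 := H.eq_of_eq_zero hb z2
    have k3 := H.eq_of_eq_zero hc z3
    grind
  exact ⟨key _ _ _ H, key _ _ _ H.rotate, key _ _ _ H.rotate.rotate⟩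

theorem exists_face_of_mem (H : Hull P A B C)
    (h : MaximalDrawing P E) (hw : w ∈ ({A, B, C} : Finset (ℝ × ℝ))) :
    ∃ y c, Face P E w y c ∧ RevSide A B C y w := by
  simp only [Finset.mem_insert, Finset.mem_singleton] at hw
  unfold RevSide
  rcases hw with rfl | rfl | rfl
  · obtain ⟨c, hc⟩ := h.exists_face (H.adj h) H.ne H.mem.2.2 H.pos
    exact ⟨_, _, hc, by tauto⟩
  · obtain ⟨c, hc⟩ := h.exists_face (H.rotate.adj h) H.rotate.ne H.mem.1 H.rotate.pos
    exact ⟨_, _, hc, by tauto⟩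
  · obtain ⟨c, hc⟩ := h.exists_face (H.rotate.rotate.adj h) H.rotate.rotate.ne H.mem.2.1
      H.rotate.rotate.pos
    exact ⟨_, _, hc, by tauto⟩

theorem face_mem_of_mem (H : Hull P A B C) (h : MaximalDrawing P E) (hS : S ⊆ faces P E A B C)
    (hbd : ∀ a, a ≠ w → bd S w a = 0) (hT : T ∈ S) (hw : w ∈ T) :
    ∃ a b c, Face P E a b c ∧ {a, b, c} ∈ S ∧ w ∈ ({a, b, c} : Finset (ℝ × ℝ)) := by
  rcases (H.mem_faces h).1 (hS hT) with rfl | ⟨a, b, c, hf, rfl⟩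
  · obtain ⟨y, c, hf, hs⟩ := H.exists_face_of_mem h hw
    refine ⟨w, y, c, hf, ?_, by simp⟩
    exact H.opposite_mem h hS (bd_comm S w y ▸ hbd y hf.ne.symm) (Or.inr ⟨hs, rfl⟩) hT
      (Or.inl ⟨c, hf, rfl⟩)
  · exact ⟨a, b, c, hf, hT, hw⟩

theorem mem_of_face_mem (H : Hull P A B C) (h : MaximalDrawing P E) (hS : S ⊆ faces P E A B C)
    (hbd : ∀ a, a ≠ w → bd S w a = 0)
    (hfS : ∀ a b c, Face P E a b c → w ∈ ({a, b, c} : Finset (ℝ × ℝ)) → {a, b, c} ∈ S)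
    (hT' : T' ∈ faces P E A B C) (hw' : w ∈ T') : T' ∈ S := by
  rcases (H.mem_faces h).1 hT' with rfl | ⟨a, b, c, hf, rfl⟩
  · obtain ⟨y, c, hf, hs⟩ := H.exists_face_of_mem h hw'
    exact H.opposite_mem h hS (hbd y hf.ne.symm) (Or.inl ⟨c, hf, rfl⟩) (hfS _ _ _ hf (by simp))
      (Or.inr ⟨hs, rfl⟩)
  · exact hfS _ _ _ hf hw'

theorem connected_at (H : Hull P A B C) (h : MaximalDrawing P E) (hS : S ⊆ faces P E A B C)
    (hbd : ∀ a, a ≠ w → bd S w a = 0) (hT : T ∈ S) (hw : w ∈ T)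
    (hT' : T' ∈ faces P E A B C) (hw' : w ∈ T') : T' ∈ S := by
  obtain ⟨a, b, c, hf, hfS, hwf⟩ := H.face_mem_of_mem h hS hbd hT hw
  refine H.mem_of_face_mem h hS hbd (fun a' b' c' hf' hwf' => ?_) hT' hw'
  have hwP : w ∈ P := by
    have h1 := h.mem _ _ hf.adj₁
    have h2 := h.mem _ _ hf.adj₂
    have h3 := h.mem _ _ hf.adj₃
    simp only [Finset.mem_insert, Finset.mem_singleton] at hwf
    rcases hwf with rfl | rfl | rfl <;> assumption
  have hO : IsOpen (⋂ e ∈ (P ×ˢ P).filter fun e => E e.1 e.2 ∧ w ≠ e.1 ∧ w ≠ e.2,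
      (segment ℝ e.1 e.2)ᶜ) :=
    isOpen_biInter_finset fun e _ => (isCompact_segment_prod e.1 e.2).isClosed.isOpen_compl
  obtain ⟨ε, hε, hball⟩ := Metric.isOpen_iff.1 hO w (Set.mem_iInter₂.2 fun e he hwe => by
    rw [Finset.mem_filter] at he
    rcases h.eq_of_mem_segment he.2.1 hwP hwe with h1 | h1
    · exact he.2.2.1 h1
    · exact he.2.2.2 h1)
  have hmem := Metric.ball_mem_nhds w hε
  obtain ⟨p, hp, hpU⟩ := ((hf.frequently_interior hwf).and_eventually hmem).exists
  obtain ⟨q, hq, hqU⟩ := ((hf'.frequently_interior hwf').and_eventually hmem).exists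
  refine h.mem_of_adjacent_closed (Metric.isOpen_ball.inter (isOpen_triangle A B C))
    ((convex_ball w ε).inter (convex_triangle A B C)) ?_ hf hfS ⟨hpU, H.face_interior h hf hp⟩ hp
    hf' ⟨hqU, H.face_interior h hf' hq⟩ hq
  intro a b c hf hfS x hx hxs _ _
  refine H.exists_adjacent h hS hx.2 hxs hf hfS ?_
  have hab : w = a ∨ w = b := by
    by_contra! hne
    refine Set.mem_iInter₂.1 (hball hx.1) (a, b) ?_ hxs
    rw [Finset.mem_filter, Finset.mem_product]
    exact ⟨⟨h.mem _ _ hf.adj₁, h.mem _ _ hf.adj₂⟩, hf.adj₁, hne⟩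
  rcases hab with rfl | rfl
  · exact hbd _ hf.ne.symm
  · rw [bd_comm]
    exact hbd _ hf.ne

theorem connected (H : Hull P A B C) (h : MaximalDrawing P E) (hS : S ⊆ faces P E A B C)
    (hbd : ∀ a b, a ≠ b → bd S a b = 0) : S = ∅ ∨ S = faces P E A B C := by
  rcases S.eq_empty_or_nonempty with h0 | ⟨T, hT⟩
  · exact Or.inl h0
  refine Or.inr (Finset.Subset.antisymm hS fun T' hT' => ?_)
  obtain ⟨w, hw⟩ : T.Nonempty := Finset.card_pos.1 (by rw [H.card_face h (hS hT)]; norm_num)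
  obtain ⟨w', hw'⟩ : T'.Nonempty := Finset.card_pos.1 (by rw [H.card_face h hT']; norm_num)
  obtain ⟨a, b, c, hf, hfS, -⟩ := H.face_mem_of_mem h hS (fun a ha => hbd _ _ ha.symm) hT hw
  refine H.mem_of_face_mem h hS (fun a ha => hbd _ _ ha.symm) (fun a' b' c' hf' _ => ?_) hT' hw'
  obtain ⟨p, hp⟩ := hf.exists_interior
  obtain ⟨q, hq⟩ := hf'.exists_interior
  exact h.mem_of_adjacent_closed (isOpen_triangle A B C) (convex_triangle A B C)
    (fun a b c hf hfS x hx hxs _ _ => H.exists_adjacent h hS hx hxs hf hfS (hbd _ _ hf.ne))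
    hf hfS (H.face_interior h hf hp) hp hf' (H.face_interior h hf' hq) hq

end Hull

theorem mem_segment_of_fst {x y z : ℝ × ℝ} (hxy : x.1 < y.1) (h0 : orient x y z = 0)
    (h1 : x.1 ≤ z.1) (h2 : z.1 ≤ y.1) : z ∈ segment ℝ x y := by
  have hpos := sub_pos.2 hxy
  refine mem_segment_prod.2 ⟨(z.1 - x.1) / (y.1 - x.1), div_nonneg (sub_nonneg.2 h1) hpos.le,
    (div_le_one hpos).2 (by linarith), ?_, ?_⟩
  · field_simp; ring
  · unfold orient at h0
    field_simp
    linarith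

theorem orient_pos_iff_of_disjoint {x y p q : ℝ × ℝ} (hxy : x.1 < y.1)
    (hd : ∀ r ∈ segment ℝ p q, r ∉ segment ℝ x y)
    (hr : ∀ r ∈ segment ℝ p q, x.1 ≤ r.1 ∧ r.1 ≤ y.1) :
    0 < orient x y p ↔ 0 < orient x y q := by
  have key : ∀ p q, (∀ r ∈ segment ℝ p q, r ∉ segment ℝ x y) →
      (∀ r ∈ segment ℝ p q, x.1 ≤ r.1 ∧ r.1 ≤ y.1) → 0 < orient x y p → 0 < orient x y q := by
    intro p q hd hr hp
    by_contra! hle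
    obtain ⟨z, hz, h0⟩ := exists_mem_segment_eq_zero (continuous_orient x y) hp.le hle
    exact hd z hz (mem_segment_of_fst hxy h0 (hr z hz).1 (hr z hz).2)
  refine ⟨key p q hd hr, key q p ?_ ?_⟩ <;> rw [segment_symm] <;> assumption

theorem exists_mem_segment_fst_eq {x y p q v : ℝ × ℝ} (hxy : x.1 < y.1) (hpq : p.1 < q.1)
    (hv : v = x ∨ v = y) (h1 : p.1 ≤ v.1) (h2 : v.1 ≤ q.1) :
    ∃ z ∈ segment ℝ p q, z.1 = v.1 ∧ (0 < orient x y z ↔ orient p q v < 0) := by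
  have hpos := sub_pos.2 hpq
  have hpos' := sub_pos.2 hxy
  have e1 : v.1 = p.1 + (v.1 - p.1) / (q.1 - p.1) * (q.1 - p.1) := by field_simp; ring
  refine ⟨(v.1, p.2 + (v.1 - p.1) / (q.1 - p.1) * (q.2 - p.2)),
    mem_segment_prod.2 ⟨(v.1 - p.1) / (q.1 - p.1), div_nonneg (sub_nonneg.2 h1) hpos.le,
    (div_le_one hpos).2 (by linarith), e1, rfl⟩, rfl, ?_⟩
  set w := p.2 + (v.1 - p.1) / (q.1 - p.1) * (q.2 - p.2) with hw
  have e2 : orient x y (v.1, w) = (y.1 - x.1) * (w - v.2) := by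
    unfold orient
    rcases hv with rfl | rfl <;> ring
  have e3 : orient p q v = (q.1 - p.1) * (v.2 - w) := by
    unfold orient
    rw [hw]; field_simp; ring
  rw [e2, e3, mul_pos_iff_of_pos_left hpos', ← neg_pos, ← mul_neg, mul_pos_iff_of_pos_left hpos]
  constructor <;> intro h <;> linarith

/-- The vertical ray going down from `q` crosses the segment `xy`. -/
def Hits (q x y : ℝ × ℝ) : Prop :=
  (x.1 ≤ q.1 ∧ q.1 < y.1 ∧ 0 < orient x y q) ∨ (y.1 ≤ q.1 ∧ q.1 < x.1 ∧ 0 < orient y x q)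

/-- The point `v` lies in the vertical strip below the segment `pq`. -/
def InStrip (p q v : ℝ × ℝ) : Prop := p.1 < v.1 ∧ v.1 ≤ q.1 ∧ orient p q v < 0

theorem Hits.symm {q x y : ℝ × ℝ} (h : Hits q x y) : Hits q y x := Or.symm h

theorem hits_add_of_lt {p q x y : ℝ × ℝ} (hpq : p.1 ≤ q.1) (hxy : x.1 < y.1)
    (hd : ∀ r ∈ segment ℝ p q, r ∉ segment ℝ x y) :
    ((if Hits p x y then 1 else 0) + (if Hits q x y then 1 else 0) : ZMod 2) =
      (if InStrip p q x then 1 else 0) + (if InStrip p q y then 1 else 0) := by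
  have hp : Hits p x y ↔ x.1 ≤ p.1 ∧ p.1 < y.1 ∧ 0 < orient x y p :=
    or_iff_left fun h => by linarith [h.1, h.2.1]
  have hq : Hits q x y ↔ x.1 ≤ q.1 ∧ q.1 < y.1 ∧ 0 < orient x y q :=
    or_iff_left fun h => by linarith [h.1, h.2.1]
  rcases le_or_gt y.1 p.1 with g1 | g1
  · rw [if_neg, if_neg, if_neg, if_neg]
    · rintro ⟨h1, -⟩; linarith
    · rintro ⟨h1, -⟩; linarith
    · rw [hq]; rintro ⟨-, h1, -⟩; linarith
    · rw [hp]; rintro ⟨-, h1, -⟩; linarith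
  rcases lt_or_ge q.1 x.1 with g2 | g2
  · rw [if_neg, if_neg, if_neg, if_neg]
    · rintro ⟨-, h1, -⟩; linarith
    · rintro ⟨-, h1, -⟩; linarith
    · rw [hq]; rintro ⟨h1, -⟩; linarith
    · rw [hp]; rintro ⟨h1, -⟩; linarith
  have left : ∃ z ∈ segment ℝ p q, x.1 ≤ z.1 ∧ z.1 ≤ y.1 ∧
      (((if Hits p x y then 1 else 0) : ZMod 2) - (if InStrip p q x then 1 else 0)) =
        if 0 < orient x y z then 1 else 0 := by
    rcases le_or_gt x.1 p.1 with g3 | g3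
    · refine ⟨p, left_mem_segment ℝ p q, g3, g1.le, ?_⟩
      rw [if_neg fun h : InStrip p q x => h.1.not_ge g3, sub_zero]
      congr 1
      rw [hp]
      simp [g3, g1]
    · obtain ⟨z, hz, hz1, hz2⟩ := exists_mem_segment_fst_eq (q := q) hxy (by linarith) (Or.inl rfl)
        g3.le g2
      refine ⟨z, hz, hz1.ge, by linarith, ?_⟩
      rw [if_neg (by rw [hp]; exact fun h => g3.not_ge h.1), zero_sub, ZMod.neg_eq_self_mod_two]
      congr 1
      simp [InStrip, hz2, g3, g2]
  have right : ∃ z ∈ segment ℝ p q, x.1 ≤ z.1 ∧ z.1 ≤ y.1 ∧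
      (((if Hits q x y then 1 else 0) : ZMod 2) - (if InStrip p q y then 1 else 0)) =
        if 0 < orient x y z then 1 else 0 := by
    rcases lt_or_ge q.1 y.1 with g3 | g3
    · refine ⟨q, right_mem_segment ℝ p q, g2, g3.le, ?_⟩
      rw [if_neg fun h : InStrip p q y => h.2.1.not_gt g3, sub_zero]
      congr 1
      rw [hq]
      simp [g3, g2]
    · obtain ⟨z, hz, hz1, hz2⟩ := exists_mem_segment_fst_eq (p := p) hxy (by linarith) (Or.inr rfl)
        g1.le g3
      refine ⟨z, hz, by linarith, hz1.le, ?_⟩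
      rw [if_neg (by rw [hq]; exact fun h => g3.not_gt h.2.1), zero_sub, ZMod.neg_eq_self_mod_two]
      congr 1
      simp [InStrip, hz2, g3, g1]
  obtain ⟨z, hz, z1, z2, ez⟩ := left
  obtain ⟨z', hz', z1', z2', ez'⟩ := right
  have := orient_pos_iff_of_disjoint (p := z) (q := z') hxy
    (fun r hr => hd r (segment_subset_of_mem hz hz' hr)) (fun r hr => by
      obtain ⟨t, t0, t1, r1, -⟩ := mem_segment_prod.1 hr
      rw [r1]
      constructor <;> nlinarith)
  simp only [this] at ez
  rw [← ez', sub_eq_sub_iff_add_eq_add] at ez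
  have e2 : ∀ a b c d : ZMod 2, a + b = c + d → a + c = d + b := by decide
  exact e2 _ _ _ _ ez

theorem hits_comm (q x y : ℝ × ℝ) : Hits q x y ↔ Hits q y x := ⟨Hits.symm, Hits.symm⟩

theorem hits_add {p q x y : ℝ × ℝ} (hpq : p.1 ≤ q.1) (hxy : x.1 ≠ y.1)
    (hd : ∀ r ∈ segment ℝ p q, r ∉ segment ℝ x y) :
    ((if Hits p x y then 1 else 0) + (if Hits q x y then 1 else 0) : ZMod 2) =
      (if InStrip p q x then 1 else 0) + (if InStrip p q y then 1 else 0) := by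
  rcases lt_or_gt_of_ne hxy with h | h
  · exact hits_add_of_lt hpq h hd
  · rw [segment_symm] at hd
    simp only [hits_comm _ x y]
    rw [add_comm (if InStrip p q x then 1 else 0)]
    refine hits_add_of_lt hpq h fun r hr => ?_
    rw [segment_symm]
    rw [segment_symm] at hr
    exact hd r hr

/-- The number modulo two of edges of the walk `l` crossed by the ray going down from `q`. -/
noncomputable def hits (q : ℝ × ℝ) : List (ℝ × ℝ) → ZMod 2
  | [] => 0
  | [_] => 0
  | x :: y :: l => (if Hits q x y then 1 else 0) + hits q (y :: l)

theorem hits_add_hits_chain {p q : ℝ × ℝ} (hpq : p.1 ≤ q.1) (x : ℝ × ℝ) (l : List (ℝ × ℝ))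
    (z : ℝ × ℝ) (hl : (x :: l ++ [z]).IsChain fun x y => x.1 ≠ y.1 ∧
      ∀ r ∈ segment ℝ p q, r ∉ segment ℝ x y) :
    hits p (x :: l ++ [z]) + hits q (x :: l ++ [z]) =
      (if InStrip p q x then 1 else 0) + (if InStrip p q z then 1 else 0) := by
  induction l generalizing x with
  | nil =>
    simp only [List.cons_append, List.nil_append, List.isChain_cons_cons] at hl
    simp only [List.cons_append, List.nil_append, hits, add_zero]
    exact hits_add hpq hl.1.1 hl.1.2
  | cons y l ih =>
    simp only [List.cons_append, List.isChain_cons_cons] at hl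
    have e := ih y hl.2
    have e' := hits_add hpq hl.1.1 hl.1.2
    simp only [List.cons_append, hits] at e ⊢
    linear_combination e + e' + zmod_two_self (x := if InStrip p q y then (1 : ZMod 2) else 0)

theorem hits_eq_hits {p q x : ℝ × ℝ} {l : List (ℝ × ℝ)}
    (hl : (x :: l ++ [x]).IsChain fun x y => x.1 ≠ y.1 ∧ ∀ r ∈ segment ℝ p q, r ∉ segment ℝ x y) :
    hits p (x :: l ++ [x]) = hits q (x :: l ++ [x]) := by
  rcases le_total p.1 q.1 with hpq | hpq
  · have := hits_add_hits_chain hpq x l x hl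
    rwa [zmod_two_self, CharTwo.add_eq_zero] at this
  · simp only [segment_symm ℝ p q] at hl
    have := hits_add_hits_chain hpq x l x hl
    rw [zmod_two_self, CharTwo.add_eq_zero] at this
    exact this.symm

theorem hits_add_hits_eq_pathInd {p q a b : ℝ × ℝ} {l : List (ℝ × ℝ)}
    (hl : l.IsChain fun x y => ((if Hits p x y then 1 else 0) + (if Hits q x y then 1 else 0) :
      ZMod 2) = if s(x, y) = s(a, b) then 1 else 0) :
    hits p l + hits q l = pathInd l a b := by
  induction l with
  | nil => simp [hits, pathInd]
  | cons x l ih =>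
    cases l with
    | nil => simp [hits, pathInd]
    | cons y l =>
      rw [List.isChain_cons_cons] at hl
      have e := ih hl.2
      have e' := hl.1
      simp only [hits, pathInd]
      by_cases hs : s(x, y) = s(a, b)
      · rw [if_pos hs] at e' ⊢
        linear_combination e + e'
      · rw [if_neg hs] at e' ⊢
        linear_combination e + e'

theorem rel_of_pathInd_ne_zero {V : Type*} {R : V → V → Prop} (symm : ∀ a b, R a b → R b a)
    {l : List V} {a b : V} (hl : l.IsChain R) (h : pathInd l a b ≠ 0) : R a b := by
  induction l with
  | nil => exact absurd rfl h
  | cons x l ih =>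
    cases l with
    | nil => exact absurd rfl h
    | cons y l =>
      rw [List.isChain_cons_cons] at hl
      simp only [pathInd] at h
      by_cases he : s(x, y) = s(a, b)
      · rcases Sym2.eq_iff.1 he with ⟨rfl, rfl⟩ | ⟨rfl, rfl⟩
        · exact hl.1
        · exact symm _ _ hl.1
      · rw [if_neg he, zero_add] at h
        exact ih hl.2 h

theorem hits_eq_zero_of_fst {q : ℝ × ℝ} {l : List (ℝ × ℝ)} (h : ∀ x ∈ l, x.1 ≤ q.1) :
    hits q l = 0 := by
  induction l with
  | nil => rfl
  | cons x l ih =>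
    cases l with
    | nil => rfl
    | cons y l =>
      have e := ih fun x hx => h x (List.mem_cons_of_mem _ hx)
      have hx := h x (by simp)
      have hy := h y (by simp)
      simp only [hits]
      rw [e, if_neg, zero_add]
      rintro (⟨-, h1, -⟩ | ⟨-, h1, -⟩) <;> linarith

/-- Just below and just above an edge, the numbers of crossings with the edge differ by one. -/
theorem hits_add_of_mem {a b m : ℝ × ℝ} (hab : a.1 < b.1) (hm : m ∈ segment ℝ a b) (hmb : m ≠ b)
    {e : ℝ} (he : 0 < e) {x y : ℝ × ℝ} (hxy : s(x, y) = s(a, b)) :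
    ((if Hits (m.1, m.2 - e) x y then 1 else 0) +
      (if Hits (m.1, m.2 + e) x y then 1 else 0) : ZMod 2) = 1 := by
  have h0 := orient_eq_zero_of_mem hm
  obtain ⟨t, t0, t1, m1, m2⟩ := mem_segment_prod.1 hm
  have t1 : t < 1 := lt_of_le_of_ne t1 fun hx => hmb (by
    subst hx
    exact Prod.ext (by rw [m1]; ring) (by rw [m2]; ring))
  have l1 : a.1 ≤ m.1 := by nlinarith
  have l2 : m.1 < b.1 := by nlinarith
  have e1 : orient a b (m.1, m.2 - e) = orient a b m - (b.1 - a.1) * e := by unfold orient; ring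
  have e2 : orient a b (m.1, m.2 + e) = orient a b m + (b.1 - a.1) * e := by unfold orient; ring
  have hpos := mul_pos (sub_pos.2 hab) he
  have k1 : ¬Hits (m.1, m.2 - e) a b := by
    rintro (⟨-, -, h⟩ | ⟨h1, h2, -⟩)
    · rw [e1, h0] at h; linarith
    · exact absurd (h1.trans_lt h2) hab.not_gt
  have k2 : Hits (m.1, m.2 + e) a b := Or.inl ⟨l1, l2, by rw [e2, h0]; linarith⟩
  rcases Sym2.eq_iff.1 hxy with ⟨rfl, rfl⟩ | ⟨rfl, rfl⟩
  · rw [if_neg k1, if_pos k2, zero_add]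
  · rw [if_neg fun h => k1 h.symm, if_pos k2.symm, zero_add]

theorem rotation_of_eq {a b c a' b' c' : ℝ × ℝ} (h : 0 < orient a b c) (h' : 0 < orient a' b' c')
    (he : ({a, b, c} : Finset (ℝ × ℝ)) = {a', b', c'}) :
    (a' = a ∧ b' = b ∧ c' = c) ∨ (a' = b ∧ b' = c ∧ c' = a) ∨ (a' = c ∧ b' = a ∧ c' = b) := by
  have ha : a' ∈ ({a, b, c} : Finset (ℝ × ℝ)) := he ▸ by simp
  have hb : b' ∈ ({a, b, c} : Finset (ℝ × ℝ)) := he ▸ by simp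
  have hc : c' ∈ ({a, b, c} : Finset (ℝ × ℝ)) := he ▸ by simp
  simp only [Finset.mem_insert, Finset.mem_singleton] at ha hb hc
  have z1 : ∀ x y, ¬0 < orient x x y := fun x y => (orient_self x y).not_gt
  have z2 : ∀ x y, ¬0 < orient x y x := fun x y => (orient_self_left x y).not_gt
  have z3 : ∀ x y, ¬0 < orient x y y := fun x y => (orient_self_right x y).not_gt
  have z4 : ∀ x y z, 0 < orient x y z → ¬0 < orient y x z := fun x y z h h' => by
    rw [orient_swap] at h'
    linarith
  have h1 := z4 _ _ _ h
  have h2 := z4 _ _ _ ((orient_rotate a b c).symm ▸ h)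
  have h3 := z4 _ _ _ ((orient_rotate b c a).symm ▸ (orient_rotate a b c).symm ▸ h)
  clear he
  rcases ha with rfl | rfl | rfl <;> rcases hb with rfl | rfl | rfl <;>
    rcases hc with rfl | rfl | rfl <;>
    first
    | exact absurd h' (z1 _ _)
    | exact absurd h' (z2 _ _)
    | exact absurd h' (z3 _ _)
    | contradiction
    | tauto

theorem mem_of_isChain {V : Type*} {P : Finset V} {x : V} {l : List V}
    (hl : (x :: l).IsChain fun a b => a ∈ P ∧ b ∈ P) (hx : x ∈ P) : ∀ v ∈ x :: l, v ∈ P := by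
  induction l generalizing x with
  | nil => simpa using hx
  | cons y l ih =>
    rw [List.isChain_cons_cons] at hl
    intro v hv
    rcases List.mem_cons.1 hv with rfl | hv
    · exact hx
    · exact ih hl.2 hl.1.2 v hv

namespace MaximalDrawing
variable {P : Finset (ℝ × ℝ)} {E : ℝ × ℝ → ℝ × ℝ → Prop}
  {a b c m p q z z' x : ℝ × ℝ} {l : List (ℝ × ℝ)}

theorem hits_eq_hits (h : MaximalDrawing P E) (hfst : ∀ x ∈ P, ∀ y ∈ P, x.1 = y.1 → x = y)
    (hl : (x :: l ++ [x]).IsChain fun a b => E a b ∧ a ≠ b)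
    (hd : ∀ r ∈ segment ℝ p q, ∀ a b, E a b → a ≠ b → r ∉ segment ℝ a b) :
    hits p (x :: l ++ [x]) = hits q (x :: l ++ [x]) :=
  _root_.hits_eq_hits (hl.imp fun a b hab =>
    ⟨fun he => hab.2 (hfst _ (h.mem _ _ hab.1) _ (h.mem_right hab.1) he),
      fun r hr => hd r hr a b hab.1 hab.2⟩)

theorem hits_eq_of_face (h : MaximalDrawing P E) (hfst : ∀ x ∈ P, ∀ y ∈ P, x.1 = y.1 → x = y)
    (hl : (x :: l ++ [x]).IsChain fun a b => E a b ∧ a ≠ b) (hf : Face P E a b c)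
    (hz : 0 < orient a b z ∧ 0 < orient b c z ∧ 0 < orient c a z)
    (hz' : 0 < orient a b z' ∧ 0 < orient b c z' ∧ 0 < orient c a z') :
    hits z (x :: l ++ [x]) = hits z' (x :: l ++ [x]) :=
  h.hits_eq_hits hfst hl fun _ hr _ _ hpq _ hrs => h.edge_not_mem_interior hf hpq hrs
    ((convex_triangle a b c).segment_subset hz hz' hr)

theorem hits_add_hits (h : MaximalDrawing P E) (hfst : ∀ x ∈ P, ∀ y ∈ P, x.1 = y.1 → x = y)
    (hl : (x :: l ++ [x]).IsChain fun a b => E a b ∧ a ≠ b)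
    (hab : E a b) (hlt : a.1 < b.1) (hm : m ∈ segment ℝ a b) (hma : m ≠ a)
    (hmb : m ≠ b) : ∀ᶠ e in nhdsWithin (0 : ℝ) (Set.Ioi 0),
      hits (m.1, m.2 - e) (x :: l ++ [x]) + hits (m.1, m.2 + e) (x :: l ++ [x]) =
        pathInd (x :: l ++ [x]) a b := by
  have hO := (h.isCompact_edges s(a, b)).isClosed.isOpen_compl
  obtain ⟨δ, hδ, hball⟩ := Metric.isOpen_iff.1 hO m (by
    rintro ⟨c, d, hcd, hne, hmem⟩
    exact hne (h.sym2_eq_of_mem hab hm hma hmb hcd hmem))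
  filter_upwards [Ioo_mem_nhdsGT hδ] with e he
  refine hits_add_hits_eq_pathInd (hl.imp fun c d hcd => ?_)
  by_cases hs : s(c, d) = s(a, b)
  · rw [if_pos hs]
    exact hits_add_of_mem hlt hm hmb he.1 hs
  · rw [if_neg hs, hits_add (p := (m.1, m.2 - e)) (q := (m.1, m.2 + e)) le_rfl, if_neg, if_neg,
      add_zero]
    · rintro ⟨h1, h2, -⟩; exact h2.not_gt h1
    · rintro ⟨h1, h2, -⟩; exact h2.not_gt h1
    · exact fun he => hcd.2 (hfst _ (h.mem _ _ hcd.1) _ (h.mem_right hcd.1) he)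
    · intro r hr hrs
      have hmem : r ∈ Metric.ball m δ := by
        refine (convex_ball m δ).segment_subset ?_ ?_ hr <;>
          simp [Metric.mem_ball, Prod.dist_eq, abs_of_pos he.1, he.2, hδ]
      exact hball hmem ⟨c, d, hcd.1, fun h => hs h.symm, hrs⟩

end MaximalDrawing

namespace Hull
variable {P : Finset (ℝ × ℝ)} {E : ℝ × ℝ → ℝ × ℝ → Prop} {A B C : ℝ × ℝ}
  {a b c m p q x z : ℝ × ℝ} {l : List (ℝ × ℝ)} {T : Finset (ℝ × ℝ)}

theorem ne_of_face (H : Hull P A B C)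
    (hf : Face P E a b c) : ({A, B, C} : Finset (ℝ × ℝ)) ≠ {a, b, c} := by
  intro he
  rcases rotation_of_eq H.pos hf.pos he with ⟨rfl, rfl, rfl⟩ | ⟨rfl, rfl, rfl⟩ | ⟨rfl, rfl, rfl⟩
  · exact H.not_face hf
  · exact H.rotate.not_face hf
  · exact H.rotate.rotate.not_face hf

theorem hits_eq_zero_of_neg (H : Hull P A B C) (h : MaximalDrawing P E)
    (hfst : ∀ x ∈ P, ∀ y ∈ P, x.1 = y.1 → x = y)
    (hl : (x :: l ++ [x]).IsChain fun a b => E a b ∧ a ≠ b)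
    (hq : orient A B q < 0) : hits q (x :: l ++ [x]) = 0 := by
  obtain ⟨M, hM⟩ := (P.image Prod.fst).bddAbove
  have hM : ∀ v ∈ P, v.1 ≤ M := fun v hv => hM (by simpa using ⟨v.2, hv⟩)
  have hAB : B.1 - A.1 ≠ 0 := fun h0 =>
    H.ne (hfst _ H.mem.1 _ H.mem.2.1 (by linarith))
  set q' : ℝ × ℝ := (M, q.2 + (M - q.1) / (B.1 - A.1) * (B.2 - A.2)) with hq'
  have hq'' : orient A B q' = orient A B q := by
    unfold orient
    rw [hq']
    field_simp
    ring
  rw [h.hits_eq_hits hfst hl (q := q')]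
  · refine hits_eq_zero_of_fst fun v hv => hM v ?_
    refine mem_of_isChain (hl.imp fun a b hab => ⟨h.mem _ _ hab.1, h.mem_right hab.1⟩) ?_ v hv
    cases l with
    | nil => exact h.mem _ _ (List.isChain_cons_cons.1 hl).1.1
    | cons y l => exact h.mem _ _ (List.isChain_cons_cons.1 hl).1.1
  · intro r hr c d hcd _ hrs
    obtain ⟨t, t0, t1, r1, r2⟩ := mem_segment_prod.1 hr
    obtain ⟨s, s0, s1, s1', s2'⟩ := mem_segment_prod.1 hrs
    have e1 := orient_segment A B _ _ r1 r2
    have e2 := orient_segment A B _ _ s1' s2'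
    rw [hq''] at e1
    have k1 := mul_nonneg (sub_nonneg.2 s1) (H.nonneg (h.mem _ _ hcd)).1
    have k2 := mul_nonneg s0 (H.nonneg (h.mem_right hcd)).1
    linarith

/-- The bounded faces around which the closed walk winds an odd number of times fill the walk. -/
theorem exists_filling (H : Hull P A B C) (h : MaximalDrawing P E)
    (hfst : ∀ x ∈ P, ∀ y ∈ P, x.1 = y.1 → x = y)
    (hl : (x :: l ++ [x]).IsChain fun a b => E a b ∧ a ≠ b) : ∃ S ⊆ faces P E A B C, ∀ a b, a ≠ b →
    bd S a b = pathInd (x :: l ++ [x]) a b := by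
  set S := (faces P E A B C).filter fun T => ∃ a b c z, Face P E a b c ∧ T = {a, b, c} ∧
    (0 < orient a b z ∧ 0 < orient b c z ∧ 0 < orient c a z) ∧ hits z (x :: l ++ [x]) = 1 with hS
  have hSf : ∀ a b c z, Face P E a b c →
      (0 < orient a b z ∧ 0 < orient b c z ∧ 0 < orient c a z) →
      (if {a, b, c} ∈ S then 1 else 0) = hits z (x :: l ++ [x]) := by
    intro a b c z hf hz
    split_ifs with hmem
    · obtain ⟨-, a', b', c', z', hf', he, hz', h1⟩ := Finset.mem_filter.1 hmem
      rw [← h1]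
      refine h.hits_eq_of_face hfst hl hf' hz' ?_
      rcases rotation_of_eq hf.pos hf'.pos he with
        ⟨rfl, rfl, rfl⟩ | ⟨rfl, rfl, rfl⟩ | ⟨rfl, rfl, rfl⟩ <;> tauto
    · by_contra h0
      have h2 : ∀ n : ZMod 2, 0 ≠ n → n = 1 := by decide
      refine hmem (Finset.mem_filter.2 ⟨(H.mem_faces h).2 (Or.inr ⟨a, b, c, hf, rfl⟩),
        a, b, c, z, hf, rfl, hz, h2 _ h0⟩)
  have hSo : {A, B, C} ∉ S := by
    intro hmem
    obtain ⟨-, a', b', c', z', hf', he, -⟩ := Finset.mem_filter.1 hmem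
    exact H.ne_of_face hf' he
  have hSl : ∀ a b m T, LeftFace P E A B C a b T → m ∈ segment ℝ a b → m ≠ a → m ≠ b →
      ∀ᶠ z in nhds m, 0 < orient a b z → (if T ∈ S then 1 else 0) = hits z (x :: l ++ [x]) := by
    rintro a b m T (⟨c, hf, rfl⟩ | ⟨hs, rfl⟩) hm hma hmb
    · filter_upwards [hf.eventually hm hma hmb] with z hz hpos
      exact hSf a b c z hf ⟨hpos, hz⟩
    · refine Filter.Eventually.of_forall fun z hz => ?_
      rw [if_neg hSo]
      symm
      rw [orient_swap b a z] at hz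
      rcases hs with ⟨rfl, rfl⟩ | ⟨rfl, rfl⟩ | ⟨rfl, rfl⟩
      · exact H.hits_eq_zero_of_neg h hfst hl (by linarith)
      · exact H.rotate.hits_eq_zero_of_neg h hfst hl (by linarith)
      · exact H.rotate.rotate.hits_eq_zero_of_neg h hfst hl (by linarith)
  refine ⟨S, Finset.filter_subset _ _, ?_⟩
  have key : ∀ a b, E a b → a.1 < b.1 → bd S a b = pathInd (x :: l ++ [x]) a b := by
    intro a b hab hlt
    have hne : a ≠ b := by rintro rfl; exact hlt.false
    obtain ⟨m, hm, hma, hmb⟩ := exists_mem_segment_ne hne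
    obtain ⟨T, hT⟩ := H.exists_leftFace h hab hne
    obtain ⟨T', hT'⟩ := H.exists_leftFace h (h.symm _ _ hab) hne.symm
    have c1 : Filter.Tendsto (fun e : ℝ => (m.1, m.2 + e)) (nhdsWithin 0 (Set.Ioi 0)) (nhds m) := by
      have : Continuous fun e : ℝ => (m.1, m.2 + e) := by fun_prop
      simpa using (this.tendsto 0).mono_left nhdsWithin_le_nhds
    have c2 : Filter.Tendsto (fun e : ℝ => (m.1, m.2 - e)) (nhdsWithin 0 (Set.Ioi 0)) (nhds m) := by
      have : Continuous fun e : ℝ => (m.1, m.2 - e) := by fun_prop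
      simpa using (this.tendsto 0).mono_left nhdsWithin_le_nhds
    obtain ⟨e, he, h1, h2, h3⟩ := ((eventually_mem_nhdsWithin (s := Set.Ioi (0 : ℝ))).and
      ((h.hits_add_hits hfst hl hab hlt hm hma hmb).and
        ((c1.eventually (hSl a b m T hT hm hma hmb)).and
          (c2.eventually (hSl b a m T' hT' (segment_symm ℝ a b ▸ hm) hmb hma))))).exists
    have he : 0 < e := he
    have hpos := mul_pos (sub_pos.2 hlt) he
    have h0 := orient_eq_zero_of_mem hm
    have h2 := h2 (by
      have : orient a b (m.1, m.2 + e) = orient a b m + (b.1 - a.1) * e := by unfold orient; ring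
      linarith)
    have h3 := h3 (by
      have : orient b a (m.1, m.2 - e) = -orient a b m + (b.1 - a.1) * e := by unfold orient; ring
      linarith)
    rw [← h1, ← h2, ← h3]
    obtain ⟨-, ta, tb, -⟩ := H.leftFace_mem h hT
    obtain ⟨-, tb', ta', -⟩ := H.leftFace_mem h hT'
    have hTT := H.leftFace_ne hT hT'
    have hb : ∀ R ∈ S, a ∈ R → b ∈ R → R = T ∨ R = T' := by
      intro R hR ha hb
      rcases H.leftFace_of_mem h (Finset.mem_filter.1 hR).1 ha hb hne with hr | hr
      · exact Or.inl (H.leftFace_unique h hr hT)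
      · exact Or.inr (H.leftFace_unique h hr hT')
    have hsum : bd S a b = ∑ R ∈ S, ((if R = T' then 1 else 0) + if R = T then 1 else 0) := by
      refine Finset.sum_congr rfl fun R hR => ?_
      by_cases hR1 : R = T'
      · subst hR1
        rw [if_pos ⟨ta', tb'⟩, if_pos rfl, if_neg hTT.symm, add_zero]
      by_cases hR2 : R = T
      · subst hR2
        rw [if_pos ⟨ta, tb⟩, if_neg hR1, if_pos rfl, zero_add]
      rw [if_neg hR1, if_neg hR2, if_neg, add_zero]
      rintro ⟨k1, k2⟩
      rcases hb R hR k1 k2 with k | k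
      · exact hR2 k
      · exact hR1 k
    rw [hsum, Finset.sum_add_distrib, Finset.sum_ite_eq', Finset.sum_ite_eq']
  intro a b hne
  by_cases hab : E a b
  · rcases lt_or_gt_of_ne fun he => hne (hfst _ (h.mem _ _ hab) _ (h.mem_right hab) he) with g | g
    · exact key a b hab g
    · rw [bd_comm, pathInd_comm]
      exact key b a (h.symm _ _ hab) g
  · have z1 : bd S a b = 0 := by
      by_contra h0
      obtain ⟨T, hT, ha, hb⟩ := exists_of_bd_ne_zero h0
      exact hab (H.adj_of_mem_faces h (Finset.mem_filter.1 hT).1 ha hb hne)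
    have z2 : pathInd (x :: l ++ [x]) a b = 0 := by
      by_contra h0
      exact hab (rel_of_pathInd_ne_zero h.symm (hl.imp fun _ _ h => h.1) h0)
    rw [z1, z2]

theorem isSphere (H : Hull P A B C) (h : MaximalDrawing P E)
    (hfst : ∀ x ∈ P, ∀ y ∈ P, x.1 = y.1 → x = y) : IsSphere (faces P E A B C) where
  card_face _ hT := H.card_face h hT
  exists_opposite _ hT _ ha _ hb hab := H.exists_opposite h hT ha hb hab
  connected_at _ hS _ hbd _ hT hw _ hT' hw' := H.connected_at h hS hbd hT hw hT' hw'
  connected _ hS hbd := H.connected h hS hbd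
  exists_filling _ _ hl := H.exists_filling h hfst (hl.imp fun _ _ hab => by
    obtain ⟨hne, T, hT, ha, hb⟩ := hab
    exact ⟨H.adj_of_mem_faces h hT ha hb hne, hne⟩)

end Hull

theorem exists_maximalDrawing {P : Finset (ℝ × ℝ)} {E₀ : ℝ × ℝ → ℝ × ℝ → Prop}
    (mem : ∀ a b, E₀ a b → a ∈ P) (symm : ∀ a b, E₀ a b → E₀ b a)
    (vertex : ∀ p ∈ P, ∀ a b, E₀ a b → p ∈ segment ℝ a b → p = a ∨ p = b)
    (cross : ∀ a b c d, E₀ a b → E₀ c d → s(a, b) ≠ s(c, d) → ∀ r ∈ segment ℝ a b,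
      r ∈ segment ℝ c d → (r = a ∨ r = b) ∧ (r = c ∨ r = d)) :
    ∃ E, MaximalDrawing P E ∧ ∀ a b, E₀ a b → E a b := by
  let Good : Finset ((ℝ × ℝ) × (ℝ × ℝ)) → Prop := fun R =>
    (∀ a b, E₀ a b → (a, b) ∈ R) ∧ (∀ a ∈ P, (a, a) ∈ R) ∧ (∀ a b, (a, b) ∈ R → (b, a) ∈ R) ∧
    ∀ a b c d, (a, b) ∈ R → (c, d) ∈ R → s(a, b) ≠ s(c, d) → ∀ r ∈ segment ℝ a b,
      r ∈ segment ℝ c d → (r = a ∨ r = b) ∧ (r = c ∨ r = d)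
  have h0 : ((P ×ˢ P).powerset.filter Good).Nonempty := by
    refine ⟨(P ×ˢ P).filter fun e => e.1 = e.2 ∨ E₀ e.1 e.2, Finset.mem_filter.2
      ⟨Finset.mem_powerset.2 (Finset.filter_subset _ _), ?_, ?_, ?_, ?_⟩⟩ <;>
      simp only [Finset.mem_filter, Finset.mem_product]
    · exact fun a b h => ⟨⟨mem a b h, mem b a (symm a b h)⟩, Or.inr h⟩
    · exact fun a ha => ⟨⟨ha, ha⟩, Or.inl trivial⟩
    · rintro a b ⟨⟨ha, hb⟩, rfl | h⟩
      · exact ⟨⟨ha, ha⟩, Or.inl rfl⟩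
      · exact ⟨⟨hb, ha⟩, Or.inr (symm a b h)⟩
    · rintro a b c d ⟨⟨ha, -⟩, rfl | h⟩ ⟨⟨hc, -⟩, rfl | h'⟩ hne r hr hr'
      · rw [segment_same, Set.mem_singleton_iff] at hr hr'
        exact absurd (by rw [← hr, ← hr']) hne
      · rw [segment_same, Set.mem_singleton_iff] at hr
        subst hr
        exact ⟨Or.inl rfl, vertex _ ha _ _ h' hr'⟩
      · rw [segment_same, Set.mem_singleton_iff] at hr'
        subst hr'
        exact ⟨vertex _ hc _ _ h hr, Or.inl rfl⟩
      · exact cross a b c d h h' hne r hr hr'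
  obtain ⟨R, hR, hmax⟩ := Finset.exists_max_image _ Finset.card h0
  obtain ⟨hRP, g0, g1, g2, g3⟩ := Finset.mem_filter.1 hR
  rw [Finset.mem_powerset] at hRP
  refine ⟨fun a b => (a, b) ∈ R, ⟨fun a b h => (Finset.mem_product.1 (hRP h)).1, g2, g1, g3, ?_⟩,
    g0⟩
  intro a ha b hb hab
  set R' := insert (a, b) (insert (b, a) R) with hR'
  have hmem : ∀ c d, (c, d) ∈ R' ↔ s(c, d) = s(a, b) ∨ (c, d) ∈ R := by
    intro c d
    rw [hR', Finset.mem_insert, Finset.mem_insert, Sym2.eq_iff, Prod.mk.injEq c d a b,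
      Prod.mk.injEq c d b a, or_assoc]
  have hsub : R ⊆ R' := fun e he => Finset.mem_insert_of_mem (Finset.mem_insert_of_mem he)
  have hcross : ∀ c d e g, s(c, d) = s(a, b) → (e, g) ∈ R → s(c, d) ≠ s(e, g) →
      ∀ r ∈ segment ℝ c d, r ∈ segment ℝ e g → (r = c ∨ r = d) ∧ (r = e ∨ r = g) := by
    intro c d e g hs h' hne r hr hr'
    rw [hs] at hne
    rw [segment_eq_of_sym2 hs] at hr
    have := hab e g h' hne r hr hr'
    rcases Sym2.eq_iff.1 hs with ⟨rfl, rfl⟩ | ⟨rfl, rfl⟩ <;> tauto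
  have hgood : R' ∈ (P ×ˢ P).powerset.filter Good := by
    refine Finset.mem_filter.2 ⟨?_, fun a b h => hsub (g0 a b h), fun a ha => hsub (g1 a ha),
      ?_, ?_⟩
    · simp only [hR', Finset.mem_powerset, Finset.insert_subset_iff, Finset.mem_product]
      exact ⟨⟨ha, hb⟩, ⟨hb, ha⟩, hRP⟩
    · intro c d
      rw [hmem, hmem, Sym2.eq_swap]
      exact Or.imp id (g2 c d)
    · intro c d e g h1 h2 hne r hr hr'
      rcases (hmem _ _).1 h1 with h1 | h1 <;> rcases (hmem _ _).1 h2 with h2 | h2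
      · exact absurd (h1.trans h2.symm) hne
      · exact hcross c d e g h1 h2 hne r hr hr'
      · exact (hcross e g c d h2 h1 hne.symm r hr' hr).symm
      · exact g3 c d e g h1 h2 hne r hr hr'
  have he := Finset.eq_of_subset_of_card_le hsub (hmax R' hgood)
  rw [he]
  exact Finset.mem_insert_self _ _

theorem exists_shear {V : Type*} [Finite V] {f : V → ℝ × ℝ} (hf : Function.Injective f) :
    ∃ k : ℝ, ∀ v w, (f v).1 + k * (f v).2 = (f w).1 + k * (f w).2 → v = w := by
  have hfin : (Set.range fun e : V × V =>
      -(((f e.1).1 - (f e.2).1) / ((f e.1).2 - (f e.2).2))).Finite := Set.finite_range _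
  obtain ⟨k, hk⟩ := hfin.infinite_compl.nonempty
  refine ⟨k, fun v w h => hf ?_⟩
  by_cases h2 : (f v).2 = (f w).2
  · rw [h2] at h
    exact Prod.ext (by linarith) h2
  · refine absurd ⟨(v, w), ?_⟩ hk
    have := sub_ne_zero.2 h2
    simp only
    field_simp
    linarith

theorem exists_hull {Q : Finset (ℝ × ℝ)} (hQ : Q.Nonempty) :
    ∃ A B C : ℝ × ℝ, Hull (insert A (insert B (insert C Q))) A B C ∧
      (∀ p ∈ Q, 0 < orient A B p ∧ 0 < orient B C p ∧ 0 < orient C A p) ∧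
      A.1 ≠ B.1 ∧ B.1 ≠ C.1 ∧ C.1 ≠ A.1 ∧ ∀ p ∈ Q, p.1 ≠ A.1 ∧ p.1 ≠ B.1 ∧ p.1 ≠ C.1 := by
  obtain ⟨M, hM0, hM⟩ : ∃ M : ℝ, 0 < M ∧ ∀ p ∈ Q, |p.1| < M ∧ |p.2| < M := by
    obtain ⟨M, hM⟩ := (Q.image fun p => max |p.1| |p.2|).bddAbove
    have hM : ∀ p ∈ Q, |p.1| ≤ M ∧ |p.2| ≤ M := fun p hp =>
      max_le_iff.1 (hM (Finset.mem_coe.2 (Finset.mem_image_of_mem (fun p => max |p.1| |p.2|) hp)))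
    refine ⟨|M| + 1, by positivity, fun p hp => ?_⟩
    have := le_abs_self M
    constructor <;> linarith [(hM p hp).1, (hM p hp).2]
  set A : ℝ × ℝ := (-10 * M, -2 * M) with hA
  set B : ℝ × ℝ := (10 * M, -2 * M) with hB
  set C : ℝ × ℝ := (2 * M, 20 * M) with hC
  have hin : ∀ p ∈ Q, 0 < orient A B p ∧ 0 < orient B C p ∧ 0 < orient C A p := by
    intro p hp
    obtain ⟨h1, h2⟩ := hM p hp
    rw [abs_lt] at h1 h2
    refine ⟨?_, ?_, ?_⟩
    · have : orient A B p = M * (20 * (p.2 + 2 * M)) := by unfold orient; simp [hA, hB]; ring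
      rw [this]
      exact mul_pos hM0 (by linarith)
    · have : orient B C p = M * (-8 * p.2 - 22 * p.1 + 204 * M) := by
        unfold orient; simp [hC, hB]; ring
      rw [this]
      exact mul_pos hM0 (by linarith)
    · have : orient C A p = M * (-12 * p.2 + 22 * p.1 + 196 * M) := by
        unfold orient; simp [hC, hA]; ring
      rw [this]
      exact mul_pos hM0 (by linarith)
  refine ⟨A, B, C, ⟨?_, by simp, ?_, ?_⟩, hin, ?_, ?_, ?_, ?_⟩
  · have : orient A B C = 440 * (M * M) := by unfold orient; simp [hA, hB, hC]; ring
    rw [this]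
    positivity
  · intro p hp
    simp only [Finset.mem_insert] at hp
    rcases hp with hp | hp | hp | hp
    · exact Or.inl hp
    · exact Or.inr (Or.inl hp)
    · exact Or.inr (Or.inr (Or.inl hp))
    · exact Or.inr (Or.inr (Or.inr (hin p hp)))
  · obtain ⟨p, hp⟩ := hQ
    exact ⟨p, by simp [hp], hin p hp⟩
  · simp only [hA, hB]; intro h; linarith
  · simp only [hC, hB]; intro h; linarith
  · simp only [hA, hC]; intro h; linarith
  · intro p hp
    obtain ⟨h1, -⟩ := hM p hp
    rw [abs_lt] at h1
    simp only [hA, hB, hC]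
    refine ⟨?_, ?_, ?_⟩ <;> intro h <;> linarith

/-- A planar graph with an edge can be drawn as part of a triangulation, with the vertices having
distinct abscissas. -/
theorem IsPlanar.exists_triangulation {V : Type*} [Finite V] {G : SimpleGraph V} (hG : IsPlanar G)
    {u v : V} (huv : G.Adj u v) : ∃ (f : V → ℝ × ℝ) (P : Finset (ℝ × ℝ))
      (E : ℝ × ℝ → ℝ × ℝ → Prop) (A B C : ℝ × ℝ), Function.Injective f ∧ Hull P A B C ∧
      MaximalDrawing P E ∧ (∀ x ∈ P, ∀ y ∈ P, x.1 = y.1 → x = y) ∧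
      ∀ a b, G.Adj a b → E (f a) (f b) := by
  obtain ⟨f₀, hinj, hplane⟩ := hG
  obtain ⟨k, hk⟩ := exists_shear hinj
  set f : V → ℝ × ℝ := fun v => ((f₀ v).1 + k * (f₀ v).2, (f₀ v).2) with hf
  have hfinj : Function.Injective f := fun v w h => hk v w (congrArg Prod.fst h)
  have hfseg : ∀ r a b, r ∈ segment ℝ (f a) (f b) →
      (r.1 - k * r.2, r.2) ∈ segment ℝ (f₀ a) (f₀ b) := by
    intro r a b hr
    obtain ⟨t, t0, t1, r1, r2⟩ := mem_segment_prod.1 hr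
    refine mem_segment_prod.2 ⟨t, t0, t1, ?_, r2⟩
    simp only [hf] at r1 r2
    rw [r1, r2]
    ring
  have hplane' : ∀ a b c d, G.Adj a b → G.Adj c d → s(a, b) ≠ s(c, d) → ∀ r,
      r ∈ segment ℝ (f a) (f b) → r ∈ segment ℝ (f c) (f d) →
      ∃ w, r = f w ∧ (w = a ∨ w = b) ∧ (w = c ∨ w = d) := by
    intro a b c d hab hcd hne r hr hr'
    obtain ⟨w, ⟨h1, h2⟩, h3⟩ := hplane a b c d hab hcd hne ⟨hfseg _ _ _ hr, hfseg _ _ _ hr'⟩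
    refine ⟨w, ?_, h1, h2⟩
    simp only [hf, h3]
    exact Prod.ext (by simp) rfl
  have hfin : {p | ∃ a b, G.Adj a b ∧ f a = p}.Finite :=
    (Set.finite_range f).subset (by rintro p ⟨a, b, -, rfl⟩; exact ⟨a, rfl⟩)
  set Q := hfin.toFinset with hQ
  have hQm : ∀ p, p ∈ Q ↔ ∃ a b, G.Adj a b ∧ f a = p := fun p => hfin.mem_toFinset
  obtain ⟨A, B, C, H, hin, n1, n2, n3, hne⟩ := exists_hull (Q := Q)
    ⟨f u, (hQm _).2 ⟨u, v, huv, rfl⟩⟩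
  have : ∃ E, MaximalDrawing (insert A (insert B (insert C Q))) E ∧
      ∀ p q, (∃ a b, G.Adj a b ∧ f a = p ∧ f b = q) → E p q := by
    refine exists_maximalDrawing ?_ ?_ ?_ ?_
    · rintro _ _ ⟨a, b, hab, rfl, rfl⟩
      simp only [Finset.mem_insert]
      exact Or.inr (Or.inr (Or.inr ((hQm _).2 ⟨a, b, hab, rfl⟩)))
    · rintro _ _ ⟨a, b, hab, rfl, rfl⟩
      exact ⟨b, a, hab.symm, rfl, rfl⟩
    · rintro p hp _ _ ⟨a, b, hab, rfl, rfl⟩ hps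
      have hinside : 0 < orient A B p ∧ 0 < orient B C p ∧ 0 < orient C A p :=
        (convex_triangle A B C).segment_subset (hin _ ((hQm _).2 ⟨a, b, hab, rfl⟩))
          (hin _ ((hQm _).2 ⟨b, a, hab.symm, rfl⟩)) hps
      simp only [Finset.mem_insert] at hp
      rcases hp with rfl | rfl | rfl | hp
      · exact absurd hinside.1 (orient_self_left _ _).not_gt
      · exact absurd hinside.1 (orient_self_right _ _).not_gt
      · exact absurd hinside.2.1 (orient_self_right _ _).not_gt
      · obtain ⟨c, d, hcd, rfl⟩ := (hQm _).1 hp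
        by_cases hs : s(a, b) = s(c, d)
        · rcases Sym2.eq_iff.1 hs with ⟨rfl, -⟩ | ⟨-, rfl⟩
          · exact Or.inl rfl
          · exact Or.inr rfl
        · obtain ⟨w, h1, h2, -⟩ := hplane' a b c d hab hcd hs _ hps (left_mem_segment ℝ _ _)
          rw [h1]
          exact h2.imp (congrArg f) (congrArg f)
    · rintro _ _ _ _ ⟨a, b, hab, rfl, rfl⟩ ⟨c, d, hcd, rfl, rfl⟩ hs r hr hr'
      obtain ⟨w, rfl, h2, h3⟩ := hplane' a b c d hab hcd (fun he => hs (by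
        rcases Sym2.eq_iff.1 he with ⟨rfl, rfl⟩ | ⟨rfl, rfl⟩
        · rfl
        · exact Sym2.eq_swap)) r hr hr'
      exact ⟨h2.imp (congrArg f) (congrArg f), h3.imp (congrArg f) (congrArg f)⟩
  obtain ⟨E, hE, hE'⟩ := this
  refine ⟨f, _, E, A, B, C, hfinj, H, hE, ?_, fun a b hab => hE' _ _ ⟨a, b, hab, rfl, rfl⟩⟩
  intro x hx y hy hxy
  simp only [Finset.mem_insert] at hx hy
  have hQinj : x ∈ Q → y ∈ Q → x = y := by
    intro hx hy
    obtain ⟨a, -, -, rfl⟩ := (hQm _).1 hx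
    obtain ⟨b, -, -, rfl⟩ := (hQm _).1 hy
    rw [hk a b hxy]
  have hx' := hne x
  have hy' := hne y
  rcases hx with rfl | rfl | rfl | hx <;> rcases hy with rfl | rfl | rfl | hy <;>
    first | rfl | exact hQinj hx hy | (exfalso; grind)

theorem chainDrawing_edge {V : Type*} {u v : V} (huv : u ≠ v) :
    ChainDrawing u v (fun a b => (a = u ∨ a = v) ∧ (b = u ∨ b = v))
      (fun w => if w = v then ((1 : ℝ), (0 : ℝ)) else (0, 0)) [u, v] := by
  have hu : (if u = v then ((1 : ℝ), (0 : ℝ)) else (0, 0)) = (0, 0) := if_neg huv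
  have hv : (if v = v then ((1 : ℝ), (0 : ℝ)) else (0, 0)) = (1, 0) := if_pos rfl
  have hsnd : ∀ w, (if w = v then ((1 : ℝ), (0 : ℝ)) else (0, 0)).2 = 0 := by
    intro w
    split_ifs <;> rfl
  refine ⟨fun a b h => ⟨h.2, h.1⟩, fun a b h => ⟨h.1, h.1⟩, ?_, ?_, ?_, ?_, ?_, ?_, ?_⟩
  · refine (Set.toFinite {u, v}).subset ?_
    rintro w ⟨h, -⟩
    exact h
  · rintro a b ⟨rfl | rfl, -⟩ ⟨rfl | rfl, -⟩ h <;> simp_all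
  · rintro a b c d ⟨rfl | rfl, rfl | rfl⟩ ⟨rfl | rfl, rfl | rfl⟩ hne p ⟨hp, hp'⟩ <;>
      simp only [hu, segment_same, Set.mem_singleton_iff] at hp hp' <;>
      first
        | exact absurd rfl hne
        | exact absurd Sym2.eq_swap hne
        | (subst hp; simp_all)
        | (subst hp'; simp_all)
  · intro c hc
    simp only [List.mem_cons, List.not_mem_nil, or_false] at hc
    exact ⟨hc, hc⟩
  · simp [huv]
  · intro c hc a b h p hp hpc
    obtain ⟨t, -, -, -, h2⟩ := mem_segment_prod.1 hp
    simp only [hsnd] at h2 ⊢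
    linarith
  · rintro w ⟨h, -⟩ h1 h2
    exact absurd h (not_or.2 ⟨h1, h2⟩)

/-- A triangulated sphere can be drawn in the upper half plane with a given edge on the boundary. -/
theorem IsSphere.exists_drawing {V : Type*} {𝓕 : Finset (Finset V)} (h : IsSphere 𝓕) {u v : V}
    (huv : FaceEdge 𝓕 u v) : ∃ H g L, ChainDrawing u v H g L ∧ g u = (0, 0) ∧ g v = (1, 0) ∧
      ∀ a b, FaceEdge 𝓕 a b → H a b := by
  obtain ⟨hne, T, hT, hu, hv⟩ := huv
  obtain ⟨w, hw, hwu, hwv⟩ : ∃ w ∈ T, w ≠ u ∧ w ≠ v := by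
    obtain ⟨w, hw, hw'⟩ := Finset.exists_mem_notMem_of_card_lt_card (s := {u, v}) (t := T) (by
      rw [h.card_face T hT, Finset.card_pair hne]
      norm_num)
    simp only [Finset.mem_insert, Finset.mem_singleton, not_or] at hw'
    exact ⟨w, hw, hw'⟩
  have hTe : ∀ x, x ∈ T ↔ x = u ∨ x = v ∨ x = w := by
    have : {u, v, w} = T := by
      refine Finset.eq_of_subset_of_card_le ?_ ?_
      · simp [Finset.insert_subset_iff, hu, hv, hw]
      · rw [h.card_face T hT, Finset.card_eq_three.2 ⟨u, v, w, hne, hwu.symm, hwv.symm, rfl⟩]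
    intro x
    simp [← this]
  have hdraw := h.drawable (u₀ := u) (v₀ := v) (𝓕.erase T) (Finset.erase_subset _ _)
    (fun he => Finset.notMem_erase T 𝓕 (he.symm.subset hT)) u v [w, v] _ _ [] [] (by
      simp [hne, hwv, hwu.symm]) rfl (by
      simp only [List.cons_append, List.nil_append, List.isChain_cons_cons,
        List.isChain_singleton, and_true]
      exact ⟨⟨hwu.symm, T, hT, hu, hw⟩, ⟨hwv, T, hT, hw, hv⟩, ⟨hne.symm, T, hT, hv, hu⟩⟩) (by
      intro a b hab
      rw [bd_erase (S := 𝓕) hT, h.bd_univ hab]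
      simp only [hTe]
      rw [triangle_pairs hne hwu.symm hwv.symm hab]
      simp only [List.cons_append, List.nil_append, pathInd]
      rw [Sym2.eq_swap (a := v) (b := u)]
      ring) (chainDrawing_edge hne) ⟨Or.inl rfl, Or.inr rfl⟩ (fun _ _ _ _ hw => hw.1)
  obtain ⟨H, g, hE, hD⟩ := hdraw
  refine ⟨H, g, _, hD, ?_, ?_, ?_⟩
  · rw [hE.agree u ⟨Or.inl rfl, Or.inl rfl⟩, if_neg hne]
  · rw [hE.agree v ⟨Or.inr rfl, Or.inr rfl⟩, if_pos rfl]
  · rintro a b ⟨hab, S, hS, ha, hb⟩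
    by_cases hST : S = T
    · obtain ⟨S', hS', hne', ha', hb', -⟩ := h.exists_opposite S hS a ha b hb hab
      exact hE.faces S' (Finset.mem_erase.2 ⟨hST ▸ hne', hS'⟩) a ha' b hb'
    · exact hE.faces S (Finset.mem_erase.2 ⟨hST, hS⟩) a ha b hb

/-- A planar graph can be drawn in the upper half plane with a given edge on the boundary. -/
theorem IsPlanar.exists_halfPlane_drawing {V : Type*} [Finite V] {G : SimpleGraph V}
    (hG : IsPlanar G) {u v : V} (huv : G.Adj u v) : ∃ h : V → ℝ × ℝ, h u = (0, 0) ∧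
      h v = (1, 0) ∧ (∀ a b, (∃ c, G.Adj a c) → (∃ c, G.Adj b c) → h a = h b → a = b) ∧
      (∀ a, (∃ c, G.Adj a c) → a ≠ u → a ≠ v → 0 < (h a).2) ∧
      ∀ a b c d : V, G.Adj a b → G.Adj c d → s(a, b) ≠ s(c, d) →
        segment ℝ (h a) (h b) ∩ segment ℝ (h c) (h d) ⊆ h '' ({a, b} ∩ {c, d} : Set V) := by
  obtain ⟨f, P, E, A, B, C, hf, hull, hM, hfst, hE⟩ := hG.exists_triangulation huv
  have hedge : ∀ a b, G.Adj a b → FaceEdge (faces P E A B C) (f a) (f b) := by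
    intro a b hab
    obtain ⟨T, hT⟩ := hull.exists_leftFace hM (hE a b hab) (hf.ne hab.ne)
    obtain ⟨h1, h2, h3, h4⟩ := hull.leftFace_mem hM hT
    exact ⟨h4, T, h1, h2, h3⟩
  obtain ⟨H, g, L, hD, hu, hv, hH⟩ := (hull.isSphere hM hfst).exists_drawing (hedge u v huv)
  have hloop : ∀ a, (∃ c, G.Adj a c) → H (f a) (f a) := fun a ⟨c, hc⟩ =>
    hD.left _ _ (hH _ _ (hedge a c hc))
  refine ⟨g ∘ f, hu, hv, ?_, ?_, ?_⟩
  · intro a b ha hb hab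
    exact hf (hD.fst_inj _ _ (hloop a ha) (hloop b hb) (congrArg Prod.fst hab))
  · intro a ha hau hav
    exact hD.pos _ (hloop a ha) (hf.ne hau) (hf.ne hav)
  · intro a b c d hab hcd hne p hp
    obtain ⟨w, ⟨h1, h2⟩, rfl⟩ := hD.planar _ _ _ _ (hH _ _ (hedge a b hab)) (hH _ _ (hedge c d hcd))
      (fun he => hne (by
        rcases Sym2.eq_iff.1 he with ⟨h1, h2⟩ | ⟨h1, h2⟩
        · rw [hf h1, hf h2]
        · rw [hf h1, hf h2, Sym2.eq_swap])) hp
    simp only [Set.mem_insert_iff, Set.mem_singleton_iff] at h1 h2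
    rcases h1 with rfl | rfl
    · exact ⟨a, ⟨Or.inl rfl, h2.imp (fun h => hf h) (fun h => hf h)⟩, rfl⟩
    · exact ⟨b, ⟨Or.inr rfl, h2.imp (fun h => hf h) (fun h => hf h)⟩, rfl⟩

theorem eq_or_eq_of_mem_segment_of_snd_eq_zero {x y p : ℝ × ℝ} (ε : ℝ) (hp : p ∈ segment ℝ x y)
    (hx : 0 ≤ ε * x.2) (hy : 0 ≤ ε * y.2) (hxy : 0 < ε * x.2 ∨ 0 < ε * y.2) :
    0 ≤ ε * p.2 ∧ (p.2 = 0 → p = x ∨ p = y) := by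
  obtain ⟨t, t0, t1, h1, h2⟩ := mem_segment_prod.1 hp
  have e : ε * p.2 = (1 - t) * (ε * x.2) + t * (ε * y.2) := by rw [h2]; ring
  have hx' := mul_nonneg (sub_nonneg.2 t1) hx
  have hy' := mul_nonneg t0 hy
  refine ⟨by linarith, fun h0 => ?_⟩
  rw [h0, mul_zero] at e
  rcases hxy with h | h
  · right
    have : 1 - t = 0 := (mul_eq_zero.1 (le_antisymm (by linarith) hx')).resolve_right h.ne'
    obtain rfl : t = 1 := by linarith
    exact Prod.ext (by linarith) (by linarith)
  · left
    obtain rfl : t = 0 := (mul_eq_zero.1 (le_antisymm (by linarith) hy')).resolve_right h.ne'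
    exact Prod.ext (by linarith) (by linarith)

theorem exists_injective_avoiding {V : Type*} [Finite V] {s : Set (ℝ × ℝ)} (hs : s.Finite) :
    ∃ e : V → ℝ × ℝ, Function.Injective e ∧ ∀ a, e a ∉ s := by
  have := hs.infinite_compl.to_subtype
  obtain ⟨n, ⟨φ⟩⟩ := Finite.exists_equiv_fin V
  exact ⟨fun a => Infinite.natEmbedding (sᶜ : Set (ℝ × ℝ)) (φ a), fun a b hab => φ.injective
    (Fin.ext ((Infinite.natEmbedding _).injective (Subtype.ext hab))),
    fun a => (Infinite.natEmbedding (sᶜ : Set (ℝ × ℝ)) (φ a)).prop⟩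

theorem neg_snd_mem_segment {x y p : ℝ × ℝ} (hp : p ∈ segment ℝ (x.1, -x.2) (y.1, -y.2)) :
    (p.1, -p.2) ∈ segment ℝ x y := by
  obtain ⟨t, t0, t1, h1, h2⟩ := mem_segment_prod.1 hp
  simp only at h1 h2
  exact mem_segment_prod.2 ⟨t, t0, t1, h1, by simp only; linarith⟩

theorem two_sum_planar {V : Type*} [Fintype V] [DecidableEq V]
    (G1 G2 : SimpleGraph V) (A B : Set V) (u v : V) (huv : u ≠ v)
    (hAB : A ∩ B = {u, v})
    (hA : ∀ a b : V, G1.Adj a b → a ∈ A ∧ b ∈ A)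
    (hB : ∀ a b : V, G2.Adj a b → a ∈ B ∧ b ∈ B)
    (h1 : G1.Adj u v) (h2 : G2.Adj u v)
    (hp1 : IsPlanar G1) (hp2 : IsPlanar G2) :
    IsPlanar (G1 ⊔ G2) := by
  obtain ⟨f, fu, fv, finj, fpos, fplanar⟩ := hp1.exists_halfPlane_drawing h1
  obtain ⟨g, gu, gv, ginj, gpos, gplanar⟩ := hp2.exists_halfPlane_drawing h2
  obtain ⟨e, einj, hes⟩ := exists_injective_avoiding (V := V)
    ((Set.finite_range f).union (Set.finite_range fun a => ((g a).1, -(g a).2)))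
  set F : V → ℝ × ℝ := fun a => if ∃ c, G1.Adj a c then f a else
    if ∃ c, G2.Adj a c then ((g a).1, -(g a).2) else e a with hF
  have common : ∀ a, (∃ c, G1.Adj a c) → (∃ c, G2.Adj a c) → a = u ∨ a = v := by
    rintro a ⟨c, hc⟩ ⟨d, hd⟩
    have : a ∈ A ∩ B := ⟨(hA _ _ hc).1, (hB _ _ hd).1⟩
    rwa [hAB] at this
  have u1 : ∃ c, G1.Adj u c := ⟨v, h1⟩
  have v1 : ∃ c, G1.Adj v c := ⟨u, h1.symm⟩
  have Ff : ∀ a, (∃ c, G1.Adj a c) → F a = f a := fun a ha => if_pos ha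
  have Fg : ∀ a, (∃ c, G2.Adj a c) → F a = ((g a).1, -(g a).2) := by
    intro a ha
    by_cases ha' : ∃ c, G1.Adj a c
    · rw [Ff a ha']
      rcases common a ha' ha with rfl | rfl
      · rw [fu, gu, neg_zero]
      · rw [fv, gv, neg_zero]
    · simp only [hF, if_neg ha', if_pos ha]
  have Fe : ∀ a, (¬ ∃ c, G1.Adj a c) → (¬ ∃ c, G2.Adj a c) → F a = e a := by
    intro a ha ha'
    simp only [hF, if_neg ha, if_neg ha']
  have Fpos : ∀ a, (∃ c, G1.Adj a c) → 0 ≤ 1 * (F a).2 ∧ (a ≠ u → a ≠ v → 0 < 1 * (F a).2) := by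
    intro a ha
    rw [Ff a ha, one_mul]
    refine ⟨?_, fpos a ha⟩
    by_cases hu : a = u
    · rw [hu, fu]
    · by_cases hv : a = v
      · rw [hv, fv]
      · exact (fpos a ha hu hv).le
  have Fneg : ∀ a, (∃ c, G2.Adj a c) →
      0 ≤ (-1) * (F a).2 ∧ (a ≠ u → a ≠ v → 0 < (-1) * (F a).2) := by
    intro a ha
    rw [Fg a ha, neg_one_mul, neg_neg]
    refine ⟨?_, gpos a ha⟩
    by_cases hu : a = u
    · rw [hu, gu]
    · by_cases hv : a = v
      · rw [hv, gv]
      · exact (gpos a ha hu hv).le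
  have apart : ∀ a b, (∃ c, G1.Adj a c) → (¬ ∃ c, G1.Adj b c) → (∃ c, G2.Adj b c) → F a ≠ F b := by
    intro a b ha hb hb' hab
    have h := (Fpos a ha).1
    have h' := (Fneg b hb').2 (fun h => hb (h ▸ u1)) (fun h => hb (h ▸ v1))
    rw [hab] at h
    linarith
  have eF : ∀ a b, (¬ ∃ c, G1.Adj a c) → (¬ ∃ c, G2.Adj a c) → F a = F b → a = b := by
    intro a b ha ha' hab
    rw [Fe a ha ha'] at hab
    by_cases hb : ∃ c, G1.Adj b c
    · rw [Ff b hb] at hab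
      exact absurd (Or.inl ⟨b, hab.symm⟩) (hes a)
    · by_cases hb' : ∃ c, G2.Adj b c
      · rw [Fg b hb'] at hab
        exact absurd (Or.inr ⟨b, hab.symm⟩) (hes a)
      · rw [Fe b hb hb'] at hab
        exact einj hab
  have Finj : Function.Injective F := by
    intro a b hab
    by_cases ha : ∃ c, G1.Adj a c
    · by_cases hb : ∃ c, G1.Adj b c
      · rw [Ff a ha, Ff b hb] at hab
        exact finj a b ha hb hab
      · by_cases hb' : ∃ c, G2.Adj b c
        · exact absurd hab (apart a b ha hb hb')
        · exact (eF b a hb hb' hab.symm).symm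
    · by_cases ha' : ∃ c, G2.Adj a c
      · by_cases hb : ∃ c, G1.Adj b c
        · exact absurd hab.symm (apart b a hb ha ha')
        · by_cases hb' : ∃ c, G2.Adj b c
          · rw [Fg a ha', Fg b hb', Prod.mk.injEq, neg_inj] at hab
            exact ginj a b ha' hb' (Prod.ext hab.1 hab.2)
          · exact (eF b a hb hb' hab.symm).symm
      · exact eF a b ha ha' hab
  have both1 : ∀ a b c d, G1.Adj a b → G1.Adj c d → s(a, b) ≠ s(c, d) →
      segment ℝ (F a) (F b) ∩ segment ℝ (F c) (F d) ⊆ F '' ({a, b} ∩ {c, d} : Set V) := by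
    intro a b c d hab hcd hne p hp
    rw [Ff a ⟨b, hab⟩, Ff b ⟨a, hab.symm⟩, Ff c ⟨d, hcd⟩, Ff d ⟨c, hcd.symm⟩] at hp
    obtain ⟨w, hw, rfl⟩ := fplanar a b c d hab hcd hne hp
    refine ⟨w, hw, Ff w ?_⟩
    rcases hw.1 with rfl | rfl
    exacts [⟨b, hab⟩, ⟨a, hab.symm⟩]
  have both2 : ∀ a b c d, G2.Adj a b → G2.Adj c d → s(a, b) ≠ s(c, d) →
      segment ℝ (F a) (F b) ∩ segment ℝ (F c) (F d) ⊆ F '' ({a, b} ∩ {c, d} : Set V) := by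
    intro a b c d hab hcd hne p hp
    rw [Fg a ⟨b, hab⟩, Fg b ⟨a, hab.symm⟩, Fg c ⟨d, hcd⟩, Fg d ⟨c, hcd.symm⟩] at hp
    obtain ⟨w, hw, hwp⟩ := gplanar a b c d hab hcd hne
      ⟨neg_snd_mem_segment hp.1, neg_snd_mem_segment hp.2⟩
    refine ⟨w, hw, (Fg w ?_).trans ?_⟩
    · rcases hw.1 with rfl | rfl
      exacts [⟨b, hab⟩, ⟨a, hab.symm⟩]
    · rw [hwp, neg_neg]
  have other : ∀ a b, a ≠ b → s(a, b) ≠ s(u, v) → (a ≠ u ∧ a ≠ v) ∨ (b ≠ u ∧ b ≠ v) := by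
    intro a b hab hne
    rw [Ne, Sym2.eq_iff] at hne
    grind
  have mixed : ∀ a b c d, G1.Adj a b → G2.Adj c d → s(a, b) ≠ s(c, d) →
      segment ℝ (F a) (F b) ∩ segment ℝ (F c) (F d) ⊆ F '' ({a, b} ∩ {c, d} : Set V) := by
    intro a b c d hab hcd hne
    by_cases hab' : s(a, b) = s(u, v)
    · refine both2 a b c d ?_ hcd hne
      rwa [← SimpleGraph.mem_edgeSet, hab']
    by_cases hcd' : s(c, d) = s(u, v)
    · refine both1 a b c d hab ?_ hne
      rwa [← SimpleGraph.mem_edgeSet, hcd']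
    rintro p ⟨hp, hp'⟩
    have ha := Fpos a ⟨b, hab⟩
    have hb := Fpos b ⟨a, hab.symm⟩
    have hc := Fneg c ⟨d, hcd⟩
    have hd := Fneg d ⟨c, hcd.symm⟩
    obtain ⟨k1, k2⟩ := eq_or_eq_of_mem_segment_of_snd_eq_zero 1 hp ha.1 hb.1
      ((other a b hab.ne hab').imp (fun h => ha.2 h.1 h.2) fun h => hb.2 h.1 h.2)
    obtain ⟨k3, k4⟩ := eq_or_eq_of_mem_segment_of_snd_eq_zero (-1) hp' hc.1 hd.1
      ((other c d hcd.ne hcd').imp (fun h => hc.2 h.1 h.2) fun h => hd.2 h.1 h.2)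
    have h0 : p.2 = 0 := by linarith
    rcases k2 h0 with rfl | rfl
    · exact ⟨a, ⟨Or.inl rfl, (k4 h0).imp (fun h => Finj h) fun h => Finj h⟩, rfl⟩
    · exact ⟨b, ⟨Or.inr rfl, (k4 h0).imp (fun h => Finj h) fun h => Finj h⟩, rfl⟩
  refine ⟨F, Finj, ?_⟩
  rintro a b c d (hab | hab) (hcd | hcd) hne
  · exact both1 a b c d hab hcd hne
  · exact mixed a b c d hab hcd hne
  · rw [Set.inter_comm, Set.inter_comm {a, b}]
    exact mixed c d a b hcd hab hne.symm
  · exact both2 a b c d hab hcd hne
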